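/- Let p be a prime number and H a Hopf algebra over k of dimension p². Then H is isomorphic as a Hopf algebra to exactly one of: (a) the group algebra k[Z_{p²}]; (b) the group algebra k[Z_p × Z_p]; (c) a Taft algebra T(ω) for some primitive p-th root of unity ω ∈ k. -/

import Mathlib

open scoped TensorProduct

/-- A group-like element of a coalgebra: a nonzero element `a` with `Δ a = a ⊗ a`. -/
def IsGroupLike (k : Type*) {H : Type*} [CommSemiring k] [AddCommMonoid H] [Module k H]
    [Coalgebra k H] (a : H) : Prop :=
  a ≠ 0 ∧ Coalgebra.comul (R := k) a = a ⊗ₜ[k] a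

/-- The convolution product on the dual of a coalgebra. -/
noncomputable def conv {k H : Type*} [CommSemiring k] [AddCommMonoid H] [Module k H]
    [Coalgebra k H] (f g : Module.Dual k H) : Module.Dual k H :=
  LinearMap.mul' k k ∘ₗ TensorProduct.map f g ∘ₗ Coalgebra.comul

/-- `l ∈ H*` is a right integral of `H*`: `l * β = β(1) • l` for the convolution product. -/
def IsRightIntegralDual (k : Type*) {H : Type*} [CommSemiring k] [Semiring H]
    [HopfAlgebra k H] (l : Module.Dual k H) : Prop :=
  ∀ f : Module.Dual k H, conv l f = f 1 • l

/-- `Λ ∈ H` is a left integral of `H`: `a * Λ = ε(a) • Λ` for all `a`. -/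
def IsLeftIntegral (k : Type*) {H : Type*} [CommSemiring k] [Semiring H]
    [HopfAlgebra k H] (L : H) : Prop :=
  ∀ a : H, a * L = Coalgebra.counit (R := k) a • L

/-- `Λ ∈ H` is a right integral of `H`: `Λ * a = ε(a) • Λ` for all `a`. -/
def IsRightIntegral (k : Type*) {H : Type*} [CommSemiring k] [Semiring H]
    [HopfAlgebra k H] (L : H) : Prop :=
  ∀ a : H, L * a = Coalgebra.counit (R := k) a • L

/-- `g` is the distinguished group-like element of `H`: it is group-like and
`β * λ = β(g) • λ` for some nonzero right integral `λ` of `H*`. -/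
def IsDistinguishedGroupLike (k : Type*) {H : Type*} [CommSemiring k] [Semiring H]
    [HopfAlgebra k H] (g : H) : Prop :=
  IsGroupLike k g ∧ ∃ l : Module.Dual k H, l ≠ 0 ∧ IsRightIntegralDual k l ∧
    ∀ f : Module.Dual k H, conv f l = f g • l

/-- `α` is the distinguished group-like element of `H*`: an algebra map `H → k` with
`Λ * a = α(a) • Λ` for some nonzero left integral `Λ` of `H`. -/
def IsDistinguishedGroupLikeDual (k : Type*) {H : Type*} [CommSemiring k] [Semiring H]
    [HopfAlgebra k H] (α : H →ₐ[k] k) : Prop :=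
  ∃ L : H, L ≠ 0 ∧ IsLeftIntegral k L ∧ ∀ a : H, L * a = α a • L

/-- `IsHopfIndex k g n` : `n` is the index of the Hopf algebra `H` with distinguished
group-like element `g`, i.e. the smallest positive integer `n` with `S ^ (4 n) = id` and
`g ^ n = 1`, where `S` is the antipode. -/
def IsHopfIndex (k : Type*) {H : Type*} [CommSemiring k] [Semiring H] [HopfAlgebra k H]
    (g : H) (n : ℕ) : Prop :=
  0 < n ∧ (HopfAlgebra.antipode (R := k) (A := H) : Module.End k H) ^ (4 * n) = 1 ∧ g ^ n = 1 ∧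
    ∀ m : ℕ, 0 < m → (HopfAlgebra.antipode (R := k) (A := H) : Module.End k H) ^ (4 * m) = 1 →
      g ^ m = 1 → n ≤ m

/-- The simultaneous eigenspace `H^ω_{a,i,j} = {u ∈ H | S² u = (-1)^a ω^i • u, u * g = ω^j • u}`
for `(a,i,j) ∈ ℤ/2 × ℤ/n × ℤ/n`. -/
noncomputable def hopfEigenspace {k H : Type*} [CommRing k] [Ring H] [HopfAlgebra k H]
    (g : H) (ω : k) {n : ℕ} (t : ZMod 2 × ZMod n × ZMod n) : Submodule k H :=
  Module.End.eigenspace ((HopfAlgebra.antipode (R := k) (A := H) : Module.End k H) ^ 2)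
      ((-1 : k) ^ t.1.val * ω ^ t.2.1.val) ⊓
    Module.End.eigenspace (LinearMap.mulRight k g : Module.End k H) (ω ^ t.2.2.val)

/-- Convolution powers of an element of the dual; the zeroth power is the counit,
the unit of the convolution algebra. -/
noncomputable def convPow {k H : Type*} [CommSemiring k] [AddCommMonoid H] [Module k H]
    [Coalgebra k H] (f : Module.Dual k H) : ℕ → Module.Dual k H
  | 0 => Coalgebra.counit
  | m + 1 => conv f (convPow f m)

/-- Taft algebra as in stmt 4 context. -/
def IsTaftAlgebra (k : Type*) {H : Type*} [CommRing k] [Ring H] [HopfAlgebra k H]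
    (ξ : k) (n : ℕ) : Prop :=
  ∃ a x : H, a ^ n = 1 ∧ a * x = ξ • (x * a) ∧ x ^ n = 0 ∧
    Coalgebra.comul (R := k) a = a ⊗ₜ[k] a ∧
    Coalgebra.comul (R := k) x = x ⊗ₜ[k] a + 1 ⊗ₜ[k] x ∧
    Coalgebra.counit (R := k) a = 1 ∧ Coalgebra.counit (R := k) x = 0 ∧
    HopfAlgebra.antipode (R := k) a = a ^ (n - 1) ∧
    HopfAlgebra.antipode (R := k) x = -(x * a ^ (n - 1)) ∧
    Algebra.adjoin k {a, x} = ⊤ ∧ Module.finrank k H = n ^ 2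

/-- `H` is isomorphic, as a Hopf algebra over `k`, to the group algebra `k[G]`.
Equivalently: there is an injective homomorphism of monoids `φ : G → H` whose values are
group-like elements of `H` and whose range spans `H` (group-like elements are linearly
independent, so such a `φ` extends to a Hopf algebra isomorphism `k[G] ≅ H` and conversely). -/
def IsGroupAlgebraOf (k : Type*) (G : Type*) (H : Type*) [CommSemiring k] [Monoid G]
    [Semiring H] [HopfAlgebra k H] : Prop :=
  ∃ φ : G →* H, Function.Injective φ ∧ (∀ s : G, IsGroupLike k (φ s)) ∧
    Submodule.span k (Set.range φ) = ⊤

section HopfTheory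

open Coalgebra HopfAlgebra
set_option linter.unusedSectionVars false

attribute [fun_prop] IsLinearMap

section Lin
variable {k M N P A : Type*} [CommSemiring k] [AddCommMonoid M] [Module k M] [AddCommMonoid N] [Module k N]
  [AddCommMonoid P] [Module k P] [Semiring A] [Algebra k A]

@[fun_prop] theorem IsLinearMap.id_fun : IsLinearMap k (fun x : M => x) := ⟨fun _ _ => rfl, fun _ _ => rfl⟩

@[fun_prop] theorem IsLinearMap.comp_fun {f : N → P} {g : M → N} (hf : IsLinearMap k f) (hg : IsLinearMap k g) :
    IsLinearMap k (fun x => f (g x)) :=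
  ⟨fun x y => by rw [hg.map_add, hf.map_add], fun c x => by rw [hg.map_smul, hf.map_smul]⟩

@[fun_prop] theorem LinearMap.isLinearMap_comp (L : N →ₗ[k] P) {f : M → N} (hf : IsLinearMap k f) :
    IsLinearMap k (fun x => L (f x)) := ⟨fun x y => by simp [hf.map_add], fun c x => by simp [hf.map_smul]⟩

@[fun_prop] theorem IsLinearMap.apply_linearMap {f : M → (N →ₗ[k] P)} (hf : IsLinearMap k f) (c : N) :
    IsLinearMap k (fun x => f x c) := ⟨fun x y => by simp [hf.map_add], fun c x => by simp [hf.map_smul]⟩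

@[fun_prop] theorem IsLinearMap.mul_const_fun {f : M → A} (hf : IsLinearMap k f) (c : A) :
    IsLinearMap k (fun x => f x * c) := ⟨fun x y => by rw [hf.map_add, add_mul], fun r x => by rw [hf.map_smul, smul_mul_assoc]⟩

@[fun_prop] theorem IsLinearMap.const_mul_fun {f : M → A} (hf : IsLinearMap k f) (c : A) :
    IsLinearMap k (fun x => c * f x) := ⟨fun x y => by rw [hf.map_add, mul_add], fun r x => by rw [hf.map_smul, mul_smul_comm]⟩

@[fun_prop] theorem IsLinearMap.smul_const_fun {f : M → k} (hf : IsLinearMap k f) (c : N) :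
    IsLinearMap k (fun x => f x • c) := ⟨fun x y => by rw [hf.map_add, add_smul], fun r x => by rw [hf.map_smul, smul_assoc]⟩

@[fun_prop] theorem IsLinearMap.const_smul_fun {f : M → N} (hf : IsLinearMap k f) (c : k) :
    IsLinearMap k (fun x => c • f x) := ⟨fun x y => by rw [hf.map_add, smul_add], fun r x => by rw [hf.map_smul, smul_comm]⟩

@[fun_prop] theorem IsLinearMap.tmul_left {f : M → N} (hf : IsLinearMap k f) (c : P) :
    IsLinearMap k (fun x => f x ⊗ₜ[k] c) :=
  ⟨fun x y => by rw [hf.map_add, TensorProduct.add_tmul], fun r x => by rw [hf.map_smul, TensorProduct.smul_tmul']⟩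

@[fun_prop] theorem IsLinearMap.tmul_right {f : M → N} (hf : IsLinearMap k f) (c : P) :
    IsLinearMap k (fun x => c ⊗ₜ[k] f x) :=
  ⟨fun x y => by rw [hf.map_add, TensorProduct.tmul_add], fun r x => by rw [hf.map_smul, TensorProduct.tmul_smul]⟩

@[fun_prop] theorem IsLinearMap.sum_fun {ι : Type*} (s : Finset ι) {f : ι → M → N} (hf : ∀ i, IsLinearMap k (f i)) :
    IsLinearMap k (fun x => ∑ i ∈ s, f i x) :=
  ⟨fun x y => by simp [(hf _).map_add, Finset.sum_add_distrib], fun r x => by simp [(hf _).map_smul, Finset.smul_sum]⟩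

end Lin

section Sw
variable {k C M N : Type*} [CommSemiring k] [AddCommMonoid C] [Module k C] [Coalgebra k C]
  [AddCommMonoid M] [Module k M] [AddCommMonoid N] [Module k N]

variable (k) in
/-- The Sweedler sum `∑ F a₍₁₎ a₍₂₎`. -/
noncomputable def sw (a : C) (F : C → C → M) : M :=
  ∑ i ∈ (Coalgebra.Repr.arbitrary k a).index,
    F ((Coalgebra.Repr.arbitrary k a).left i) ((Coalgebra.Repr.arbitrary k a).right i)

theorem sw_eq_of_comul {ι : Type*} (s : Finset ι) (l r : ι → C) (a : C)
    (h : comul (R := k) a = ∑ i ∈ s, l i ⊗ₜ[k] r i) (F : C → C → M)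
    (h1 : ∀ y, IsLinearMap k (fun x => F x y) := by intros; fun_prop)
    (h2 : ∀ x, IsLinearMap k (fun y => F x y) := by intros; fun_prop) :
    sw k a F = ∑ i ∈ s, F (l i) (r i) := by
  let B : C →ₗ[k] C →ₗ[k] M := LinearMap.mk₂ k F (fun a b c => (h1 c).map_add a b) (fun c a b => (h1 b).map_smul c a)
    (fun a => (h2 a).map_add) (fun c a => (h2 a).map_smul c)
  have e1 := congrArg (TensorProduct.lift B) h
  rw [← (Coalgebra.Repr.arbitrary k a).eq] at e1
  simpa [B, sw] using e1

theorem sw_lift (F : C →ₗ[k] C →ₗ[k] M) (a : C) : sw k a (fun x y => F x y) = TensorProduct.lift F (comul a) := by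
  conv_rhs => rw [← (Coalgebra.Repr.arbitrary k a).eq]
  simp [sw]

theorem comul_eq_sw (a : C) : comul (R := k) a = sw k a (fun x y => x ⊗ₜ[k] y) :=
  (Coalgebra.Repr.arbitrary k a).eq.symm

@[fun_prop] theorem IsLinearMap.sw_left {f : M → C} (hf : IsLinearMap k f) (F : C → C → N)
    (h1 : ∀ y, IsLinearMap k (fun x => F x y))
    (h2 : ∀ x, IsLinearMap k (fun y => F x y)) : IsLinearMap k (fun x => sw k (f x) F) := by
  let B : C →ₗ[k] C →ₗ[k] N := LinearMap.mk₂ k F (fun a b c => (h1 c).map_add a b) (fun c a b => (h1 b).map_smul c a)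
    (fun a => (h2 a).map_add) (fun c a => (h2 a).map_smul c)
  have : ∀ a, sw k a F = TensorProduct.lift B (comul a) := fun a => sw_lift B a
  simp only [this]
  fun_prop

@[fun_prop] theorem IsLinearMap.sw_right (a : C) (F : M → C → C → N)
    (h1 : ∀ x y, IsLinearMap k (fun m => F m x y)) : IsLinearMap k (fun m => sw k a (F m)) := by
  unfold sw
  fun_prop

theorem map_sw (L : M →ₗ[k] N) (a : C) (F : C → C → M) : L (sw k a F) = sw k a (fun x y => L (F x y)) := by
  simp [sw]

theorem IsLinearMap.map_sw {L : M → N} (hL : IsLinearMap k L) (a : C) (F : C → C → M) :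
    L (sw k a F) = sw k a (fun x y => L (F x y)) :=
  _root_.map_sw (hL.mk' L) a F

theorem sw_congr {a : C} {F G : C → C → M} (h : ∀ x y, F x y = G x y) : sw k a F = sw k a G := by
  simp [sw, h]

theorem smul_sw (c : k) (a : C) (F : C → C → M) : c • (sw k a F) = sw k a (fun x y => c • (F x y)) := by
  simp [sw, Finset.smul_sum]

theorem sw_comm {D : Type*} [AddCommMonoid D] [Module k D] [Coalgebra k D] (a : C) (b : D)
   (F : C → C → D → D → M) :
   sw k a (fun x y => sw k b (fun u v => F x y u v)) = sw k b (fun u v => sw k a (fun x y => F x y u v)) :=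
  Finset.sum_comm

theorem sw_add (a : C) (F G : C → C → M) : sw k a (fun x y => F x y + G x y) = sw k a F + sw k a G := by
  simp [sw, Finset.sum_add_distrib]

theorem sw_sum {ι : Type*} (s : Finset ι) (a : C) (F : ι → C → C → M) :
    sw k a (fun x y => ∑ i ∈ s, F i x y) = ∑ i ∈ s, sw k a (F i) := by
  simp only [sw]; exact Finset.sum_comm

theorem sw_add_left (a b : C) (F : C → C → M)
    (h1 : ∀ y, IsLinearMap k (fun x => F x y) := by intros; fun_prop)
    (h2 : ∀ x, IsLinearMap k (fun y => F x y) := by intros; fun_prop) :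
    sw k (a + b) F = sw k a F + sw k b F :=
  (IsLinearMap.sw_left (IsLinearMap.id_fun (k := k)) F h1 h2).map_add a b

theorem sw_smul_left (c : k) (a : C) (F : C → C → M)
    (h1 : ∀ y, IsLinearMap k (fun x => F x y) := by intros; fun_prop)
    (h2 : ∀ x, IsLinearMap k (fun y => F x y) := by intros; fun_prop) :
    sw k (c • a) F = c • sw k a F :=
  (IsLinearMap.sw_left (IsLinearMap.id_fun (k := k)) F h1 h2).map_smul c a

theorem sw_assoc (a : C) (F : C → C → C → M)
    (h1 : ∀ y z, IsLinearMap k (fun x => F x y z) := by intros; fun_prop)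
    (h2 : ∀ x z, IsLinearMap k (fun y => F x y z) := by intros; fun_prop)
    (h3 : ∀ x y, IsLinearMap k (fun z => F x y z) := by intros; fun_prop) :
    sw k a (fun x z => sw k x (fun u v => F u v z)) = sw k a (fun u x => sw k x (fun v z => F u v z)) := by
  let B : C →ₗ[k] C →ₗ[k] C →ₗ[k] M := LinearMap.mk₂ k (fun x y => (h3 x y).mk' _)
    (fun a b c => by ext z; simp [(h1 c z).map_add]) (fun c a b => by ext z; simp [(h1 b z).map_smul])
    (fun a b c => by ext z; simp [(h2 a z).map_add]) (fun c a b => by ext z; simp [(h2 a z).map_smul])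
  have hB : ∀ x y z, F x y z = B x y z := fun x y z => rfl
  have e := congrArg (TensorProduct.lift (TensorProduct.lift B))
    (Coalgebra.coassoc_symm_apply (R := k) a)
  have e1 : ∀ x z, sw k x (fun u v => F u v z) = TensorProduct.lift (TensorProduct.lift B) (comul x ⊗ₜ z) := by
    intro x z
    rw [comul_eq_sw]
    simp [sw, TensorProduct.sum_tmul, hB]
  have e2 : ∀ u x, sw k x (fun v z => F u v z) = TensorProduct.lift (TensorProduct.lift B)
      ((TensorProduct.assoc k C C C).symm (u ⊗ₜ comul x)) := by
    intro x z
    rw [comul_eq_sw]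
    simp [sw, TensorProduct.tmul_sum, hB]
  simp only [e1, e2]
  rw [comul_eq_sw a] at e
  simpa [sw] using e.symm

theorem sw_counit_smul (a : C) (F : C → M) (h : IsLinearMap k F := by fun_prop) :
    sw k a (fun x y => counit (R := k) x • F y) = F a := by
  have := congrArg (h.mk' F) (sum_counit_smul (Coalgebra.Repr.arbitrary k a))
  simpa only [sw, map_sum, map_smul, IsLinearMap.mk'_apply] using this

theorem sw_smul_counit (a : C) (F : C → M) (h : IsLinearMap k F := by fun_prop) :
    sw k a (fun x y => counit (R := k) y • F x) = F a := by
  have := congrArg (fun t => h.mk' F (TensorProduct.rid k C t)) (sum_tmul_counit_eq (R := k) (Coalgebra.Repr.arbitrary k a))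
  simpa only [sw, map_sum, map_smul, IsLinearMap.mk'_apply, TensorProduct.rid_tmul, one_smul] using this

end Sw

section Hopf
variable {k H M : Type*} [CommSemiring k] [Semiring H] [AddCommMonoid M] [Module k M]

section Bialg
variable [Bialgebra k H]

theorem sw_one (F : H → H → M)
    (h1 : ∀ y, IsLinearMap k (fun x => F x y) := by intros; fun_prop)
    (h2 : ∀ x, IsLinearMap k (fun y => F x y) := by intros; fun_prop) :
    sw k (1 : H) F = F 1 1 := by
  rw [sw_eq_of_comul (k := k) Finset.univ (fun _ : Unit => (1 : H)) (fun _ => 1) 1 (by simp [Algebra.TensorProduct.one_def]) F h1 h2]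
  simp

theorem sw_mul (a b : H) (F : H → H → M)
    (h1 : ∀ y, IsLinearMap k (fun x => F x y) := by intros; fun_prop)
    (h2 : ∀ x, IsLinearMap k (fun y => F x y) := by intros; fun_prop) :
    sw k (a * b) F = sw k a (fun a₁ a₂ => sw k b (fun b₁ b₂ => F (a₁ * b₁) (a₂ * b₂))) := by
  rw [sw_eq_of_comul (k := k) ((Coalgebra.Repr.arbitrary k a).index ×ˢ (Coalgebra.Repr.arbitrary k b).index)
    (fun ij => (Coalgebra.Repr.arbitrary k a).left ij.1 * (Coalgebra.Repr.arbitrary k b).left ij.2)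
    (fun ij => (Coalgebra.Repr.arbitrary k a).right ij.1 * (Coalgebra.Repr.arbitrary k b).right ij.2) _ _ F h1 h2]
  · simp only [Finset.sum_product, sw]
  · rw [Bialgebra.comul_mul, comul_eq_sw a, comul_eq_sw b]
    simp only [sw, Finset.sum_mul_sum, Finset.sum_product, Algebra.TensorProduct.tmul_mul_tmul]
end Bialg

theorem sw_of_comul {C : Type*} [AddCommMonoid C] [Module k C] [Coalgebra k C] (a u v : C)
    (h : comul (R := k) a = u ⊗ₜ[k] v) (F : C → C → M)
    (h1 : ∀ y, IsLinearMap k (fun x => F x y) := by intros; fun_prop)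
    (h2 : ∀ x, IsLinearMap k (fun y => F x y) := by intros; fun_prop) :
    sw k a F = F u v := by
  rw [sw_eq_of_comul (k := k) Finset.univ (fun _ : Unit => u) (fun _ => v) a (by simp [h]) F h1 h2]
  simp

variable [HopfAlgebra k H]

theorem sw_antipode_mul (a : H) (F : H → M) (h : IsLinearMap k F := by fun_prop) :
    sw k a (fun x y => F (antipode k x * y)) = counit (R := k) a • F 1 := by
  have := congrArg (h.mk' F) (sum_antipode_mul_eq_smul (Coalgebra.Repr.arbitrary k a))
  simpa only [sw, map_sum, map_smul, IsLinearMap.mk'_apply] using this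

theorem sw_mul_antipode (a : H) (F : H → M) (h : IsLinearMap k F := by fun_prop) :
    sw k a (fun x y => F (x * antipode k y)) = counit (R := k) a • F 1 := by
  have := congrArg (h.mk' F) (sum_mul_antipode_eq_smul (Coalgebra.Repr.arbitrary k a))
  simpa only [sw, map_sum, map_smul, IsLinearMap.mk'_apply] using this

theorem comul_antipode (a : H) :
    comul (R := k) (antipode k a) = sw k a (fun x y => antipode k y ⊗ₜ[k] antipode k x) := by
  have hlin : IsLinearMap k (fun a : H => sw k a (fun x y => antipode k y ⊗ₜ[k] antipode k x)) := by
    fun_prop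
  have hinv : WithConv.toConv (hlin.mk' _) * WithConv.toConv (comul (R := k) (A := H)) = 1 := by
    ext a
    rw [(Coalgebra.Repr.arbitrary k a).convMul_apply]
    change sw k a (fun x y => sw k x (fun u v => antipode k v ⊗ₜ[k] antipode k u) * comul (R := k) y) = _
    calc _ = sw k a (fun x y => sw k x (fun u v => sw k y (fun w z =>
            (antipode k v * w) ⊗ₜ[k] (antipode k u * z)))) := sw_congr fun x y => by
            rw [comul_eq_sw y, IsLinearMap.map_sw (L := fun t => t * _) (by fun_prop)]
            refine sw_congr fun u v => ?_
            rw [IsLinearMap.map_sw (L := fun t => _ * t) (by fun_prop)]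
            simp only [Algebra.TensorProduct.tmul_mul_tmul]
      _ = sw k a (fun u x => sw k x (fun v y => sw k y (fun w z =>
            (antipode k v * w) ⊗ₜ[k] (antipode k u * z)))) :=
            sw_assoc a (fun u v y => sw k y (fun w z =>
              (antipode k v * w) ⊗ₜ[k] (antipode k u * z)))
      _ = sw k a (fun u x => 1 ⊗ₜ[k] (antipode k u * x)) := sw_congr fun u x => by
            rw [← sw_assoc x (fun v w z => (antipode k v * w) ⊗ₜ[k] (antipode k u * z))]
            rw [← sw_counit_smul x (fun x => 1 ⊗ₜ[k] (antipode k u * x))]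
            exact sw_congr fun t z => sw_antipode_mul t (fun s => s ⊗ₜ[k] (antipode k u * z))
      _ = _ := by
            rw [sw_antipode_mul a (fun s => 1 ⊗ₜ[k] s)]
            simp [Algebra.algebraMap_eq_smul_one, Algebra.TensorProduct.one_def]
  have := left_inv_eq_right_inv hinv (LinearMap.comul_right_inv (R := k) (C := H))
  exact congrArg (fun f => f.ofConv a) this.symm

theorem sw_antipode (a : H) (F : H → H → M)
    (h1 : ∀ y, IsLinearMap k (fun x => F x y) := by intros; fun_prop)
    (h2 : ∀ x, IsLinearMap k (fun y => F x y) := by intros; fun_prop) :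
    sw k (antipode k a) F = sw k a (fun x y => F (antipode k y) (antipode k x)) := by
  have key := comul_antipode (k := k) a
  rw [sw] at key
  exact sw_eq_of_comul _ _ _ _ key F h1 h2
end Hopf

/-- The dual of a finite-dimensional Hopf algebra, with the convolution product. -/
def HDual (k H : Type*) [CommSemiring k] [AddCommMonoid H] [Module k H] := WithConv (H →ₗ[k] k)

section DualCoalg
variable {k H P : Type*} [Field k] [Ring H] [AddCommGroup P] [Module k P]

section Bialg
variable [Bialgebra k H]

noncomputable instance HDual.ring : Ring (HDual k H) := inferInstanceAs (Ring (WithConv (H →ₗ[k] k)))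
noncomputable instance HDual.algebra : Algebra k (HDual k H) :=
  inferInstanceAs (Algebra k (WithConv (H →ₗ[k] k)))

instance HDual.funLike : FunLike (HDual k H) H k where
  coe f := f.ofConv
  coe_injective _ _ h := WithConv.ext (DFunLike.coe_injective h)

instance HDual.linearMapClass : LinearMapClass (HDual k H) k H k where
  map_add f := map_add f.ofConv
  map_smulₛₗ f := map_smul f.ofConv

@[ext] theorem HDual.ext {f g : HDual k H} (h : ∀ x, f x = g x) : f = g := DFunLike.ext _ _ h

/-- The linear identification of the linear dual with `HDual`. -/
def HDual.of : (H →ₗ[k] k) ≃ₗ[k] HDual k H where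
  toFun f := WithConv.toConv f
  invFun f := f.ofConv
  map_add' _ _ := rfl
  map_smul' _ _ := rfl

@[simp] theorem HDual.of_apply (f : H →ₗ[k] k) (x : H) : HDual.of f x = f x := rfl
@[simp] theorem HDual.of_symm_apply (f : HDual k H) (x : H) : HDual.of.symm f x = f x := rfl
@[simp] theorem HDual.add_apply (f g : HDual k H) (x : H) : (f + g) x = f x + g x := rfl
@[simp] theorem HDual.sub_apply (f g : HDual k H) (x : H) : (f - g) x = f x - g x := rfl
@[simp] theorem HDual.zero_apply (x : H) : (0 : HDual k H) x = 0 := rfl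
@[simp] theorem HDual.smul_apply (c : k) (f : HDual k H) (x : H) : (c • f) x = c * f x := rfl

variable (k) in
/-- Evaluation at `h`. -/
def HDual.ev (h : H) : HDual k H →ₗ[k] k where
  toFun f := f h
  map_add' _ _ := rfl
  map_smul' _ _ := rfl

@[simp] theorem HDual.ev_apply (h : H) (f : HDual k H) : HDual.ev k h f = f h := rfl

@[simp] theorem HDual.sum_apply {ι : Type*} (s : Finset ι) (f : ι → HDual k H) (x : H) :
    (∑ i ∈ s, f i) x = ∑ i ∈ s, f i x := map_sum (HDual.ev k x) f s

@[fun_prop] theorem IsLinearMap.hdual_comp {M : Type*} [AddCommMonoid M] [Module k M]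
    (L : HDual k H) {f : M → H} (hf : IsLinearMap k f) :
    IsLinearMap k (fun x => L (f x)) := ⟨fun x y => by simp [hf.map_add], fun c x => by simp [hf.map_smul]⟩

@[fun_prop] theorem IsLinearMap.hdual_apply {M : Type*} [AddCommMonoid M] [Module k M]
    {f : M → HDual k H} (hf : IsLinearMap k f) (h : H) :
    IsLinearMap k (fun x => f x h) := ⟨fun x y => by simp [hf.map_add], fun c x => by simp [hf.map_smul]⟩

theorem HDual.mul_apply (f g : HDual k H) (h : H) :
    (f * g) h = sw k h (fun x y => f x * g y) :=
  (Coalgebra.Repr.arbitrary k h).convMul_apply f g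

@[simp] theorem HDual.one_apply (h : H) : (1 : HDual k H) h = counit (R := k) h :=
  LinearMap.convOne_apply (A := k) h

/-- Contraction of the first tensor factor of `H* ⊗ P` with `h`. -/
noncomputable def evl (P : Type*) [AddCommGroup P] [Module k P] (h : H) : HDual k H ⊗[k] P →ₗ[k] P :=
  TensorProduct.lift (LinearMap.mk₂ k (fun f x => f h • x) (by intros; simp [add_smul])
    (by intros; simp [mul_smul]) (by intros; simp) (by intros; rw [smul_comm]))

@[simp] theorem evl_tmul (h : H) (f : HDual k H) (x : P) : evl P h (f ⊗ₜ x) = f h • x := rfl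

theorem evl_mul (s t : HDual k H ⊗[k] HDual k H) (a : H) :
    evl _ a (s * t) = sw k a (fun x y => evl _ x s * evl _ y t) := by
  induction s with
  | zero => simp [sw]
  | add s s' hs hs' => simp only [add_mul, map_add, hs, hs', sw_add]
  | tmul f g =>
    induction t with
    | zero => simp [sw]
    | add s s' hs hs' => simp only [mul_add, map_add, hs, hs', sw_add]
    | tmul f' g' =>
      simp only [Algebra.TensorProduct.tmul_mul_tmul, evl_tmul, HDual.mul_apply]
      rw [IsLinearMap.map_sw (L := fun c => c • (g * g')) (by fun_prop)]
      exact sw_congr fun x y => by rw [mul_smul, smul_mul_smul_comm, mul_smul]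

theorem evl_one (a : H) : evl _ a (1 : HDual k H ⊗[k] HDual k H) = counit (R := k) a • 1 := by
  simp [Algebra.TensorProduct.one_def]

variable [FiniteDimensional k H]

variable (k H) in
/-- The basis of `H*` dual to the standard basis of `H`. -/
noncomputable def dualBas : Module.Basis (Fin (Module.finrank k H)) k (HDual k H) :=
  (Module.finBasis k H).dualBasis.map HDual.of

theorem dualBas_apply (i) (h : H) : (dualBas k H i) h = (Module.finBasis k H).repr h i := by
  simp [dualBas]

theorem sum_dualBas_smul (h : H) : ∑ i, (dualBas k H i) h • Module.finBasis k H i = h := by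
  simp [dualBas_apply, (Module.finBasis k H).sum_repr]

theorem sum_smul_dualBas (f : HDual k H) : ∑ i, f (Module.finBasis k H i) • dualBas k H i = f := by
  ext h
  conv_rhs => rw [← sum_dualBas_smul (k := k) h, map_sum]
  simp [mul_comm]

theorem evl_ext {s t : HDual k H ⊗[k] P} (h : ∀ a, evl P a s = evl P a t) : s = t := by
  have key : ∀ t : HDual k H ⊗[k] P, t = ∑ i, dualBas k H i ⊗ₜ evl P (Module.finBasis k H i) t := by
    intro t
    induction t with
    | zero => simp
    | add x y hx hy => simp only [map_add, TensorProduct.tmul_add, Finset.sum_add_distrib, ← hx, ← hy]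
    | tmul f x =>
      conv_lhs => rw [← sum_smul_dualBas f, TensorProduct.sum_tmul]
      simp [TensorProduct.smul_tmul]
  rw [key s, key t]
  simp [h]

/-- Precomposition with left multiplication by `a`. -/
noncomputable def precompMulLeft (a : H) : HDual k H →ₗ[k] HDual k H where
  toFun f := HDual.of (HDual.of.symm f ∘ₗ LinearMap.mulLeft k a)
  map_add' _ _ := rfl
  map_smul' _ _ := rfl

@[simp] theorem precompMulLeft_apply (a b : H) (f : HDual k H) :
    precompMulLeft a f b = f (a * b) := rfl

/-- The comultiplication of the dual. -/
noncomputable def dualComul : HDual k H →ₗ[k] HDual k H ⊗[k] HDual k H where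
  toFun f := ∑ i, dualBas k H i ⊗ₜ precompMulLeft (Module.finBasis k H i) f
  map_add' f g := by simp only [map_add, TensorProduct.tmul_add, Finset.sum_add_distrib]
  map_smul' f g := by simp only [map_smul, TensorProduct.tmul_smul, Finset.smul_sum, RingHom.id_apply]

theorem evl_dualComul (a : H) (f : HDual k H) : evl _ a (dualComul f) = precompMulLeft a f := by
  ext b
  simp only [dualComul, LinearMap.coe_mk, AddHom.coe_mk, map_sum, evl_tmul, HDual.sum_apply, HDual.smul_apply,
    precompMulLeft_apply]
  conv_rhs => rw [← sum_dualBas_smul (k := k) a, Finset.sum_mul, map_sum]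
  simp

noncomputable instance HDual.coalgebra : Coalgebra k (HDual k H) where
  comul := dualComul
  counit := HDual.ev k 1
  coassoc := by
    refine LinearMap.ext fun f => evl_ext (P := HDual k H ⊗[k] HDual k H) fun a => evl_ext (P := HDual k H) fun b => ?_
    have h1 : ∀ t : (HDual k H ⊗[k] HDual k H) ⊗[k] HDual k H,
        evl _ a (TensorProduct.assoc k _ _ _ t) = (evl (HDual k H) a).rTensor _ t := by
      intro t
      refine LinearMap.congr_fun (f := evl _ a ∘ₗ (TensorProduct.assoc k _ _ _).toLinearMap) ?_ t
      ext x y z : 5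
      simp [TensorProduct.smul_tmul']
    have h2 : ∀ t : HDual k H ⊗[k] HDual k H, evl _ b ((precompMulLeft (k := k) a).rTensor _ t) =
        evl _ (a * b) t := by
      intro t
      refine LinearMap.congr_fun (f := evl _ b ∘ₗ ((precompMulLeft (k := k) a).rTensor _)) ?_ t
      ext x y : 3
      simp
    have h3 : ∀ t : HDual k H ⊗[k] HDual k H, evl _ a (dualComul.lTensor _ t) =
        dualComul (evl _ a t) := by
      intro t
      refine LinearMap.congr_fun (f := evl _ a ∘ₗ (dualComul.lTensor _)) (g := dualComul ∘ₗ evl _ a) ?_ t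
      ext x y : 3
      simp
    have h4 : evl _ a ∘ₗ dualComul = precompMulLeft (k := k) a := LinearMap.ext (evl_dualComul a)
    simp only [LinearMap.comp_apply, LinearEquiv.coe_coe]
    rw [h1, ← LinearMap.rTensor_comp_apply, h4, h2, h3, evl_dualComul, evl_dualComul, evl_dualComul]
    ext c
    simp [mul_assoc]
  rTensor_counit_comp_comul := by
    refine LinearMap.ext fun f => (TensorProduct.lid k _).injective ?_
    have h1 : ∀ t : HDual k H ⊗[k] HDual k H, (TensorProduct.lid k (HDual k H)) (LinearMap.rTensor _
        (HDual.ev k 1) t) = evl _ 1 t := by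
      intro t
      induction t with
      | zero => simp
      | add x y hx hy => simp only [map_add, hx, hy]
      | tmul x y => simp
    simp only [LinearMap.comp_apply]
    rw [h1, evl_dualComul]
    ext c
    simp
  lTensor_counit_comp_comul := by
    refine LinearMap.ext fun f => evl_ext (P := k) fun a => ?_
    have h1 : ∀ t : HDual k H ⊗[k] HDual k H, evl _ a (LinearMap.lTensor _
        (HDual.ev k 1) t) = (evl _ a t) 1 := by
      intro t
      induction t with
      | zero => simp
      | add x y hx hy => simp only [map_add, hx, hy, HDual.add_apply]
      | tmul x y => simp
    simp only [LinearMap.comp_apply]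
    rw [h1, evl_dualComul]
    simp

theorem HDual.counit_apply (f : HDual k H) : counit (R := k) f = f 1 := rfl

theorem HDual.evl_comul (f : HDual k H) (a : H) : evl _ a (comul f) = precompMulLeft a f := evl_dualComul a f

theorem HDual.sw_apply (f : HDual k H) (a b : H) :
    sw k f (fun u v => u a * v b) = f (a * b) := by
  have := congrArg (HDual.ev k b) (HDual.evl_comul f a)
  rw [comul_eq_sw, map_sw, map_sw] at this
  simpa using this

noncomputable instance HDual.bialgebra : Bialgebra k (HDual k H) :=
  Bialgebra.mk' k (HDual k H) (by simp [HDual.counit_apply])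
    (by
      intro f g
      change (f * g) 1 = f 1 * g 1
      rw [HDual.mul_apply, sw_one (fun x y => f x * g y)])
    (by
      refine evl_ext fun a => ?_
      rw [HDual.evl_comul, evl_one]
      ext b
      simp)
    (by
      intro f g
      refine evl_ext fun a => ?_
      rw [HDual.evl_comul, evl_mul]
      simp only [HDual.evl_comul]
      ext b
      rw [precompMulLeft_apply, HDual.mul_apply, sw_mul a b (fun x y => f x * g y),
        ← HDual.ev_apply b (sw _ _ _), map_sw]
      exact sw_congr fun x y => by rw [HDual.ev_apply, HDual.mul_apply]; rfl)
end Bialg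

section Hopf
variable [HopfAlgebra k H] [FiniteDimensional k H]

/-- The antipode of the dual. -/
noncomputable def dualAntipode : HDual k H →ₗ[k] HDual k H where
  toFun f := HDual.of (HDual.of.symm f ∘ₗ antipode k)
  map_add' _ _ := rfl
  map_smul' _ _ := rfl

noncomputable instance HDual.hopfAlgebra : HopfAlgebra k (HDual k H) where
  antipode := dualAntipode
  mul_antipode_rTensor_comul := by
    refine LinearMap.ext fun f => HDual.ext fun h => ?_
    simp only [LinearMap.comp_apply]
    rw [comul_eq_sw, map_sw, map_sw, ← HDual.ev_apply h (sw _ _ _), map_sw]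
    simp only [HDual.ev_apply, LinearMap.rTensor_tmul, LinearMap.mul'_apply, HDual.mul_apply]
    rw [sw_comm]
    have : ∀ x y : H, sw k f (fun u v => (dualAntipode u) x * v y) = f (antipode k x * y) :=
      fun x y => HDual.sw_apply f (antipode k x) y
    simp only [this]
    rw [sw_antipode_mul h (fun x => f x)]
    simp [HDual.counit_apply, mul_comm, Algebra.algebraMap_eq_smul_one]
  mul_antipode_lTensor_comul := by
    refine LinearMap.ext fun f => HDual.ext fun h => ?_
    simp only [LinearMap.comp_apply]
    rw [comul_eq_sw, map_sw, map_sw, ← HDual.ev_apply h (sw _ _ _), map_sw]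
    simp only [HDual.ev_apply, LinearMap.lTensor_tmul, LinearMap.mul'_apply, HDual.mul_apply]
    rw [sw_comm]
    have : ∀ x y : H, sw k f (fun u v => u x * (dualAntipode v) y) = f (x * antipode k y) :=
      fun x y => HDual.sw_apply f x (antipode k y)
    simp only [this]
    rw [sw_mul_antipode h (fun x => f x)]
    simp [HDual.counit_apply, mul_comm, Algebra.algebraMap_eq_smul_one]

theorem HDual.antipode_apply (f : HDual k H) (h : H) : (antipode k f) h = f (antipode k h) := rfl

instance HDual.finiteDimensional : FiniteDimensional k (HDual k H) := Module.Finite.of_basis (dualBas k H)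

theorem HDual.finrank_eq : Module.finrank k (HDual k H) = Module.finrank k H := by
  rw [Module.finrank_eq_card_basis (dualBas k H)]; simp

end Hopf
end DualCoalg

section Rho
variable {k H : Type*} [Field k] [Ring H] [Bialgebra k H]

theorem HDual.eq_of_forall {x y : H} (h : ∀ f : HDual k H, f x = f y) : x = y := by
  rw [← sub_eq_zero]
  refine (Module.forall_dual_apply_eq_zero_iff k _).1 fun f => ?_
  have := h (HDual.of f)
  simpa [sub_eq_zero] using this

/-- The left coregular action `f ⇀ h = h₍₁₎ f(h₍₂₎)` of the dual. -/
noncomputable def rho : HDual k H →ₐ[k] Module.End k H :=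
  AlgHom.ofLinearMap
    { toFun f := { toFun h := sw k h (fun x y => f y • x)
                   map_add' a b := sw_add_left a b (fun x y => f y • x)
                   map_smul' c a := sw_smul_left c a (fun x y => f y • x) }
      map_add' f g := LinearMap.ext fun h => by simp [add_smul, sw_add]
      map_smul' c f := LinearMap.ext fun h => by simp [mul_smul, smul_sw] }
    (LinearMap.ext fun h => by
      simpa using sw_smul_counit (k := k) h (fun x => x))
    (fun f g => LinearMap.ext fun h => by
      simp only [LinearMap.coe_mk, AddHom.coe_mk, Module.End.mul_apply]
      rw [IsLinearMap.map_sw (L := fun h => sw k h (fun x y => f y • x)) (by fun_prop)]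
      have := sw_assoc (k := k) h (fun u v z => f v • g z • u)
      simp only [HDual.mul_apply]
      calc _ = sw k h (fun u x => sw k x (fun v z => f v • g z • u)) := sw_congr fun u x => by
              rw [IsLinearMap.map_sw (L := fun t => t • u) (by fun_prop)]
              exact sw_congr fun v z => by rw [mul_smul]
        _ = _ := by
          rw [← this]
          refine sw_congr fun x z => ?_
          rw [sw_smul_left (g z) x (fun u v => f v • u), smul_sw]
          exact sw_congr fun u v => by rw [smul_comm])

theorem rho_apply (f : HDual k H) (h : H) : rho f h = sw k h (fun x y => f y • x) := rfl

/-- The right coregular action `h ↼ f = f(h₍₁₎) h₍₂₎`. -/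
noncomputable def lam (f : HDual k H) : Module.End k H where
  toFun h := sw k h (fun x y => f x • y)
  map_add' a b := sw_add_left a b (fun x y => f x • y)
  map_smul' c a := sw_smul_left c a (fun x y => f x • y)

theorem lam_apply (f : HDual k H) (h : H) : lam f h = sw k h (fun x y => f x • y) := rfl

theorem apply_rho (f f' : HDual k H) (h : H) : f' (rho f h) = (f' * f) h := by
  rw [rho_apply, HDual.mul_apply, IsLinearMap.map_sw (L := fun t => f' t) (by fun_prop)]
  exact sw_congr fun x y => by simp [mul_comm]

theorem apply_lam (f f' : HDual k H) (h : H) : f' (lam f h) = (f * f') h := by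
  rw [lam_apply, HDual.mul_apply, IsLinearMap.map_sw (L := fun t => f' t) (by fun_prop)]
  exact sw_congr fun x y => by simp

theorem rho_lam_comm (f f' : HDual k H) (h : H) : rho f (lam f' h) = lam f' (rho f h) :=
  HDual.eq_of_forall fun e => by rw [apply_rho, apply_lam, apply_lam, apply_rho, mul_assoc]

theorem lam_mul (f f' : HDual k H) (h : H) : lam (f * f') h = lam f' (lam f h) :=
  HDual.eq_of_forall fun e => by rw [apply_lam, apply_lam, apply_lam, mul_assoc]

theorem counit_rho (f : HDual k H) (h : H) : counit (R := k) (rho f h) = f h := by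
  rw [← HDual.one_apply, apply_rho, one_mul]

end Rho

section Integrals
variable {k H : Type*} [Field k] [Ring H] [HopfAlgebra k H]

/-- The right action `(m · h)(x) = m (x S(h))` on the dual. -/
noncomputable def dact (m : HDual k H) (h : H) : HDual k H :=
  HDual.of (HDual.of.symm m ∘ₗ LinearMap.mulRight k (antipode k h))

@[simp] theorem dact_apply (m : HDual k H) (h x : H) : dact m h x = m (x * antipode k h) := rfl

@[fun_prop] theorem dact_isLinearMap {M : Type*} [AddCommGroup M] [Module k M] {f : M → HDual k H} (hf : IsLinearMap k f)
    (h : H) : IsLinearMap k (fun x => dact (f x) h) :=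
  ⟨fun x y => by ext; simp [hf.map_add], fun c x => by ext; simp [hf.map_smul]⟩

@[fun_prop] theorem dact_isLinearMap' {M : Type*} [AddCommGroup M] [Module k M] {f : M → H} (hf : IsLinearMap k f)
    (m : HDual k H) : IsLinearMap k (fun x => dact m (f x)) :=
  ⟨fun x y => by ext; simp [hf.map_add, mul_add], fun c x => by ext; simp [hf.map_smul]⟩

/-- Precomposition with right multiplication. -/
noncomputable def precompMulRight (f : HDual k H) (h : H) : HDual k H :=
  HDual.of (HDual.of.symm f ∘ₗ LinearMap.mulRight k h)

@[simp] theorem precompMulRight_apply (m : HDual k H) (h x : H) : precompMulRight m h x = m (x * h) := rfl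

@[fun_prop] theorem precompMulRight_isLinearMap {M : Type*} [AddCommGroup M] [Module k M] {f : M → H} (hf : IsLinearMap k f)
    (m : HDual k H) : IsLinearMap k (fun x => precompMulRight m (f x)) :=
  ⟨fun x y => by ext; simp [hf.map_add, mul_add], fun c x => by ext; simp [hf.map_smul]⟩

theorem dact_dact (m : HDual k H) (h h' : H) : dact (dact m h) h' = dact m (h * h') := by
  ext x; simp [antipode_mul_antidistrib, mul_assoc]

theorem HDual.sw_eval {M : Type*} [AddCommGroup M] [Module k M] [Coalgebra k M] (m : M) (F : M → M → HDual k H) (x : H) :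
    (sw k m F) x = sw k m (fun u v => F u v x) := map_sw (HDual.ev k x) m F

theorem mul_dact (f m : HDual k H) (h : H) :
    f * dact m h = sw k h (fun u v => dact (precompMulRight f v * m) u) := by
  ext x
  rw [HDual.mul_apply, HDual.sw_eval]
  symm
  calc _ = sw k h (fun u v => sw k x (fun x₁ x₂ => sw k u (fun a b =>
            f (x₁ * (antipode k b * v)) * m (x₂ * antipode k a)))) := sw_congr fun u v => by
          rw [dact_apply, HDual.mul_apply, sw_mul x _ (fun s t => (precompMulRight f v) s * m t)]
          refine sw_congr fun x₁ x₂ => ?_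
          rw [sw_antipode u (fun b₁ b₂ => (precompMulRight f v) (x₁ * b₁) * m (x₂ * b₂))]
          exact sw_congr fun a b => by simp [mul_assoc]
    _ = sw k x (fun x₁ x₂ => sw k h (fun u v => sw k u (fun a b =>
            f (x₁ * (antipode k b * v)) * m (x₂ * antipode k a)))) := by rw [sw_comm]
    _ = _ := sw_congr fun x₁ x₂ => by
          rw [sw_assoc h (fun a b v => f (x₁ * (antipode k b * v)) * m (x₂ * antipode k a)), dact_apply]
          rw [← sw_smul_counit (k := k) h (fun h => f x₁ * m (x₂ * antipode k h))]
          refine sw_congr fun a t => ?_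
          rw [sw_antipode_mul t (fun s => f (x₁ * s) * m (x₂ * antipode k a)), mul_one]

variable [FiniteDimensional k H]

local notation "bas" => Module.finBasis k H
local notation "dbas" => dualBas k H

theorem sum_dual_coassoc {M : Type*} [AddCommGroup M] [Module k M] (m : HDual k H) (G : HDual k H → H → H → M)
    (h1 : ∀ y z, IsLinearMap k (fun x => G x y z) := by intros; fun_prop)
    (h2 : ∀ x z, IsLinearMap k (fun y => G x y z) := by intros; fun_prop)
    (h3 : ∀ x y, IsLinearMap k (fun z => G x y z) := by intros; fun_prop) :
    ∑ i, sw k (bas i) (fun x y => G (dbas i * m) x y) = ∑ j, ∑ l, G (dbas j * dbas l * m) (bas j) (bas l) := by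
  have e1 : ∀ (u : HDual k H) (x y : H), G u x y = ∑ j, ∑ l, (dbas j x * dbas l y) • G u (bas j) (bas l) := by
    intro u x y
    conv_lhs => rw [← sum_dualBas_smul (k := k) x, ← sum_dualBas_smul (k := k) y]
    have := fun z => map_sum ((h2 u z).mk' _) (fun i => dbas i x • bas i) Finset.univ
    simp only [IsLinearMap.mk'_apply] at this
    rw [this]
    refine Finset.sum_congr rfl fun j _ => ?_
    have := map_sum ((h3 u (dbas j x • bas j)).mk' _) (fun i => dbas i y • bas i) Finset.univ
    simp only [IsLinearMap.mk'_apply] at this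
    rw [this]
    refine Finset.sum_congr rfl fun l _ => ?_
    rw [(h3 _ _).map_smul, (h2 _ _).map_smul, smul_smul, mul_comm]
  have e2 : ∀ i, sw k (bas i) (fun x y => G (dbas i * m) x y) =
      ∑ j, ∑ l, G (((dbas j * dbas l) (bas i) • dbas i) * m) (bas j) (bas l) := by
    intro i
    rw [sw_congr fun x y => e1 (dbas i * m) x y, sw_sum]
    refine Finset.sum_congr rfl fun j _ => ?_
    rw [sw_sum]
    refine Finset.sum_congr rfl fun l _ => ?_
    rw [smul_mul_assoc, (h1 _ _).map_smul, HDual.mul_apply,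
      IsLinearMap.map_sw (L := fun c => c • G (dbas i * m) (bas j) (bas l)) (by fun_prop)]
  simp_rw [e2]
  rw [Finset.sum_comm]
  refine Finset.sum_congr rfl fun j _ => ?_
  rw [Finset.sum_comm]
  refine Finset.sum_congr rfl fun l _ => ?_
  conv_rhs => rw [← sum_smul_dualBas (dbas j * dbas l), Finset.sum_mul]
  have := map_sum ((h1 (bas j) (bas l)).mk' _) (fun i => ((dbas j * dbas l) (bas i) • dbas i) * m) Finset.univ
  simp only [IsLinearMap.mk'_apply] at this
  rw [this]

/-- The projection of the Hopf module `H*` onto its coinvariants. -/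
noncomputable def coinvProj (m : HDual k H) : HDual k H := ∑ i, dact (dbas i * m) (antipode k (bas i))

theorem mul_coinvProj (f m : HDual k H) : f * coinvProj m = f 1 • coinvProj m := by
  unfold coinvProj
  rw [Finset.mul_sum]
  simp_rw [mul_dact]
  have e1 : ∀ i, sw k (antipode k (bas i)) (fun u v => dact (precompMulRight f v * (dbas i * m)) u) =
    sw k (bas i) (fun u v => dact (precompMulRight f (antipode k u) * (dbas i * m)) (antipode k v)) := fun i =>
      sw_antipode (bas i) (fun u v => dact (precompMulRight f v * (dbas i * m)) u)
  simp_rw [e1]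
  rw [sum_dual_coassoc m (fun t u v => dact (precompMulRight f (antipode k u) * t) (antipode k v)), Finset.sum_comm,
    Finset.smul_sum]
  refine Finset.sum_congr rfl fun l _ => ?_
  have e2 : ∑ j, precompMulRight f (antipode k (bas j)) * dbas j = f 1 • 1 := by
    ext x
    simp only [HDual.sum_apply, HDual.mul_apply]
    rw [← sw_sum]
    calc _ = sw k x (fun u v => f (u * antipode k v)) := sw_congr fun u v => by
            conv_rhs => rw [← sum_dualBas_smul (k := k) v]
            simp [Finset.mul_sum, mul_comm]
      _ = _ := by
            rw [sw_mul_antipode x (fun t => f t)]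
            simp [mul_comm]
  have e3 : ∀ j, dact (precompMulRight f (antipode k (bas j)) * (dbas j * dbas l * m)) (antipode k (bas l)) =
    (IsLinearMap.mk' (fun t => dact (t * (dbas l * m)) (antipode k (bas l))) (by fun_prop) : HDual k H →ₗ[k] HDual k H) 
       (precompMulRight f (antipode k (bas j)) * dbas j) := fun j => by simp [mul_assoc]
  simp_rw [e3]
  rw [← map_sum, e2, map_smul]
  simp

theorem sum_coinvProj (m : HDual k H) : ∑ j, dact (coinvProj (dbas j * m)) (bas j) = m := by
  have : ∀ j, dact (coinvProj (dbas j * m)) (bas j) = ∑ i, dact (dbas i * dbas j * m) (antipode k (bas i) * bas j) := by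
    intro j
    have := map_sum (IsLinearMap.mk' (fun t => dact t (bas j)) (by fun_prop) : HDual k H →ₗ[k] HDual k H)
      (fun i => dact (dbas i * (dbas j * m)) (antipode k (bas i))) Finset.univ
    simp only [IsLinearMap.mk'_apply, dact_dact] at this
    rw [coinvProj, this]
    simp only [mul_assoc]
  simp_rw [this]
  rw [Finset.sum_comm, ← sum_dual_coassoc m (fun t x y => dact t (antipode k x * y))]
  have e : ∀ i, sw k (bas i) (fun x y => dact (dbas i * m) (antipode k x * y)) = (counit (R := k) (bas i) • dbas i) * m := by
    intro i
    rw [sw_antipode_mul (bas i) (fun x => dact (dbas i * m) x)]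
    ext x; simp [antipode_one]
  simp_rw [e]
  rw [← Finset.sum_mul]
  simp_rw [← HDual.one_apply]
  rw [sum_smul_dualBas, one_mul]

end Integrals

section Integrals
variable {k H : Type*} [Field k] [Ring H] [HopfAlgebra k H]

local notation "bas" => Module.finBasis k H
local notation "dbas" => dualBas k H
local notation "S" => antipode k

theorem nontrivial_of_hopf (k H : Type*) [Field k] [Ring H] [HopfAlgebra k H] : Nontrivial H :=
  ⟨⟨1, 0, fun h => by
    have := congrArg (counit (R := k)) h
    rw [Bialgebra.counit_one, map_zero] at this
    exact one_ne_zero this⟩⟩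

theorem IsGroupLikeElem.rho_eq {g : H} (hg : IsGroupLikeElem k g) (f : HDual k H) : rho f g = f g • g := by
  rw [rho_apply, sw_of_comul g g g hg.comul_eq_tmul_self (fun x y => f y • x)]

variable [FiniteDimensional k H]

theorem sw_eq_sum {M : Type*} [AddCommGroup M] [Module k M] (h : H) (F : H → H → M)
    (h1 : ∀ y, IsLinearMap k (fun x => F x y) := by intros; fun_prop)
    (h2 : ∀ x, IsLinearMap k (fun y => F x y) := by intros; fun_prop) :
    sw k h F = ∑ j, F (rho (dbas j) h) (bas j) := by
  simp_rw [rho_apply]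
  have : ∀ j, F (sw k h fun x y => (dbas j y) • x) (bas j) = sw k h fun x y => (dbas j y) • F x (bas j) := fun j => by
    rw [IsLinearMap.map_sw (h1 (bas j))]
    exact sw_congr fun x y => (h1 (bas j)).map_smul _ _
  simp_rw [this]
  rw [← sw_sum]
  refine sw_congr fun x y => ?_
  conv_lhs => rw [← sum_dualBas_smul (k := k) y]
  have := map_sum ((h2 x).mk' _) (fun i => dbas i y • bas i) Finset.univ
  simp only [IsLinearMap.mk'_apply, (h2 x).map_smul] at this
  exact this

theorem comul_eq_sum_rho (h : H) : comul (R := k) h = ∑ j, rho (dbas j) h ⊗ₜ[k] bas j := by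
  rw [comul_eq_sw]; exact sw_eq_sum h (fun x y => x ⊗ₜ[k] y)

theorem isGroupLikeElem_of_rho {g : H} (h0 : g ≠ 0) (h : ∀ f : HDual k H, rho f g = f g • g) : IsGroupLikeElem k g where
  comul_eq_tmul_self := by
    rw [comul_eq_sum_rho]
    simp_rw [h, TensorProduct.smul_tmul]
    rw [← TensorProduct.tmul_sum, sum_dualBas_smul]
  counit_eq_one := by
    have := h 1
    rw [map_one, HDual.one_apply, Module.End.one_apply] at this
    by_contra hc
    apply hc
    have h2 : (counit (R := k) g - 1) • g = 0 := by rw [sub_smul, one_smul, ← this, sub_self]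
    rcases smul_eq_zero.1 h2 with h2 | h2
    · exact sub_eq_zero.1 h2
    · exact absurd h2 h0

theorem HDual.isGroupLikeElem_of_mul {α : HDual k H} (h1 : α 1 = 1) (h : ∀ x y, α (x * y) = α x * α y) :
    IsGroupLikeElem k α where
  counit_eq_one := by rw [HDual.counit_apply, h1]
  comul_eq_tmul_self := evl_ext fun a => by
    rw [HDual.evl_comul, evl_tmul]
    ext x
    simp [h]

theorem HDual.mul_of_isGroupLikeElem {α : HDual k H} (hα : IsGroupLikeElem k α) (x y : H) : α (x * y) = α x * α y := by
  rw [← HDual.sw_apply, sw_of_comul α α α hα.comul_eq_tmul_self (fun u v : HDual k H => u x * v y)]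

theorem HDual.one_of_isGroupLikeElem {α : HDual k H} (hα : IsGroupLikeElem k α) : α 1 = 1 := by
  rw [← HDual.counit_apply, hα.counit_eq_one]

theorem exists_left_integral : ∃ m : HDual k H, m ≠ 0 ∧ ∀ f, f * m = f 1 • m := by
  by_contra! hc
  have h0 : ∀ m : HDual k H, coinvProj m = 0 := fun m => by
    by_contra h
    obtain ⟨f, hf⟩ := hc _ h
    exact hf (mul_coinvProj f m)
  have h1 := sum_coinvProj (1 : HDual k H)
  simp only [h0] at h1
  have h2 := congrArg (fun f : HDual k H => f 1) h1
  simp at h2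

theorem mul_dact_integral {m : HDual k H} (hm : ∀ f, f * m = f 1 • m) (f : HDual k H) (h : H) :
    f * dact m h = dact m (rho f h) := by
  rw [mul_dact, rho_apply, IsLinearMap.map_sw (L := fun t => dact m t) (by fun_prop)]
  refine sw_congr fun u v => ?_
  rw [hm]
  ext x; simp

theorem dact_injective {m : HDual k H} (h0 : m ≠ 0) (hm : ∀ f, f * m = f 1 • m) {h : H} (hh : dact m h = 0) : h = 0 := by
  have key : ∀ h, dact m h = 0 → counit (R := k) h = 0 := by
    intro h hh
    have e1 : sw k h (fun x y => dact m (x * S y)) = 0 := by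
      rw [sw_eq_sum h (fun x y => dact m (x * S y))]
      refine Finset.sum_eq_zero fun j _ => ?_
      rw [← dact_dact, ← mul_dact_integral hm, hh, mul_zero]
      ext; simp
    rw [sw_mul_antipode h (fun t => dact m t)] at e1
    have e2 : dact m 1 = m := by ext; simp [antipode_one]
    rw [e2] at e1
    exact (smul_eq_zero.1 e1).resolve_right h0
  refine HDual.eq_of_forall (k := k) fun f => ?_
  rw [map_zero, ← counit_rho]
  exact key _ (by rw [← mul_dact_integral hm, hh, mul_zero])

theorem antipode_injective : Function.Injective (S : H →ₗ[k] H) := by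
  obtain ⟨m, h0, hm⟩ := exists_left_integral (k := k) (H := H)
  refine (injective_iff_map_eq_zero _).2 fun h hh => dact_injective h0 hm ?_
  ext; simp [hh]

theorem antipode_bijective : Function.Bijective (S : H →ₗ[k] H) :=
  ⟨antipode_injective, LinearMap.injective_iff_surjective.1 antipode_injective⟩

theorem left_integral_unique {m m' : HDual k H} (h0 : m ≠ 0) (hm : ∀ f, f * m = f 1 • m)
    (hm' : ∀ f, f * m' = f 1 • m') : ∃ c : k, m' = c • m := by
  let D : H →ₗ[k] HDual k H := IsLinearMap.mk' (fun h => dact m h) (by fun_prop)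
  have hD : Function.Injective D := (injective_iff_map_eq_zero _).2 fun h hh => dact_injective h0 hm hh
  have hD' : Function.Surjective D :=
    (LinearMap.injective_iff_surjective_of_finrank_eq_finrank HDual.finrank_eq.symm).1 hD
  obtain ⟨h, rfl⟩ := hD' m'
  refine ⟨counit (R := k) h, ?_⟩
  have : h = counit (R := k) h • 1 := HDual.eq_of_forall fun f => by
    have := hm' f
    rw [← map_smul] at this
    change f * dact m h = _ at this
    rw [mul_dact_integral hm] at this
    have := hD this
    rw [← counit_rho, this]
    simp [mul_comm]
  conv_lhs => rw [this]
  rw [map_smul]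
  congr 1
  ext; simp [D]

/-- Normalised integrals of `H` and its dual, together with the distinguished group-likes. -/
structure IntDatum (k H : Type*) [Field k] [Ring H] [HopfAlgebra k H] where
  l : HDual k H
  L : H
  g : H
  α : HDual k H
  l_mul : ∀ f : HDual k H, l * f = f 1 • l
  mul_l : ∀ f : HDual k H, f * l = f g • l
  mul_L : ∀ h : H, h * L = counit (R := k) h • L
  L_mul : ∀ h : H, L * h = α h • L
  l_L : l L = 1
  nondeg : ∀ h, (∀ x, l (h * x) = 0) → h = 0
  nondeg' : ∀ h, (∀ x, l (x * h) = 0) → h = 0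
  g_groupLike : IsGroupLikeElem k g
  α_one : α 1 = 1
  α_mul : ∀ x y, α (x * y) = α x * α y
  l_unique : ∀ m : HDual k H, (∀ f, m * f = f 1 • m) → m = m L • l
  L_unique : ∀ M : H, (∀ h, h * M = counit (R := k) h • M) → M = l M • L

theorem IntDatum.nonempty : Nonempty (IntDatum k H) := by
  obtain ⟨m, h0, hm⟩ := exists_left_integral (k := k) (H := H)
  have Sinj := antipode_injective (k := k) (H := H)
  have Ssurj := (antipode_bijective (k := k) (H := H)).2
  have Tinj := antipode_injective (k := k) (H := HDual k H)
  have Tsurj := (antipode_bijective (k := k) (H := HDual k H)).2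
  have S1 : ∀ f : HDual k H, (S f) 1 = f 1 := fun f => by rw [HDual.antipode_apply, antipode_one]
  set l : HDual k H := S m with hl
  have l_mul : ∀ f : HDual k H, l * f = f 1 • l := fun f => by
    obtain ⟨f, rfl⟩ := Tsurj f
    rw [hl, ← antipode_mul_antidistrib, hm, map_smul, S1]
  have l0 : l ≠ 0 := fun h => h0 (Tinj (by rw [← hl, h, map_zero]))
  have nondeg : ∀ h, (∀ x, l (h * x) = 0) → h = 0 := fun h hh => dact_injective h0 hm <| by
    ext x
    obtain ⟨x, rfl⟩ := Ssurj x
    rw [dact_apply, ← antipode_mul_antidistrib, ← HDual.antipode_apply, ← hl, hh, HDual.zero_apply]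
  let D : H →ₗ[k] HDual k H := IsLinearMap.mk' (fun h => precompMulLeft h l) 
    ⟨fun x y => by ext; simp [add_mul], fun c x => by ext; simp⟩
  have hD : Function.Surjective D := by
    refine (LinearMap.injective_iff_surjective_of_finrank_eq_finrank HDual.finrank_eq.symm).1 ?_
    refine (injective_iff_map_eq_zero _).2 fun h hh => nondeg h fun x => ?_
    simpa [D] using congrArg (fun f : HDual k H => f x) hh
  have nondeg' : ∀ h, (∀ x, l (x * h) = 0) → h = 0 := fun h hh => HDual.eq_of_forall (k := k) fun f => by
    obtain ⟨x, rfl⟩ := hD f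
    simp [D, hh]
  let D' : H →ₗ[k] HDual k H := IsLinearMap.mk' (fun h => precompMulRight l h) (by fun_prop)
  have hD' : Function.Surjective D' := by
    refine (LinearMap.injective_iff_surjective_of_finrank_eq_finrank HDual.finrank_eq.symm).1 ?_
    refine (injective_iff_map_eq_zero _).2 fun h hh => nondeg' h fun x => ?_
    simpa [D'] using congrArg (fun f : HDual k H => f x) hh
  obtain ⟨L, hL⟩ := hD' 1
  have hL' : ∀ x, l (x * L) = counit (R := k) x := fun x => by
    simpa [D'] using congrArg (fun f : HDual k H => f x) hL
  have lL : l L = 1 := by simpa using hL' 1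
  have L0 : L ≠ 0 := fun h => by simp [h] at lL
  have mul_L : ∀ h : H, h * L = counit (R := k) h • L := fun h => by
    rw [← sub_eq_zero]
    refine nondeg' _ fun x => ?_
    rw [mul_sub, map_sub, ← mul_assoc, hL', mul_smul_comm, map_smul, hL', Bialgebra.counit_mul]
    simp [mul_comm]
  have L_unique : ∀ M : H, (∀ h, h * M = counit (R := k) h • M) → M = l M • L := fun M hM => by
    rw [← sub_eq_zero]
    refine nondeg' _ fun x => ?_
    rw [mul_sub, hM, map_sub, map_smul, mul_smul_comm, map_smul, hL']
    simp [mul_comm]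
  have l_unique : ∀ m : HDual k H, (∀ f, m * f = f 1 • m) → m = m L • l := fun m' hm' => by
    obtain ⟨m', rfl⟩ := Tsurj m'
    obtain ⟨c, rfl⟩ := left_integral_unique h0 hm (m' := m') fun f => Tinj (by
      rw [antipode_mul_antidistrib, hm', map_smul, S1])
    rw [map_smul, ← hl, HDual.smul_apply, lL, mul_one]
  have α_spec : ∀ h, L * h = precompMulLeft L l h • L := fun h => by
    refine L_unique _ fun x => ?_
    rw [← mul_assoc, mul_L, smul_mul_assoc]
  have g_spec : ∀ f : HDual k H, f * l = f (rho l L) • l := fun f => by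
    rw [apply_rho]
    exact l_unique _ fun f' => by rw [mul_assoc, l_mul, mul_smul_comm]
  have α_one : precompMulLeft L l 1 = 1 := by simp [lL]
  refine ⟨⟨l, L, rho l L, precompMulLeft L l, l_mul, g_spec, mul_L, α_spec, lL, nondeg, nondeg', ?_, α_one, ?_, 
    l_unique, L_unique⟩⟩
  · have hmul : ∀ f f' : HDual k H, (f * f') (rho l L) = f (rho l L) * f' (rho l L) := fun f f' => by
      have h1 := g_spec (f * f')
      rw [mul_assoc, g_spec f', mul_smul_comm, g_spec f, smul_smul] at h1
      have := congrArg (fun f : HDual k H => f L) h1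
      simp only [HDual.smul_apply, lL, mul_one] at this
      rw [← this, mul_comm]
    refine isGroupLikeElem_of_rho (k := k) (fun h => l0 ?_) fun f => HDual.eq_of_forall (k := k) fun f' => ?_
    · have := g_spec 1
      rwa [h, map_zero, zero_smul, one_mul] at this
    · rw [apply_rho, hmul, map_smul, smul_eq_mul, mul_comm]
  · intro x y
    have h1 := α_spec (x * y)
    rw [← mul_assoc, α_spec x, smul_mul_assoc, α_spec y, smul_smul] at h1
    have := congrArg l h1
    simpa [lL] using this.symm

end Integrals

section Formulas
variable {k H : Type*} [Field k] [Ring H] [HopfAlgebra k H]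
local notation "S" => antipode k

namespace IntDatum
variable (D : IntDatum k H)

theorem L_ne : D.L ≠ 0 := fun h => by simpa [h] using D.l_L
theorem l_ne : D.l ≠ 0 := fun h => by simpa [h] using D.l_L

theorem lam_l (h : H) : lam D.l h = D.l h • 1 := HDual.eq_of_forall fun f => by
  rw [apply_lam, D.l_mul]; simp [mul_comm]

theorem rho_l (h : H) : rho D.l h = D.l h • D.g := HDual.eq_of_forall fun f => by
  rw [apply_rho, D.mul_l]; simp [mul_comm]

theorem l_mul_L (h : H) : D.l (h * D.L) = counit (R := k) h := by rw [D.mul_L]; simp [D.l_L]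

theorem l_L_mul (h : H) : D.l (D.L * h) = D.α h := by rw [D.L_mul]; simp [D.l_L]

theorem sw_l_mul_left (a b : H) : sw k a (fun x y => D.l (x * b) • y) = sw k b (fun u v => D.l (a * u) • S v) := by
  symm
  calc _ = sw k b (fun u v => sw k a (fun a₁ a₂ => sw k u (fun u₁ u₂ => D.l (a₁ * u₁) • (a₂ * (u₂ * S v))))) :=
        sw_congr fun u v => by
          have := congrArg (fun t => t * S v) (D.lam_l (a * u))
          simp only [smul_mul_assoc, one_mul] at this
          rw [← this, lam_apply, sw_mul a u (fun x y => D.l x • y),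
            IsLinearMap.map_sw (L := fun t => t * S v) (by fun_prop)]
          refine sw_congr fun a₁ a₂ => ?_
          rw [IsLinearMap.map_sw (L := fun t => t * S v) (by fun_prop)]
          exact sw_congr fun u₁ u₂ => by rw [smul_mul_assoc, mul_assoc]
    _ = _ := by
          rw [sw_comm]
          refine sw_congr fun a₁ a₂ => ?_
          rw [sw_assoc b (fun u₁ u₂ v => D.l (a₁ * u₁) • (a₂ * (u₂ * S v))),
            ← sw_smul_counit (k := k) b (fun t => D.l (a₁ * t) • a₂)]
          refine sw_congr fun u t => ?_
          rw [sw_mul_antipode t (fun s => D.l (a₁ * u) • (a₂ * s)), mul_one]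

theorem sw_l_mul_right (a b : H) :
    sw k b (fun u v => D.l (a * v) • u) = sw k a (fun x y => D.l (y * b) • (S x * D.g)) := by
  symm
  calc _ = sw k a (fun x y => sw k y (fun y₁ y₂ => sw k b (fun b₁ b₂ => D.l (y₂ * b₂) • ((S x * y₁) * b₁)))) :=
        sw_congr fun x y => by
          have := congrArg (fun t => S x * t) (D.rho_l (y * b))
          simp only [mul_smul_comm] at this
          rw [← this, rho_apply, sw_mul y b (fun x y => D.l y • x),
            IsLinearMap.map_sw (L := fun t => S x * t) (by fun_prop)]
          refine sw_congr fun a₁ a₂ => ?_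
          rw [IsLinearMap.map_sw (L := fun t => S x * t) (by fun_prop)]
          exact sw_congr fun u₁ u₂ => by rw [mul_smul_comm, mul_assoc]
    _ = _ := by
          rw [← sw_assoc a (fun x y₁ y₂ => sw k b (fun b₁ b₂ => D.l (y₂ * b₂) • ((S x * y₁) * b₁)))]
          rw [← sw_counit_smul (k := k) a (fun t => sw k b (fun u v => D.l (t * v) • u))]
          refine sw_congr fun u t => ?_
          rw [sw_antipode_mul u (fun s => sw k b (fun b₁ b₂ => D.l (t * b₂) • (s * b₁)))]
          simp only [one_mul]

theorem sw_L (a : H) : sw k D.L (fun u v => D.l (a * u) • S v) = a := by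
  rw [← sw_l_mul_left]
  simp only [l_mul_L]
  exact sw_counit_smul a (fun x => x)

theorem sw_L_left (b : H) : sw k D.L (fun x y => D.l (x * b) • y) = S (lam D.α b) := by
  rw [sw_l_mul_left]
  simp only [l_L_mul]
  rw [lam_apply, map_sw]
  simp only [map_smul]

theorem sw_L_right (a : H) : sw k D.L (fun u v => D.l (a * v) • u) = S a * D.g := by
  rw [sw_l_mul_right]
  simp only [l_mul_L]
  exact sw_smul_counit a (fun x => S x * D.g)

theorem rho_α_eq (b : H) : rho D.α b = sw k D.L (fun x y => D.l (y * b) • (S x * D.g)) := by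
  rw [← sw_l_mul_right]
  simp only [l_L_mul]
  rfl

theorem L_eq : S (lam D.α D.L) = D.L := by
  rw [← sw_L_left]
  simp only [l_mul_L]
  exact sw_counit_smul D.L (fun x => x)

variable [FiniteDimensional k H]

theorem antipode_sq (a : H) : S (S a) = sw k D.L (fun u v => D.l (a * v) • (D.g * S u)) := by
  have h := congrArg (fun t => D.g * S t) (D.sw_L_right a)
  simp only [antipode_mul_antidistrib] at h
  rw [← mul_assoc, D.g_groupLike.mul_antipode_cancel, one_mul] at h
  rw [← h, IsLinearMap.map_sw (L := fun t => D.g * S t) (by fun_prop)]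
  exact sw_congr fun u v => by simp

theorem apply_mul_eq (b x : H) : D.l (x * b) = D.l (S (S (lam D.α b)) * x) := by
  let E : H →ₗ[k] HDual k H := IsLinearMap.mk' (fun h => precompMulLeft h D.l)
    ⟨fun x y => by ext; simp [add_mul], fun c x => by ext; simp⟩
  have hE : Function.Surjective E := by
    refine (LinearMap.injective_iff_surjective_of_finrank_eq_finrank HDual.finrank_eq.symm).1 ?_
    refine (injective_iff_map_eq_zero _).2 fun h hh => D.nondeg h fun x => ?_
    simpa [E] using congrArg (fun f : HDual k H => f x) hh
  obtain ⟨c, hc⟩ := hE (precompMulRight D.l b)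
  have hc' : ∀ x, D.l (c * x) = D.l (x * b) := fun x => by
    simpa [E] using congrArg (fun f : HDual k H => f x) hc
  have : c = S (S (lam D.α b)) := by
    rw [← D.sw_L c, ← D.sw_L_left, map_sw]
    simp only [hc', map_smul]
  rw [← this, hc']

/-- Radford's formula for the fourth power of the antipode. -/
theorem radford (b : H) : D.g * rho D.α b = S (S (S (S (lam D.α b)))) * D.g := by
  rw [rho_α_eq]
  simp only [D.apply_mul_eq b]
  have h := congrArg (fun t => S t * D.g) (D.sw_L_right (S (S (lam D.α b))))
  simp only [antipode_mul_antidistrib] at h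
  have h2 : sw k D.L (fun x y => D.l (S (S (lam D.α b)) * y) • (S x * D.g)) = 
     S D.g * S (S (S (S (lam D.α b)))) * D.g := by
    rw [← h, IsLinearMap.map_sw (L := fun t => S t * D.g) (by fun_prop)]
    exact sw_congr fun u v => by simp
  rw [h2, ← mul_assoc, ← mul_assoc, D.g_groupLike.mul_antipode_cancel, one_mul]

theorem trace_mulLeft_antipode_sq (h : H) :
    LinearMap.trace k H (LinearMap.mulLeft k h ∘ₗ S ∘ₗ S) = counit (R := k) D.L * D.l (h * D.g) := by
  have : LinearMap.mulLeft k h ∘ₗ S ∘ₗ S = sw k D.L (fun u v =>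
      (HDual.of.symm (precompMulRight D.l v)).smulRight (h * D.g * S u)) := by
    ext a
    rw [IsLinearMap.map_sw (L := fun t : H →ₗ[k] H => t a) (by fun_prop)]
    simp only [LinearMap.comp_apply, LinearMap.mulLeft_apply]
    rw [D.antipode_sq, IsLinearMap.map_sw (L := fun t => h * t) (by fun_prop)]
    exact sw_congr fun u v => by simp [mul_assoc]
  rw [this, map_sw]
  simp only [LinearMap.trace_smulRight]
  simp only [HDual.of_symm_apply, precompMulRight_apply, mul_assoc]
  rw [sw_antipode_mul D.L (fun t => D.l (h * (D.g * t)))]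
  simp

theorem trace_rho_antipode_sq (f : HDual k H) :
    LinearMap.trace k H (rho f ∘ₗ S ∘ₗ S) = D.l D.g * f (D.g * S D.L) := by
  have : rho f ∘ₗ S ∘ₗ S = sw k D.L (fun u v =>
      (HDual.of.symm (precompMulRight D.l v)).smulRight (rho f (D.g * S u))) := by
    ext a
    rw [IsLinearMap.map_sw (L := fun t : H →ₗ[k] H => t a) (by fun_prop)]
    simp only [LinearMap.comp_apply]
    rw [D.antipode_sq, map_sw]
    exact sw_congr fun u v => by simp
  rw [this, map_sw]
  simp only [LinearMap.trace_smulRight]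
  simp only [HDual.of_symm_apply, precompMulRight_apply]
  calc _ = sw k D.L (fun u v => sw k u (fun x y => f (D.g * S x) * D.l (D.g * (S y * v)))) := sw_congr fun u v => by
        rw [rho_apply, sw_mul D.g (S u) (fun x y => f y • x),
          sw_of_comul D.g D.g D.g D.g_groupLike.comul_eq_tmul_self
            (fun a₁ a₂ => sw k (S u) fun b₁ b₂ => f (a₂ * b₂) • (a₁ * b₁)),
          sw_antipode u (fun b₁ b₂ => f (D.g * b₂) • (D.g * b₁)),
          IsLinearMap.map_sw (L := fun t => D.l (t * v)) (by fun_prop)]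
        exact sw_congr fun x y => by simp [mul_assoc]
    _ = _ := by
        rw [sw_assoc D.L (fun x y v => f (D.g * S x) * D.l (D.g * (S y * v)))]
        have : ∀ u v : H, sw k v (fun y z => f (D.g * S u) * D.l (D.g * (S y * z))) = 
          counit (R := k) v • (D.l D.g * f (D.g * S u)) := fun u v => by
            rw [sw_antipode_mul v (fun t => f (D.g * S u) * D.l (D.g * t)), mul_one, mul_comm (D.l D.g)]
        simp only [this]
        exact sw_smul_counit D.L (fun u => D.l D.g * f (D.g * S u))

theorem l_groupLike (hg : D.g ≠ 1) {u : H} (hu : IsGroupLikeElem k u) : D.l u = 0 := by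
  by_contra h
  have h1 := D.rho_l u
  rw [hu.rho_eq] at h1
  have h2 := D.lam_l u
  rw [lam_apply, sw_of_comul u u u hu.comul_eq_tmul_self (fun x y => D.l x • y)] at h2
  exact hg ((smul_right_injective H h (h1 : D.l u • u = D.l u • D.g)).symm.trans (smul_right_injective H h (h2 : D.l u • u = D.l u • 1)))

theorem groupLike_L (hα : D.α ≠ 1) {χ : HDual k H} (hχ : IsGroupLikeElem k χ) : χ D.L = 0 := by
  by_contra h
  refine hα (HDual.ext fun x => ?_)
  have h1 := congrArg χ (D.mul_L x)
  have h2 := congrArg χ (D.L_mul x)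
  rw [HDual.mul_of_isGroupLikeElem hχ, map_smul, smul_eq_mul] at h1 h2
  rw [mul_comm (χ D.L)] at h2
  rw [HDual.one_apply, ← mul_right_cancel₀ h h2, mul_right_cancel₀ h h1]

theorem α_groupLike : IsGroupLikeElem k D.α := HDual.isGroupLikeElem_of_mul D.α_one D.α_mul

end IntDatum
end Formulas

open scoped Classical

section Idem
variable {k V : Type*} [Field k] [AddCommGroup V] [Module k V] [FiniteDimensional k V]

theorem trace_idem {E : Module.End k V} (hE : E * E = E) :
    LinearMap.trace k V E = (Module.finrank k (LinearMap.range E) : k) :=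
  LinearMap.IsProj.trace (LinearMap.IsIdempotentElem.isProj_range E hE)

end Idem

section Cyc
variable {k A : Type*} [Field k] [Ring A] [Algebra k A]

/-- The spectral idempotent of an element of finite order at the root of unity `z`. -/
noncomputable def cproj (N : ℕ) (g : A) (z : k) : A := (N : k)⁻¹ • ∑ i ∈ Finset.range N, (z⁻¹ • g) ^ i

variable {N : ℕ} {g : A}

theorem smul_pow_eq_one {z : k} (hz : z ^ N = 1) (hg : g ^ N = 1) : (z⁻¹ • g) ^ N = 1 := by
  rw [smul_pow, hg, inv_pow, hz]; simp

theorem rootOfUnity_ne_zero (hN : 0 < N) {z : k} (hz : z ^ N = 1) : z ≠ 0 := by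
  rintro rfl
  rw [zero_pow hN.ne'] at hz
  exact zero_ne_one hz

theorem mul_cproj (hN : 0 < N) (hg : g ^ N = 1) {z : k} (hz : z ^ N = 1) : g * cproj N g z = z • cproj N g z := by
  have h0 := rootOfUnity_ne_zero hN hz
  have h1 := mul_geom_sum (z⁻¹ • g) N
  rw [smul_pow_eq_one hz hg, sub_self, sub_mul, one_mul, sub_eq_zero] at h1
  rw [cproj, mul_smul_comm, smul_comm z]
  congr 1
  conv_rhs => rw [← h1, smul_mul_assoc, smul_smul, mul_inv_cancel₀ h0, one_smul]

theorem cproj_commute {h : A} (hh : Commute g h) (z : k) : Commute (cproj N g z) h := by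
  unfold cproj
  refine Commute.smul_left (Commute.sum_left _ _ _ fun i _ => ?_) _
  exact (hh.smul_left _).pow_left i

theorem cproj_map {B : Type*} [Ring B] [Algebra k B] (φ : A →ₐ[k] B) (z : k) : φ (cproj N g z) = cproj N (φ g) z := by
  simp [cproj, map_sum]

theorem geom_sum_root [CharZero k] (hN : 0 < N) {w : k} (hw : w ^ N = 1) :
    (N : k)⁻¹ * ∑ i ∈ Finset.range N, w ^ i = if w = 1 then 1 else 0 := by
  split_ifs with h
  · subst h
    have : (N : k) ≠ 0 := by exact_mod_cast hN.ne'
    simp [this]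
  · have h1 := mul_geom_sum w N
    rw [hw, sub_self] at h1
    rw [(mul_eq_zero.1 h1).resolve_left (sub_ne_zero.2 h), mul_zero]

theorem cproj_eigen [CharZero k] {M : Type*} [AddCommGroup M] [Module k M] {T : Module.End k M} (hN : 0 < N)
    {z w : k} (hz : z ^ N = 1) (hw : w ^ N = 1) {x : M} (hx : T x = w • x) :
    cproj N T z x = if w = z then x else 0 := by
  have h0 := rootOfUnity_ne_zero hN hz
  have h1 : ∀ i, ((z⁻¹ • T) ^ i) x = (z⁻¹ * w) ^ i • x := fun i => by
    induction i with
    | zero => simp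
    | succ i ih => rw [pow_succ', Module.End.mul_apply, ih, map_smul, LinearMap.smul_apply, hx, smul_smul, smul_smul, pow_succ, mul_assoc]
  have h2 : (z⁻¹ * w) ^ N = 1 := by rw [mul_pow, inv_pow, hz, hw]; simp
  have h3 := geom_sum_root (k := k) hN h2
  have h4 : (z⁻¹ * w = 1) ↔ w = z := by
    rw [inv_mul_eq_one₀ h0, eq_comm]
  rw [cproj, LinearMap.smul_apply, LinearMap.sum_apply]
  simp_rw [h1]
  rw [← Finset.sum_smul, smul_smul, h3]
  simp [h4]

theorem cproj_mul_eigen [CharZero k] (hN : 0 < N)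
    {z w : k} (hz : z ^ N = 1) (hw : w ^ N = 1) {x : A} (hx : g * x = w • x) :
    cproj N g z * x = if w = z then x else 0 := by
  have := cproj_eigen (T := Algebra.lmul k A g) hN hz hw (x := x) hx
  rw [← cproj_map (Algebra.lmul k A)] at this
  exact this

theorem cproj_mul_cproj [CharZero k] (hN : 0 < N) (hg : g ^ N = 1) {z w : k} (hz : z ^ N = 1) (hw : w ^ N = 1) :
    cproj N g z * cproj N g w = if w = z then cproj N g w else 0 :=
  cproj_mul_eigen hN hz hw (mul_cproj hN hg hw)

theorem cproj_idem [CharZero k] (hN : 0 < N) (hg : g ^ N = 1) {z : k} (hz : z ^ N = 1) :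
    cproj N g z * cproj N g z = cproj N g z := by
  rw [cproj_mul_cproj hN hg hz hz, if_pos rfl]

variable (k) in
/-- The finite set of `N`-th roots of unity. -/
noncomputable abbrev rou (N : ℕ) : Finset k := Polynomial.nthRootsFinset N (1 : k)

theorem mem_rou (hN : 0 < N) {z : k} : z ∈ rou k N ↔ z ^ N = 1 := Polynomial.mem_nthRootsFinset hN 1

section
variable [IsAlgClosed k] [CharZero k]

variable (k) in
theorem exists_prim (hN : 0 < N) : ∃ ζ : k, IsPrimitiveRoot ζ N :=
  have : NeZero N := ⟨hN.ne'⟩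
  HasEnoughRootsOfUnity.exists_primitiveRoot k N

variable (k) in
theorem card_rou (hN : 0 < N) : (rou k N).card = N :=
  have : NeZero N := ⟨hN.ne'⟩
  (exists_prim k hN).choose_spec.card_nthRootsFinset

theorem sum_rou_inv_pow (hN : 0 < N) {i : ℕ} (hi : i < N) (h0 : i ≠ 0) : ∑ z ∈ rou k N, (z⁻¹) ^ i = 0 := by
  obtain ⟨ζ, hζ⟩ := exists_prim k hN
  have hζ0 := rootOfUnity_ne_zero hN hζ.pow_eq_one
  have h1 : ∑ z ∈ rou k N, (z⁻¹) ^ i = ζ ^ i * ∑ z ∈ rou k N, (z⁻¹) ^ i := by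
    rw [Finset.mul_sum]
    refine Finset.sum_bij (fun z _ => ζ * z) (fun z hz => ?_) (fun a _ b _ h => mul_left_cancel₀ hζ0 h)
      (fun b hb => ⟨ζ⁻¹ * b, ?_, by rw [mul_inv_cancel_left₀ hζ0]⟩) (fun z hz => ?_)
    · rw [mem_rou hN] at *; rw [mul_pow, hz, hζ.pow_eq_one, one_mul]
    · rw [mem_rou hN] at *; rw [mul_pow, hb, inv_pow, hζ.pow_eq_one]; simp
    · rw [← mul_pow, mul_inv, mul_inv_cancel_left₀ hζ0]
  have h2 : ζ ^ i ≠ 1 := hζ.pow_ne_one_of_pos_of_lt h0 hi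
  have h3 : (1 - ζ ^ i) * ∑ z ∈ rou k N, (z⁻¹) ^ i = 0 := by rw [sub_mul, one_mul, ← h1, sub_self]
  exact (mul_eq_zero.1 h3).resolve_left (sub_ne_zero.2 h2.symm)

theorem sum_cproj (hN : 0 < N) (g : A) : ∑ z ∈ rou k N, cproj N g z = 1 := by
  simp only [cproj, ← Finset.smul_sum, smul_pow]
  rw [Finset.sum_comm]
  simp only [← Finset.sum_smul]
  rw [Finset.sum_eq_single_of_mem 0 (Finset.mem_range.2 hN)
    (fun i hi h0 => by rw [sum_rou_inv_pow hN (Finset.mem_range.1 hi) h0, zero_smul])]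
  have : (N : k) ≠ 0 := by exact_mod_cast hN.ne'
  simp [card_rou k hN, smul_smul, this]

theorem pow_eq_sum_cproj (hN : 0 < N) (hg : g ^ N = 1) (i : ℕ) : g ^ i = ∑ z ∈ rou k N, z ^ i • cproj N g z := by
  conv_lhs => rw [← mul_one (g ^ i), ← sum_cproj (k := k) hN g, Finset.mul_sum]
  refine Finset.sum_congr rfl fun z hz => ?_
  rw [mem_rou hN] at hz
  induction i with
  | zero => simp
  | succ i ih => rw [pow_succ, mul_assoc, mul_cproj hN hg hz, mul_smul_comm, ih, smul_smul, pow_succ, mul_comm]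
end

end Cyc

section TraceMul
variable {k H : Type*} [Field k] [Ring H] [HopfAlgebra k H] [FiniteDimensional k H]
local notation "S" => antipode k

variable (k H) in
/-- The canonical map `a ⊗ b ↦ a₍₁₎ ⊗ a₍₂₎ b`. -/
noncomputable def canMap : H ⊗[k] H →ₗ[k] H ⊗[k] H :=
  TensorProduct.lift (LinearMap.mk₂ k (fun a b => sw k a (fun x y => x ⊗ₜ[k] (y * b)))
    (fun a a' b => sw_add_left a a' (fun x y => x ⊗ₜ[k] (y * b)))
    (fun c a b => sw_smul_left c a (fun x y => x ⊗ₜ[k] (y * b)))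
    (fun a b b' => by simp only [mul_add, TensorProduct.tmul_add, sw_add])
    (fun c a b => by simp only [mul_smul_comm, TensorProduct.tmul_smul, smul_sw]))

theorem canMap_tmul (a b : H) : canMap k H (a ⊗ₜ b) = sw k a (fun x y => x ⊗ₜ[k] (y * b)) := rfl

theorem canMap_surjective : Function.Surjective (canMap k H) := by
  rw [← LinearMap.range_eq_top, eq_top_iff]
  intro t _
  induction t using TensorProduct.induction_on with
  | zero => exact zero_mem _
  | add x y hx hy => exact add_mem (hx trivial) (hy trivial)
  | tmul a b =>
    refine ⟨sw k a (fun x y => x ⊗ₜ[k] (S y * b)), ?_⟩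
    rw [map_sw]
    simp only [canMap_tmul]
    rw [sw_assoc a (fun u v y => u ⊗ₜ[k] (v * (S y * b)))]
    have : ∀ u y : H, sw k y (fun v z => u ⊗ₜ[k] (v * (S z * b))) = counit (R := k) y • (u ⊗ₜ[k] b) := fun u y => by
      simp only [← mul_assoc]
      rw [sw_mul_antipode y (fun t => u ⊗ₜ[k] (t * b)), one_mul]
    simp only [this]
    exact sw_smul_counit a (fun u => u ⊗ₜ[k] b)

variable (k H) in
/-- The character of the regular representation. -/
noncomputable def regChar : HDual k H := HDual.of (LinearMap.trace k H ∘ₗ LinearMap.mul k H)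

theorem regChar_apply (h : H) : regChar k H h = LinearMap.trace k H (LinearMap.mulLeft k h) := rfl

theorem regChar_mul_regChar : regChar k H * regChar k H = (Module.finrank k H : k) • regChar k H := by
  ext h
  let e : (H ⊗[k] H) ≃ₗ[k] (H ⊗[k] H) := LinearEquiv.ofBijective (canMap k H)
    ⟨LinearMap.injective_iff_surjective.2 canMap_surjective, canMap_surjective⟩
  let A : Module.End k (H ⊗[k] H) := sw k h (fun x y => TensorProduct.map (LinearMap.mulLeft k x) (LinearMap.mulLeft k y))
  let B : Module.End k (H ⊗[k] H) := TensorProduct.map (LinearMap.mulLeft k h) LinearMap.id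
  have hAB : A ∘ₗ canMap k H = canMap k H ∘ₗ B := by
    ext a b
    simp only [TensorProduct.AlgebraTensorModule.curry_apply, LinearMap.restrictScalars_self, TensorProduct.curry_apply,
      LinearMap.comp_apply, A, B, TensorProduct.map_tmul, LinearMap.mulLeft_apply, LinearMap.id_apply, canMap_tmul]
    rw [IsLinearMap.map_sw (L := fun t : Module.End k (H ⊗[k] H) => t _) (by fun_prop),
      sw_mul h a (fun x y => x ⊗ₜ[k] (y * b))]
    refine sw_congr fun x y => ?_
    rw [map_sw]
    exact sw_congr fun u v => by simp [mul_assoc]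
  have h1 : e.conj B = A := by
    ext1
    ext a b
    have := congrArg (fun T => T (e.symm (a ⊗ₜ b))) hAB
    simp only [LinearMap.comp_apply] at this
    have h2 : canMap k H (e.symm (a ⊗ₜ b)) = a ⊗ₜ b := e.apply_symm_apply _
    rw [h2] at this
    simp only [TensorProduct.AlgebraTensorModule.curry_apply, LinearMap.restrictScalars_self, TensorProduct.curry_apply]
    rw [this]
    rfl
  have h2 := LinearMap.trace_conj' B e
  rw [h1, LinearMap.trace_tensorProduct', LinearMap.trace_id, map_sw] at h2
  simp only [LinearMap.trace_tensorProduct'] at h2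
  rw [HDual.mul_apply, HDual.smul_apply, mul_comm]
  exact h2

variable [IsAlgClosed k] [CharZero k]

theorem IsGroupLikeElem.cproj_ne_zero {g : H} (hg : IsGroupLikeElem k g) (hN : 0 < orderOf g) (z : k) :
    cproj (orderOf g) g z ≠ 0 := by
  intro h
  let G : GroupLike k H := ⟨g, hg⟩
  have hO : orderOf G = orderOf g := (orderOf_injective (GroupLike.valMonoidHom (R := k) (A := H)) GroupLike.val_injective G).symm
  have hinj : Function.Injective (fun i : Fin (orderOf g) => G ^ (i : ℕ)) := fun i j hij => by
    refine Fin.ext (pow_injOn_Iio_orderOf (x := G) ?_ ?_ hij) <;> rw [hO]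
    exacts [i.2, j.2]
  have hli := (linearIndep_groupLikeVal (R := k) (A := H)).comp _ hinj
  rw [Fintype.linearIndependent_iff] at hli
  have hn : (orderOf g : k) ≠ 0 := by exact_mod_cast hN.ne'
  have := hli (fun i => (z⁻¹) ^ (i : ℕ)) (by
    rw [cproj] at h
    have h := (smul_eq_zero.1 h).resolve_left (inv_ne_zero hn)
    rw [Finset.sum_range] at h
    rw [← h]
    exact Finset.sum_congr rfl fun i _ => by simp [smul_pow, G]) ⟨0, hN⟩
  simp at this

theorem orderOf_groupLike_pos {g : H} (hg : IsGroupLikeElem k g) : 0 < orderOf g := by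
  let G : GroupLike k H := ⟨g, hg⟩
  have hO : orderOf G = orderOf g := (orderOf_injective (GroupLike.valMonoidHom (R := k) (A := H)) GroupLike.val_injective G).symm
  have : Finite (GroupLike k H) := (linearIndep_groupLikeVal (R := k) (A := H)).finite
  rw [← hO]
  exact orderOf_pos G

theorem regChar_groupLike_sq {g : H} (hg : IsGroupLikeElem k g) :
    regChar k H g * regChar k H g = (Module.finrank k H : k) * regChar k H g := by
  have := congrArg (fun f : HDual k H => f g) (regChar_mul_regChar (k := k) (H := H))
  simp only [HDual.smul_apply, HDual.mul_apply] at this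
  rw [← this, sw_of_comul g g g hg.comul_eq_tmul_self (fun x y => regChar k H x * regChar k H y)]

/-- Dimension count for the cyclic group generated by a group-like element. -/
theorem lagrange {g : H} (hg : IsGroupLikeElem k g) : ∃ m : ℕ, orderOf g * m = Module.finrank k H ∧
    ∀ z : k, z ^ orderOf g = 1 → regChar k H (cproj (orderOf g) g z) = m := by
  have hN := orderOf_groupLike_pos (k := k) hg
  set N := orderOf g with hNdef
  have hgN : g ^ N = 1 := pow_orderOf_eq_one g
  have hE : ∀ z : k, z ^ N = 1 → LinearMap.mulLeft k (cproj N g z) * LinearMap.mulLeft k (cproj N g z) =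
      LinearMap.mulLeft k (cproj N g z) := fun z hz => by
    ext x
    simp only [Module.End.mul_apply, LinearMap.mulLeft_apply]
    rw [← mul_assoc, cproj_idem hN hgN hz]
  let m : k → ℕ := fun z => Module.finrank k (LinearMap.range (LinearMap.mulLeft k (cproj N g z)))
  have hm : ∀ z : k, z ^ N = 1 → regChar k H (cproj N g z) = m z := fun z hz => trace_idem (hE z hz)
  have hpos : ∀ z : k, z ^ N = 1 → 0 < m z := fun z hz => by
    rw [Nat.pos_iff_ne_zero]
    intro h0
    have := Submodule.finrank_eq_zero.1 h0
    have h1 : cproj N g z * 1 ∈ LinearMap.range (LinearMap.mulLeft k (cproj N g z)) := ⟨1, rfl⟩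
    rw [this, Submodule.mem_bot, mul_one] at h1
    exact hg.cproj_ne_zero (by rwa [← hNdef]) z h1
  have hsum : ∑ z ∈ rou k N, m z = Module.finrank k H := by
    have h1 := congrArg (regChar k H) (sum_cproj (k := k) hN g)
    rw [map_sum, regChar_apply 1, LinearMap.mulLeft_one, LinearMap.trace_id,
      Finset.sum_congr rfl fun z hz => hm z ((mem_rou hN).1 hz)] at h1
    exact_mod_cast h1
  have hpow : ∀ i, regChar k H (g ^ i) = ∑ w ∈ rou k N, w ^ i * (m w : k) := fun i => by
    rw [pow_eq_sum_cproj (k := k) hN hgN i, map_sum]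
    exact Finset.sum_congr rfl fun z hz => by rw [map_smul, hm z ((mem_rou hN).1 hz), smul_eq_mul]
  have hconv : ∀ z, z ^ N = 1 → ∑ w ∈ rou k N, m w * m (w⁻¹ * z) = Module.finrank k H * m z := fun z hz => by
    have h0 := rootOfUnity_ne_zero hN hz
    have key : (Module.finrank k H : k) * m z = ∑ w ∈ rou k N, ∑ v ∈ rou k N, (if z⁻¹ * (w * v) = 1 then 1 else 0) * ((m w : k) * m v) := by
      rw [← hm z hz, cproj, map_smul, map_sum]
      simp only [smul_pow, map_smul, smul_eq_mul]
      rw [mul_left_comm, Finset.mul_sum]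
      have : ∀ i ∈ Finset.range N, (Module.finrank k H : k) * (z⁻¹ ^ i * regChar k H (g ^ i)) =
          ∑ w ∈ rou k N, ∑ v ∈ rou k N, (z⁻¹ * (w * v)) ^ i * ((m w : k) * m v) := fun i _ => by
        rw [mul_left_comm, ← regChar_groupLike_sq hg.pow, hpow, Finset.sum_mul_sum, Finset.mul_sum]
        refine Finset.sum_congr rfl fun w _ => ?_
        rw [Finset.mul_sum]
        refine Finset.sum_congr rfl fun v _ => ?_
        ring
      rw [Finset.sum_congr rfl this, Finset.sum_comm, Finset.mul_sum]
      refine Finset.sum_congr rfl fun w hw => ?_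
      rw [Finset.sum_comm, Finset.mul_sum]
      refine Finset.sum_congr rfl fun v hv => ?_
      rw [mem_rou hN] at hw hv
      rw [← Finset.sum_mul, ← mul_assoc, geom_sum_root hN]
      rw [mul_pow, mul_pow, hw, hv, inv_pow, hz]; simp
    have : ((∑ w ∈ rou k N, m w * m (w⁻¹ * z) : ℕ) : k) = ((Module.finrank k H * m z : ℕ) : k) := by
      push_cast
      rw [key]
      refine Finset.sum_congr rfl fun w hw => ?_
      rw [mem_rou hN] at hw
      have hw0 := rootOfUnity_ne_zero hN hw
      rw [Finset.sum_eq_single_of_mem (w⁻¹ * z) (by rw [mem_rou hN, mul_pow, hz, inv_pow, hw]; simp)]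
      · rw [mul_inv_cancel_left₀ hw0, inv_mul_cancel₀ h0]; simp
      · intro v _ hv
        rw [if_neg, zero_mul]
        intro h
        apply hv
        rw [inv_mul_eq_one₀ h0] at h
        rw [h, inv_mul_cancel_left₀ hw0]
    exact_mod_cast this
  have hne : (rou k N).Nonempty := ⟨1, by rw [mem_rou hN, one_pow]⟩
  obtain ⟨z, hz, hmax⟩ := Finset.exists_max_image (rou k N) m hne
  have hz' := (mem_rou hN).1 hz
  have hall : ∀ w ∈ rou k N, m (w⁻¹ * z) = m z := by
    have h1 := hconv z hz'
    rw [← hsum, Finset.sum_mul] at h1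
    have hle : ∀ w ∈ rou k N, m w * m (w⁻¹ * z) ≤ m w * m z := fun w hw => by
      refine Nat.mul_le_mul_left _ (hmax _ ?_)
      rw [mem_rou hN] at hw ⊢
      rw [mul_pow, hz', inv_pow, hw]; simp
    intro w hw
    have := (Finset.sum_eq_sum_iff_of_le hle).1 h1 w hw
    exact Nat.eq_of_mul_eq_mul_left (hpos w ((mem_rou hN).1 hw)) this
  have hall' : ∀ w : k, w ^ N = 1 → m w = m z := fun w hw => by
    have hw0 := rootOfUnity_ne_zero hN hw
    have hz0 := rootOfUnity_ne_zero hN hz'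
    have := hall (z * w⁻¹) (by rw [mem_rou hN, mul_pow, inv_pow, hw, hz']; simp)
    rwa [mul_inv, inv_inv, mul_right_comm, inv_mul_cancel₀ hz0, one_mul] at this
  refine ⟨m z, ?_, fun w hw => by rw [hm w hw, hall' w hw]⟩
  rw [← hsum, Finset.sum_congr rfl fun w hw => hall' w ((mem_rou hN).1 hw)]
  simp [card_rou k hN]

end TraceMul

section Numbers
variable {k : Type*} [Field k] [CharZero k]

theorem int_sum_root_eq_zero {p : ℕ} (hp : p.Prime) {ζ : k} (hζ : IsPrimitiveRoot ζ p) {c : ℕ → ℤ}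
    (h : ∑ i ∈ Finset.range p, (c i : k) * ζ ^ i = 0) : ∃ d, ∀ i < p, c i = d := by
  have hp0 := hp.pos
  let _ : Algebra ℚ k := DivisionRing.toRatAlgebra
  let P : Polynomial ℚ := ∑ i ∈ Finset.range p, Polynomial.C (c i : ℚ) * Polynomial.X ^ i
  have hP : Polynomial.aeval ζ P = 0 := by
    simp only [P, map_sum, map_mul, map_pow, Polynomial.aeval_X, map_intCast]
    exact h
  have hcoef : ∀ i, P.coeff i = if i < p then (c i : ℚ) else 0 := fun i => by
    simp [P, Polynomial.finsetSum_coeff, Polynomial.coeff_X_pow]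
  have hdvd : Polynomial.cyclotomic p ℚ ∣ P := by
    rw [Polynomial.cyclotomic_eq_minpoly_rat hζ hp0]
    exact minpoly.dvd ℚ ζ hP
  obtain ⟨q, hq⟩ := hdvd
  have hcyc : ∀ i, (Polynomial.cyclotomic p ℚ).coeff i = if i < p then 1 else 0 := fun i => by
    have := Fact.mk hp
    rw [Polynomial.cyclotomic_prime, Polynomial.finsetSum_coeff]
    simp [Polynomial.coeff_X_pow]
  have hqd : q.natDegree = 0 := by
    by_cases hq0 : q = 0
    · simp [hq0]
    have h1 : P.natDegree ≤ p - 1 := by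
      rw [Polynomial.natDegree_le_iff_coeff_eq_zero]
      intro N hN
      rw [hcoef, if_neg (by omega)]
    rw [hq, Polynomial.natDegree_mul (Polynomial.cyclotomic_ne_zero p ℚ) hq0, Polynomial.natDegree_cyclotomic,
      Nat.totient_prime hp] at h1
    omega
  obtain ⟨d, rfl⟩ := Polynomial.natDegree_eq_zero.1 hqd
  refine ⟨c 0, fun i hi => ?_⟩
  have h1 := hcoef i
  have h2 := hcoef 0
  rw [hq, Polynomial.coeff_mul_C, hcyc] at h1 h2
  rw [if_pos hi, if_pos hi] at h1
  rw [if_pos hp0, if_pos hp0] at h2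
  have : (c i : ℚ) = c 0 := h1.symm.trans h2
  exact_mod_cast this

variable [IsAlgClosed k]

theorem rou_eq_image {N : ℕ} (hN : 0 < N) {ζ : k} (hζ : IsPrimitiveRoot ζ N) :
    rou k N = (Finset.range N).image (fun i => ζ ^ i) := by
  ext z
  rw [mem_rou hN, Finset.mem_image]
  constructor
  · intro hz
    have : NeZero N := ⟨hN.ne'⟩
    obtain ⟨i, hi, h⟩ := hζ.eq_pow_of_pow_eq_one hz
    exact ⟨i, Finset.mem_range.2 hi, h⟩
  · rintro ⟨i, _, rfl⟩
    rw [← pow_mul, mul_comm, pow_mul, hζ.pow_eq_one, one_pow]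

theorem sum_rou {M : Type*} [AddCommMonoid M] {N : ℕ} (hN : 0 < N) {ζ : k} (hζ : IsPrimitiveRoot ζ N) (f : k → M) :
    ∑ z ∈ rou k N, f z = ∑ i ∈ Finset.range N, f (ζ ^ i) := by
  rw [rou_eq_image hN hζ, Finset.sum_image]
  intro i hi j hj h
  exact hζ.pow_inj (Finset.mem_range.1 hi) (Finset.mem_range.1 hj) h

theorem pow_two_mul_cases {p : ℕ} {w : k} (hw : w ^ (2 * p) = 1) : w ^ p = 1 ∨ w ^ p = -1 := by
  rw [mul_comm, pow_mul] at hw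
  exact sq_eq_one_iff.1 hw

theorem sum_rou_two_mul {M : Type*} [AddCommMonoid M] {p : ℕ} (hp : Odd p) (f : k → M) :
    ∑ z ∈ rou k (2 * p), f z = ∑ z ∈ rou k p, f z + ∑ z ∈ rou k p, f (-z) := by
  have hp0 := hp.pos
  rw [← Finset.sum_filter_add_sum_filter_not (rou k (2 * p)) (fun w => w ^ p = 1)]
  congr 1
  · refine Finset.sum_congr ?_ fun _ _ => rfl
    ext w
    rw [Finset.mem_filter, mem_rou (by omega), mem_rou hp0]
    refine ⟨fun h => h.2, fun h => ⟨by rw [mul_comm, pow_mul, h, one_pow], h⟩⟩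
  · symm
    refine Finset.sum_bij (fun z _ => -z) (fun z hz => ?_) (fun _ _ _ _ h => neg_injective h) (fun w hw => ⟨-w, ?_, neg_neg w⟩)
      fun _ _ => rfl
    · rw [mem_rou hp0] at hz
      rw [Finset.mem_filter, mem_rou (by omega), hp.neg_pow, hz, mul_comm, pow_mul, hp.neg_pow, hz]
      refine ⟨by simp, ?_⟩
      intro h
      exact one_ne_zero (self_eq_neg.1 h.symm)
    · rw [Finset.mem_filter, mem_rou (by omega)] at hw
      rw [mem_rou hp0, hp.neg_pow, (pow_two_mul_cases hw.1).resolve_left hw.2, neg_neg]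

theorem mult_eq {p : ℕ} (hp : p.Prime) {n : k → ℕ} (h1 : ∑ w ∈ rou k (2 * p), n w = p)
    (h2 : ∑ w ∈ rou k (2 * p), w * (n w : k) = 0) (h3 : 0 < n 1) {w : k} (hw : w ^ (2 * p) = 1) :
    n w = if w ^ p = 1 then 1 else 0 := by
  have hp0 := hp.pos
  rcases hp.eq_two_or_odd' with rfl | hodd
  · obtain ⟨ζ, hζ⟩ := exists_prim k (N := 4) (by norm_num)
    have hz2 : ζ ^ 2 = -1 := by
      have h4 := hζ.pow_eq_one
      have := hζ.pow_ne_one_of_pos_of_lt (l := 2) (by norm_num) (by norm_num)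
      exact (pow_two_mul_cases (p := 2) h4).resolve_left this
    have hz3 : ζ ^ 3 = -ζ := by rw [pow_succ, hz2]; ring
    rw [show 2 * 2 = 4 from rfl] at h1 h2 hw
    rw [sum_rou (by norm_num) hζ] at h1 h2
    simp only [Finset.sum_range_succ, Finset.sum_range_zero, zero_add, pow_zero, pow_one, hz2, hz3] at h1 h2
    have e1 : ((n 1 : k) - n (-1)) ^ 2 + ((n ζ : k) - n (-ζ)) ^ 2 = 0 := by
      have : ((n 1 : k) - n (-1)) = - (ζ * ((n ζ : k) - n (-ζ))) := by linear_combination h2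
      rw [this]
      linear_combination ((n ζ : k) - n (-ζ)) ^ 2 * hz2
    have e2 : ((n 1 : ℤ) - n (-1)) ^ 2 + ((n ζ : ℤ) - n (-ζ)) ^ 2 = 0 := by exact_mod_cast e1
    have e3 : ((n 1 : ℤ) - n (-1)) = 0 := by nlinarith [sq_nonneg ((n 1 : ℤ) - n (-1)), sq_nonneg ((n ζ : ℤ) - n (-ζ))]
    have e4 : n 1 = 1 ∧ n (-1) = 1 ∧ n ζ = 0 ∧ n (-ζ) = 0 := by omega
    have hw' : w ∈ rou k 4 := (mem_rou (by norm_num)).2 hw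
    rw [rou_eq_image (by norm_num) hζ, Finset.mem_image] at hw'
    obtain ⟨i, hi, rfl⟩ := hw'
    rw [Finset.mem_range] at hi
    have hne : (-1 : k) ≠ 1 := fun h => one_ne_zero (self_eq_neg.1 h.symm)
    interval_cases i
    · simp [e4.1]
    · simp [e4.2.2.1, hz2, hne]
    · simp [e4.2.1, hz2]
    · simp [e4.2.2.2, hz2, hz3, hne]
  · obtain ⟨ζ, hζ⟩ := exists_prim k hp0
    rw [sum_rou_two_mul hodd, sum_rou hp0 hζ, sum_rou hp0 hζ] at h1 h2
    obtain ⟨d, hd⟩ := int_sum_root_eq_zero hp hζ (c := fun i => (n (ζ ^ i) : ℤ) - n (-ζ ^ i)) (by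
      rw [← h2, ← Finset.sum_add_distrib]
      refine Finset.sum_congr rfl fun i _ => ?_
      push_cast; ring)
    have hsum : ∑ i ∈ Finset.range p, ((n (ζ ^ i) : ℤ) - n (-ζ ^ i)) = p * d := by
      rw [Finset.sum_congr rfl fun i hi => hd i (Finset.mem_range.1 hi)]; simp
    rw [Finset.sum_sub_distrib] at hsum
    have h1' : ∑ i ∈ Finset.range p, (n (ζ ^ i) : ℤ) + ∑ i ∈ Finset.range p, (n (-ζ ^ i) : ℤ) = p := by exact_mod_cast h1
    set A := ∑ i ∈ Finset.range p, (n (ζ ^ i) : ℤ)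
    set B := ∑ i ∈ Finset.range p, (n (-ζ ^ i) : ℤ) with hB
    have hA0 : 0 < A := by
      refine Finset.sum_pos' (fun _ _ => by positivity) ⟨0, Finset.mem_range.2 hp0, ?_⟩
      simpa using h3
    have hB0 : 0 ≤ B := Finset.sum_nonneg fun _ _ => by positivity
    have hd1 : d = 1 := by
      obtain ⟨r, hr⟩ := hodd
      have hpd : (p : ℤ) = 2 * r + 1 := by exact_mod_cast hr
      have hpp : (0 : ℤ) < p := by exact_mod_cast hp0
      have hub : d ≤ 1 := by nlinarith
      have hlb : -1 < d := by nlinarith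
      have : d ≠ 0 := by
        rintro rfl
        omega
      omega
    have hBz : B = 0 := by rw [hd1] at hsum; omega
    have hBi : ∀ i < p, n (-ζ ^ i) = 0 := fun i hi => by
      have := (Finset.sum_eq_zero_iff_of_nonneg (fun _ _ => by positivity)).1 (hB.symm.trans hBz) i (Finset.mem_range.2 hi)
      exact_mod_cast this
    have hAi : ∀ i < p, n (ζ ^ i) = 1 := fun i hi => by
      have := hd i hi
      rw [hBi i hi, hd1] at this
      omega
    split_ifs with hwp
    · have := (mem_rou hp0).2 hwp
      rw [rou_eq_image hp0 hζ, Finset.mem_image] at this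
      obtain ⟨i, hi, rfl⟩ := this
      exact hAi i (Finset.mem_range.1 hi)
    · have hm := (pow_two_mul_cases hw).resolve_left hwp
      have : -w ∈ rou k p := by rw [mem_rou hp0, hodd.neg_pow, hm, neg_neg]
      rw [rou_eq_image hp0 hζ, Finset.mem_image] at this
      obtain ⟨i, hi, h⟩ := this
      rw [← neg_neg w, ← h]
      exact hBi i (Finset.mem_range.1 hi)

end Numbers

section JointEigen
variable {k V : Type*} [Field k] [CharZero k] [IsAlgClosed k] [AddCommGroup V] [Module k V] [FiniteDimensional k V]

/-- Joint eigenspace of two endomorphisms. -/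
def jeig (A T : Module.End k V) (z w : k) : Submodule k V := A.eigenspace z ⊓ T.eigenspace w

theorem mem_jeig {A T : Module.End k V} {z w : k} {x : V} : x ∈ jeig A T z w ↔ A x = z • x ∧ T x = w • x := by
  simp [jeig]

variable {A T : Module.End k V} {N M : ℕ}

theorem trace_cproj_mul_cproj (hN : 0 < N) (hM : 0 < M) (hA : A ^ N = 1) (hT : T ^ M = 1) (h : Commute A T)
    {z w : k} (hz : z ^ N = 1) (hw : w ^ M = 1) :
    LinearMap.trace k V (cproj N A z * cproj M T w) = (Module.finrank k (jeig A T z w) : k) := by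
  have hc : Commute (cproj N A z) (cproj M T w) := cproj_commute (cproj_commute h.symm w).symm z
  have hi : cproj N A z * cproj M T w * (cproj N A z * cproj M T w) = cproj N A z * cproj M T w := by
    rw [mul_assoc, ← mul_assoc (cproj M T w), ← hc.eq, mul_assoc, cproj_idem hM hT hw, ← mul_assoc, cproj_idem hN hA hz]
  rw [trace_idem hi]
  have : LinearMap.range (cproj N A z * cproj M T w) = jeig A T z w := by
    ext x
    rw [mem_jeig, LinearMap.mem_range]
    constructor
    · rintro ⟨y, rfl⟩
      constructor
      · have := congrArg (fun f => f (cproj M T w y)) (mul_cproj hN hA hz)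
        simpa using this
      · rw [hc.eq]
        have := congrArg (fun f => f (cproj N A z y)) (mul_cproj hM hT hw)
        simpa using this
    · rintro ⟨h1, h2⟩
      refine ⟨x, ?_⟩
      rw [Module.End.mul_apply, cproj_eigen hM hw hw h2, if_pos rfl, cproj_eigen hN hz hz h1, if_pos rfl]
  rw [this]

theorem sum_finrank_jeig (hN : 0 < N) (hM : 0 < M) (hA : A ^ N = 1) (hT : T ^ M = 1) (h : Commute A T)
    {z : k} (hz : z ^ N = 1) (i : ℕ) :
    ∑ w ∈ rou k M, w ^ i * (Module.finrank k (jeig A T z w) : k) = LinearMap.trace k V (cproj N A z * T ^ i) := by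
  rw [pow_eq_sum_cproj (k := k) hM hT i, Finset.mul_sum, map_sum]
  refine Finset.sum_congr rfl fun w hw => ?_
  rw [mem_rou hM] at hw
  rw [mul_smul_comm, map_smul, trace_cproj_mul_cproj hN hM hA hT h hz hw, smul_eq_mul]

end JointEigen

section Ssq
variable {k H : Type*} [Field k] [Ring H] [HopfAlgebra k H] [FiniteDimensional k H]

local notation "S" => antipode k

variable (k H) in
/-- The square of the antipode. -/
noncomputable def Ssq : Module.End k H := S ∘ₗ S

theorem Ssq_apply (h : H) : Ssq k H h = S (S h) := rfl

theorem Ssq_mul (a b : H) : Ssq k H (a * b) = Ssq k H a * Ssq k H b := by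
  simp [Ssq_apply, antipode_mul_antidistrib]

theorem Ssq_one : Ssq k H 1 = 1 := by simp [Ssq_apply, antipode_one]

theorem Ssq_groupLike {g : H} (hg : IsGroupLikeElem k g) : Ssq k H g = g := hg.antipode_antipode

theorem HDual.Ssq_apply_apply (f : HDual k H) (h : H) : Ssq k (HDual k H) f h = f (Ssq k H h) := by
  simp [Ssq_apply, HDual.antipode_apply]

theorem rho_Ssq (f : HDual k H) (h : H) : rho f (Ssq k H h) = Ssq k H (rho (Ssq k _ f) h) :=
  HDual.eq_of_forall (k := k) fun f' => by
    rw [apply_rho, ← HDual.Ssq_apply_apply, Ssq_mul, ← apply_rho, HDual.Ssq_apply_apply]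

theorem lam_Ssq (f : HDual k H) (h : H) : lam f (Ssq k H h) = Ssq k H (lam (Ssq k _ f) h) :=
  HDual.eq_of_forall (k := k) fun f' => by
    rw [apply_lam, ← HDual.Ssq_apply_apply, Ssq_mul, ← apply_lam, HDual.Ssq_apply_apply]

theorem lam_pow (f : HDual k H) (i : ℕ) : lam f ^ i = lam (f ^ i) := by
  induction i with
  | zero =>
    ext h
    refine HDual.eq_of_forall (k := k) fun f' => ?_
    rw [pow_zero, pow_zero, apply_lam, one_mul]; rfl
  | succ i ih =>
    ext h
    rw [pow_succ f, lam_mul, ← ih, pow_succ']; rfl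

theorem rho_mul_of_groupLike {χ : HDual k H} (hχ : IsGroupLikeElem k χ) (a b : H) : rho χ (a * b) = rho χ a * rho χ b := by
  rw [rho_apply, sw_mul a b (fun x y => χ y • x), rho_apply, rho_apply]
  rw [IsLinearMap.map_sw (L := fun t => t * sw k b (fun x y => χ y • x)) (by fun_prop)]
  refine sw_congr fun x y => ?_
  rw [IsLinearMap.map_sw (L := fun t => (χ y • x) * t) (by fun_prop)]
  refine sw_congr fun x' y' => ?_
  rw [HDual.mul_of_isGroupLikeElem hχ, smul_mul_smul_comm]

theorem rho_one_right (f : HDual k H) : rho f (1 : H) = f 1 • 1 := (IsGroupLikeElem.one (R := k) (A := H)).rho_eq f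

theorem commute_rho_Ssq {χ : HDual k H} (hχ : IsGroupLikeElem k χ) : Commute (rho χ) (Ssq k H) := by
  ext h
  rw [Module.End.mul_apply, rho_Ssq, Ssq_groupLike hχ]; rfl

theorem commute_lam_Ssq {χ : HDual k H} (hχ : IsGroupLikeElem k χ) : Commute (lam χ) (Ssq k H) := by
  ext h
  rw [Module.End.mul_apply, lam_Ssq, Ssq_groupLike hχ]; rfl

theorem commute_mulLeft_Ssq {g : H} (hg : IsGroupLikeElem k g) : Commute (LinearMap.mulLeft k g) (Ssq k H) := by
  ext h
  simp [Ssq_mul, Ssq_groupLike hg]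

/-- Conjugation by a group-like element. -/
noncomputable def adj (g : H) : Module.End k H := LinearMap.mulLeft k g * LinearMap.mulRight k (S g)

theorem adj_pow {g : H} (hg : IsGroupLikeElem k g) {p : ℕ} (hp : g ^ p = 1) : (adj g : Module.End k H) ^ p = 1 := by
  have h1 : (S g) ^ p = 1 := by
    have hc : Commute (S g) g := by rw [Commute, SemiconjBy, hg.mul_antipode_cancel, hg.antipode_mul_cancel]
    have := hc.mul_pow p
    rwa [hg.antipode_mul_cancel, one_pow, hp, mul_one, eq_comm] at this
  have hc : Commute (LinearMap.mulLeft k g) (LinearMap.mulRight k (S g)) := by ext h; simp [mul_assoc]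
  rw [adj, hc.mul_pow, LinearMap.pow_mulLeft, LinearMap.pow_mulRight, hp, h1]
  ext; simp

theorem Ssq_pow (D : IntDatum k H) {p : ℕ} (hg : D.g ^ p = 1) (hα : D.α ^ p = 1) : Ssq k H ^ (2 * p) = 1 := by
  have e : Ssq k H ^ 2 * lam D.α = adj D.g * rho D.α := by
    ext b
    have h := congrArg (fun t => t * S D.g) (D.radford b)
    simp only [mul_assoc] at h
    rw [D.g_groupLike.mul_antipode_cancel, mul_one] at h
    simp only [adj, Module.End.mul_apply, LinearMap.mulLeft_apply, LinearMap.mulRight_apply, pow_two]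
    exact h.symm
  have c1 : Commute (Ssq k H ^ 2) (lam D.α) := (commute_lam_Ssq D.α_groupLike).symm.pow_left 2
  have c2 : Commute (adj D.g) (rho D.α) := by
    ext b
    simp only [adj, Module.End.mul_apply, LinearMap.mulLeft_apply, LinearMap.mulRight_apply]
    rw [rho_mul_of_groupLike D.α_groupLike, rho_mul_of_groupLike D.α_groupLike, D.g_groupLike.rho_eq,
      D.g_groupLike.antipode.rho_eq, mul_smul_comm, smul_mul_assoc, mul_smul_comm, smul_smul,
      ← D.α_mul, D.g_groupLike.mul_antipode_cancel, D.α_one, one_smul]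
  have := congrArg (fun t => t ^ p) e
  rw [c1.mul_pow, c2.mul_pow, lam_pow, hα, adj_pow D.g_groupLike hg, ← map_pow, hα, map_one, ← pow_mul] at this
  rw [one_mul] at this
  rw [← this]
  have e2 : lam (1 : HDual k H) = 1 := by rw [← pow_zero (1 : HDual k H), ← lam_pow, pow_zero]
  rw [e2, mul_one]

theorem span_pow_eq_top {g : H} (hg : IsGroupLikeElem k g) (h : orderOf g = Module.finrank k H) :
    Submodule.span k (Set.range fun i : ℕ => g ^ i) = ⊤ := by
  let v : Fin (orderOf g) → H := fun i => g ^ (i : ℕ)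
  have hv : LinearIndependent k v := by
    have := (linearIndep_groupLikeVal (R := k) (A := H)).comp
      (fun i : Fin (orderOf g) => (⟨g ^ (i : ℕ), hg.pow⟩ : GroupLike k H)) (fun i j hij => ?_)
    · exact this
    · have := congrArg GroupLike.val hij
      exact Fin.ext (pow_injOn_Iio_orderOf (Set.mem_Iio.2 i.2) (Set.mem_Iio.2 j.2) this)
  rw [eq_top_iff, ← hv.span_eq_top_of_card_eq_finrank' (by simpa using h)]
  exact Submodule.span_mono (by rintro _ ⟨i, rfl⟩; exact ⟨i, rfl⟩)

theorem orderOf_cases [CharZero k] [IsAlgClosed k] {p : ℕ} (hp : p.Prime) (hdim : Module.finrank k H = p ^ 2) {g : H}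
    (hg : IsGroupLikeElem k g) (h1 : g ≠ 1) :
    orderOf g = p ∨ Submodule.span k (Set.range fun i : ℕ => g ^ i) = ⊤ := by
  obtain ⟨m, hm, -⟩ := lagrange hg
  obtain ⟨i, hi, h⟩ := (Nat.dvd_prime_pow hp).1 (Dvd.intro m (hm.trans hdim))
  interval_cases i
  · exact absurd (orderOf_eq_one_iff.1 (by simpa using h)) h1
  · left; simpa using h
  · right
    exact span_pow_eq_top hg (h.trans hdim.symm)

theorem IntDatum.orderOf_g [CharZero k] [IsAlgClosed k] (D : IntDatum k H) {p : ℕ} (hp : p.Prime)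
    (hdim : Module.finrank k H = p ^ 2) (hg : D.g ≠ 1) : orderOf D.g = p := by
  refine (orderOf_cases hp hdim D.g_groupLike hg).resolve_right fun h => D.l_ne (HDual.ext fun x => ?_)
  have hx : x ∈ Submodule.span k (Set.range fun i : ℕ => D.g ^ i) := h ▸ Submodule.mem_top
  induction hx using Submodule.span_induction with
  | mem x hx => obtain ⟨i, rfl⟩ := hx; exact D.l_groupLike hg (D.g_groupLike.pow)
  | zero => simp
  | add x y _ _ hx hy => simp_all
  | smul c x _ hx => simp_all

theorem IntDatum.orderOf_α [CharZero k] [IsAlgClosed k] (D : IntDatum k H) {p : ℕ} (hp : p.Prime)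
    (hdim : Module.finrank k H = p ^ 2) (hα : D.α ≠ 1) : orderOf D.α = p := by
  refine (orderOf_cases hp (HDual.finrank_eq.trans hdim) D.α_groupLike hα).resolve_right fun h =>
    D.L_ne (HDual.eq_of_forall (k := k) fun x => ?_)
  have hx : x ∈ Submodule.span k (Set.range fun i : ℕ => D.α ^ i) := h ▸ Submodule.mem_top
  rw [map_zero]
  induction hx using Submodule.span_induction with
  | mem x hx => obtain ⟨i, rfl⟩ := hx; exact D.groupLike_L hα (D.α_groupLike.pow)
  | zero => simp
  | add x y _ _ hx hy => simp_all
  | smul c x _ hx => simp_all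

end Ssq

section Structure
variable {k H : Type*} [Field k] [CharZero k] [IsAlgClosed k] [Ring H] [HopfAlgebra k H] [FiniteDimensional k H]
variable {p : ℕ} (hp : p.Prime) (hdim : Module.finrank k H = p ^ 2) (D : IntDatum k H) (hg : D.g ≠ 1)
include hp hdim hg

theorem IntDatum.g_pow : D.g ^ p = 1 := by rw [← D.orderOf_g hp hdim hg]; exact pow_orderOf_eq_one _

theorem IntDatum.finrank_jeig {z w : k} (hz : z ^ p = 1) (hw : w ^ (2 * p) = 1) :
    Module.finrank k (jeig (LinearMap.mulLeft k D.g) (Ssq k H) z w) = if w ^ p = 1 then 1 else 0 := by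
  have hgp := D.g_pow hp hdim hg
  have hp0 := hp.pos
  have hT : Ssq k H ^ (2 * p) = 1 := by
    refine Ssq_pow D hgp ?_
    by_cases hα : D.α = 1
    · rw [hα, one_pow]
    · rw [← D.orderOf_α hp hdim hα]; exact pow_orderOf_eq_one _
  have hA : LinearMap.mulLeft k D.g ^ p = 1 := by rw [LinearMap.pow_mulLeft, hgp]; ext; simp
  have hc := commute_mulLeft_Ssq D.g_groupLike
  have hcp : cproj p (LinearMap.mulLeft k D.g) z = LinearMap.mulLeft k (cproj p D.g z) :=
    (cproj_map (Algebra.lmul k H) z).symm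
  obtain ⟨m, hm, hm'⟩ := lagrange D.g_groupLike
  rw [D.orderOf_g hp hdim hg] at hm hm'
  have hmp : m = p := by
    rw [hdim, pow_two] at hm
    exact Nat.eq_of_mul_eq_mul_left hp0 hm
  refine mult_eq hp (n := fun w => Module.finrank k (jeig (LinearMap.mulLeft k D.g) (Ssq k H) z w)) ?_ ?_ ?_ hw
  · have := sum_finrank_jeig hp0 (by omega) hA hT hc hz 0
    simp only [pow_zero, one_mul, mul_one] at this
    rw [hcp, ← regChar_apply, hm' z hz, hmp] at this
    exact_mod_cast this
  · have := sum_finrank_jeig hp0 (by omega) hA hT hc hz 1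
    simp only [pow_one] at this
    rw [this, hcp]
    have h2 := D.trace_mulLeft_antipode_sq (cproj p D.g z)
    have h3 : D.l (cproj p D.g z * D.g) = 0 := by
      rw [cproj, smul_mul_assoc, map_smul, Finset.sum_mul, map_sum, Finset.sum_eq_zero, smul_zero]
      intro i _
      rw [smul_pow, smul_mul_assoc, map_smul, ← pow_succ, D.l_groupLike hg (D.g_groupLike.pow), smul_zero]
    rw [h3, mul_zero] at h2
    exact h2
  · have hne := D.g_groupLike.cproj_ne_zero (orderOf_groupLike_pos D.g_groupLike) z
    rw [D.orderOf_g hp hdim hg] at hne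
    have : Nontrivial (jeig (LinearMap.mulLeft k D.g) (Ssq k H) z 1) := by
      refine ⟨⟨cproj p D.g z, mem_jeig.2 ⟨mul_cproj hp0 hgp hz, ?_⟩⟩, 0, fun h => hne (congrArg Subtype.val h)⟩
      simp only [cproj, smul_pow, map_smul, map_sum, one_smul]
      congr 1
      refine Finset.sum_congr rfl fun i _ => ?_
      rw [Ssq_groupLike (D.g_groupLike.pow)]
    exact Module.finrank_pos

theorem IntDatum.exists_jeig {z w : k} (hz : z ^ p = 1) (hw : w ^ p = 1) :
    ∃ x : H, x ≠ 0 ∧ D.g * x = z • x ∧ Ssq k H x = w • x ∧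
      ∀ y, D.g * y = z • y → Ssq k H y = w • y → ∃ c : k, y = c • x := by
  have h1 := D.finrank_jeig hp hdim hg hz (w := w) (by rw [mul_comm, pow_mul, hw, one_pow])
  rw [if_pos hw, finrank_eq_one_iff'] at h1
  obtain ⟨⟨x, hx⟩, h0, h⟩ := h1
  have hx' := mem_jeig.1 hx
  refine ⟨x, fun h => h0 (Subtype.ext h), hx'.1, hx'.2, fun y hy hy' => ?_⟩
  obtain ⟨c, hc⟩ := h ⟨y, mem_jeig.2 ⟨hy, hy'⟩⟩
  exact ⟨c, (congrArg Subtype.val hc).symm⟩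

end Structure

section ThmA
variable {k H : Type*} [Field k] [CharZero k] [IsAlgClosed k] [Ring H] [HopfAlgebra k H] [FiniteDimensional k H]
variable {p : ℕ} (hp : p.Prime) (hdim : Module.finrank k H = p ^ 2) (D : IntDatum k H)

local notation "S" => antipode k

theorem lam_one (h : H) : lam (1 : HDual k H) h = h := HDual.eq_of_forall (k := k) fun f => by rw [apply_lam, one_mul]

theorem Ssq_cproj {N : ℕ} {g : H} (hg : IsGroupLikeElem k g) (z : k) :
    Ssq k H (cproj N g z) = cproj N g z := by
  simp only [cproj, smul_pow, map_smul, map_sum]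
  congr 1
  refine Finset.sum_congr rfl fun i _ => ?_
  rw [Ssq_groupLike (hg.pow)]

theorem exists_root_ne_one {p : ℕ} (hp : p.Prime) : ∃ w : k, w ^ p = 1 ∧ w ≠ 1 := by
  obtain ⟨w, hw⟩ := exists_prim k hp.pos
  exact ⟨w, hw.pow_eq_one, fun h => hp.one_lt.ne' (hw.unique (h ▸ IsPrimitiveRoot.one))⟩

variable (k H) in
/-- The canonical map to the bidual. -/
noncomputable def bid : H →ₗ[k] HDual k (HDual k H) where
  toFun h := HDual.of (HDual.ev k h)
  map_add' a b := by ext f; simp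
  map_smul' c a := by ext f; simp

@[simp] theorem bid_apply (h : H) (f : HDual k H) : bid k H h f = f h := rfl

theorem bid_mul (a b : H) : bid k H a * bid k H b = bid k H (a * b) := by
  ext f
  rw [HDual.mul_apply, bid_apply]
  exact HDual.sw_apply f a b

theorem bid_injective : Function.Injective (bid k H) := fun _ _ h =>
  HDual.eq_of_forall (k := k) fun f => congrArg (fun F : HDual k (HDual k H) => F f) h

theorem bid_surjective : Function.Surjective (bid k H) := by
  have h : Module.finrank k (HDual k (HDual k H)) = Module.finrank k H := by rw [HDual.finrank_eq, HDual.finrank_eq]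
  exact (LinearMap.injective_iff_surjective_of_finrank_eq_finrank h.symm).1 bid_injective

include hp hdim

theorem IntDatum.α_ne_one (hg : D.g ≠ 1) : D.α ≠ 1 := by
  intro hα
  have hgp := D.g_pow hp hdim hg
  have hL : Ssq k H D.L = D.L := by
    have := D.L_eq
    rw [hα, lam_one] at this
    rw [Ssq_apply, this, this]
  obtain ⟨x, -, hgx, hTx, hx⟩ := D.exists_jeig hp hdim hg (one_pow p) (one_pow p)
  obtain ⟨c, hc⟩ := hx D.L (by rw [D.mul_L, D.g_groupLike.counit_eq_one]) (by rw [hL, one_smul])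
  obtain ⟨e, he⟩ := hx (cproj p D.g 1) (mul_cproj hp.pos hgp (one_pow p))
    (by rw [Ssq_cproj D.g_groupLike, one_smul])
  have hc0 : c ≠ 0 := fun h => D.L_ne (by rw [hc, h, zero_smul])
  obtain ⟨w, hw, hw1⟩ := exists_root_ne_one (k := k) hp
  obtain ⟨y, hy0, hgy, hTy, -⟩ := D.exists_jeig hp hdim hg (one_pow p) hw
  have h1 := cproj_mul_eigen hp.pos (one_pow p) (one_pow p) hgy
  rw [if_pos rfl, he] at h1
  have h2 : x = c⁻¹ • D.L := by rw [hc, smul_smul, inv_mul_cancel₀ hc0, one_smul]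
  rw [h2, smul_mul_assoc, smul_mul_assoc, D.L_mul] at h1
  rw [← h1] at hTy hy0
  simp only [map_smul, hL] at hTy
  have h3 : (1 - w) • (e • c⁻¹ • D.α y • D.L) = 0 := by rw [sub_smul, one_smul, ← hTy, sub_self]
  rcases smul_eq_zero.1 h3 with h | h
  · exact hw1 (sub_eq_zero.1 h).symm
  · exact hy0 h

theorem IntDatum.g_ne_one (hα : D.α ≠ 1) : D.g ≠ 1 := by
  intro hg
  obtain ⟨DK⟩ := IntDatum.nonempty (k := k) (H := HDual k H)
  have hl : ∀ f : HDual k H, f * D.l = counit (R := k) f • D.l := fun f => by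
    rw [D.mul_l, hg, HDual.counit_apply]
  have h1 := DK.L_unique D.l hl
  have h0 : DK.l D.l ≠ 0 := fun h => D.l_ne (by rw [h1, h, zero_smul])
  have hαK : DK.α = 1 := by
    ext f
    have h2 := DK.L_mul f
    have h3 := D.l_mul f
    rw [h1, smul_mul_assoc, h2, smul_comm] at h3
    have h4 := sub_eq_zero.2 h3
    rw [← sub_smul] at h4
    rw [HDual.one_apply, HDual.counit_apply]
    refine sub_eq_zero.1 ((smul_eq_zero.1 h4).resolve_right ?_)
    rw [← h1]; exact D.l_ne
  have hgK : DK.g = 1 := by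
    by_contra h
    exact DK.α_ne_one hp (HDual.finrank_eq.trans hdim) h hαK
  obtain ⟨h0, hh0⟩ := bid_surjective DK.l
  have hm : ∀ h, h * h0 = counit (R := k) h • h0 := fun h => bid_injective (k := k) <| by
    rw [← bid_mul, hh0, DK.mul_l, hgK, bid_apply, HDual.one_apply, map_smul, hh0]
  have hm' : ∀ h, h0 * h = counit (R := k) h • h0 := fun h => bid_injective (k := k) <| by
    rw [← bid_mul, hh0, DK.l_mul, bid_apply, HDual.one_apply, map_smul, hh0]
  have h2 := D.L_unique h0 hm
  have hne : h0 ≠ 0 := by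
    rintro rfl
    exact DK.l_ne (by rw [← hh0, map_zero])
  refine hα (HDual.ext fun x => ?_)
  have h3 := hm' x
  rw [h2, smul_mul_assoc, D.L_mul, smul_comm] at h3
  have h4 := sub_eq_zero.2 h3
  rw [← sub_smul] at h4
  rw [HDual.one_apply]
  refine sub_eq_zero.1 ((smul_eq_zero.1 h4).resolve_right ?_)
  rw [← h2]; exact hne

end ThmA

section Taft
variable {k H : Type*} [Field k] [CharZero k] [IsAlgClosed k] [Ring H] [HopfAlgebra k H] [FiniteDimensional k H]
variable {p : ℕ} (hp : p.Prime) (hdim : Module.finrank k H = p ^ 2) (D : IntDatum k H)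

local notation "S" => antipode k

/-- A group-like element of the dual acts by algebra endomorphisms. -/
noncomputable def rhoAlg {χ : HDual k H} (hχ : IsGroupLikeElem k χ) : H →ₐ[k] H :=
  AlgHom.ofLinearMap (rho χ) (by rw [rho_one_right, HDual.one_of_isGroupLikeElem hχ, one_smul])
    (rho_mul_of_groupLike hχ)

theorem rhoAlg_apply {χ : HDual k H} (hχ : IsGroupLikeElem k χ) (h : H) : rhoAlg hχ h = rho χ h := rfl

theorem HDual.groupLike_of_Ssq {χ : HDual k H} (hχ : IsGroupLikeElem k χ) {x : H} {w : k} (hx : Ssq k H x = w • x)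
    (hw : w ≠ 1) : χ x = 0 := by
  have h := HDual.Ssq_apply_apply χ x
  rw [Ssq_groupLike hχ, hx, map_smul, smul_eq_mul] at h
  have h2 : (1 - w) * χ x = 0 := by rw [sub_mul, one_mul, ← h, sub_self]
  exact (mul_eq_zero.1 h2).resolve_left fun h => hw (sub_eq_zero.1 h).symm

theorem Ssq_groupLike_mul {g : H} (hg : IsGroupLikeElem k g) {x : H} {w : k} (hx : Ssq k H x = w • x) :
    Ssq k H (g * x) = w • (g * x) := by
  rw [Ssq_mul, Ssq_groupLike hg, hx, mul_smul_comm]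

include hp hdim

theorem IntDatum.Ssq_pow_two_mul (hg : D.g ≠ 1) : Ssq k H ^ (2 * p) = 1 := by
  refine Ssq_pow D (D.g_pow hp hdim hg) ?_
  rw [← D.orderOf_α hp hdim (D.α_ne_one hp hdim hg)]; exact pow_orderOf_eq_one _

theorem IntDatum.sum_jeig (x : H) : ∑ z ∈ rou k p, cproj p D.g z * x = x := by
  rw [← Finset.sum_mul, sum_cproj hp.pos, one_mul]

theorem IntDatum.g_mul_cproj_mul (hg : D.g ≠ 1) {z : k} (hz : z ^ p = 1) (x : H) :
    D.g * (cproj p D.g z * x) = z • (cproj p D.g z * x) := by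
  rw [← mul_assoc, mul_cproj hp.pos (D.g_pow hp hdim hg) hz, smul_mul_assoc]

theorem IntDatum.Ssq_cproj_mul {z w : k} {x : H} (hx : Ssq k H x = w • x) :
    Ssq k H (cproj p D.g z * x) = w • (cproj p D.g z * x) := by
  rw [Ssq_mul, Ssq_cproj D.g_groupLike, hx, mul_smul_comm]

theorem IntDatum.Ssq_pow_p (hg : D.g ≠ 1) : Ssq k H ^ p = 1 := by
  have hp0 := hp.pos
  have hT := D.Ssq_pow_two_mul hp hdim hg
  rw [pow_eq_sum_cproj (k := k) (N := 2 * p) (by omega) hT, ← sum_cproj (k := k) (N := 2 * p) (by omega) (Ssq k H)]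
  refine Finset.sum_congr rfl fun w hw => ?_
  rw [mem_rou (by omega)] at hw
  by_cases hwp : w ^ p = 1
  · rw [hwp, one_smul]
  suffices h : cproj (2 * p) (Ssq k H) w = 0 by rw [h, smul_zero]
  ext x
  have h1 : Ssq k H (cproj (2 * p) (Ssq k H) w x) = w • (cproj (2 * p) (Ssq k H) w x) :=
    congrArg (fun f => f x) (mul_cproj (k := k) (N := 2 * p) (by omega) hT hw)
  rw [← D.sum_jeig hp hdim (cproj (2 * p) (Ssq k H) w x)]
  refine Finset.sum_eq_zero fun z hz => ?_
  rw [mem_rou hp0] at hz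
  have h2 := D.finrank_jeig hp hdim hg hz hw
  rw [if_neg hwp, Submodule.finrank_eq_zero] at h2
  have h3 : cproj p D.g z * cproj (2 * p) (Ssq k H) w x ∈ jeig (LinearMap.mulLeft k D.g) (Ssq k H) z w :=
    mem_jeig.2 ⟨D.g_mul_cproj_mul hp hdim hg hz _, D.Ssq_cproj_mul hp hdim h1⟩
  rwa [h2] at h3

theorem IntDatum.mem_span_of_Ssq (hg : D.g ≠ 1) {x : H} (hx : Ssq k H x = x) :
    x ∈ Submodule.span k (Set.range fun i : ℕ => D.g ^ i) := by
  have hp0 := hp.pos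
  rw [← D.sum_jeig hp hdim x]
  refine Submodule.sum_mem _ fun z hz => ?_
  rw [mem_rou hp0] at hz
  have hE : cproj p D.g z ∈ Submodule.span k (Set.range fun i : ℕ => D.g ^ i) := by
    unfold cproj
    refine Submodule.smul_mem _ _ (Submodule.sum_mem _ fun i _ => ?_)
    rw [smul_pow]
    exact Submodule.smul_mem _ _ (Submodule.subset_span ⟨i, rfl⟩)
  have hne := D.g_groupLike.cproj_ne_zero (orderOf_groupLike_pos D.g_groupLike) z
  rw [D.orderOf_g hp hdim hg] at hne
  obtain ⟨y, hy0, -, -, hy⟩ := D.exists_jeig hp hdim hg hz (one_pow p)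
  obtain ⟨c, hc⟩ := hy (cproj p D.g z) (mul_cproj hp.pos (D.g_pow hp hdim hg) hz)
    (by rw [Ssq_cproj D.g_groupLike, one_smul])
  obtain ⟨d, hd⟩ := hy (cproj p D.g z * x) (D.g_mul_cproj_mul hp hdim hg hz x)
    (D.Ssq_cproj_mul hp hdim (by rw [hx, one_smul]))
  have hc0 : c ≠ 0 := fun h => hne (by rw [hc, h, zero_smul])
  rw [hd, show y = c⁻¹ • cproj p D.g z by rw [hc, smul_smul, inv_mul_cancel₀ hc0, one_smul]]
  exact Submodule.smul_mem _ _ (Submodule.smul_mem _ _ hE)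

theorem IntDatum.Ssq_rho_of_Ssq (hg : D.g ≠ 1) {x : H} (hx : Ssq k H x = x) (f : HDual k H) :
    Ssq k H (rho f x) = rho f x := by
  have h := D.mem_span_of_Ssq hp hdim hg hx
  clear hx
  induction h using Submodule.span_induction with
  | mem x hx =>
    obtain ⟨i, rfl⟩ := hx
    simp only
    rw [(D.g_groupLike.pow).rho_eq, map_smul, Ssq_groupLike D.g_groupLike.pow]
  | zero => simp
  | add x y _ _ hx hy => rw [map_add, map_add, hx, hy]
  | smul c x _ hx => rw [map_smul, map_smul, hx]

theorem Ssq_induction (hT : Ssq k H ^ p = 1) {P : H → Prop} (hadd : ∀ x y, P x → P y → P (x + y)) (h0 : P 0)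
    (h : ∀ (w : k) (x : H), w ^ p = 1 → Ssq k H x = w • x → P x) (x : H) : P x := by
  have h1 := congrArg (fun f => f x) (sum_cproj (k := k) hp.pos (Ssq k H))
  simp only [LinearMap.sum_apply, Module.End.one_apply] at h1
  rw [← h1]
  refine Finset.sum_induction _ P hadd h0 fun w hw => h w _ ((mem_rou hp.pos).1 hw) ?_
  exact congrArg (fun f => f x) (mul_cproj (k := k) hp.pos hT ((mem_rou hp.pos).1 hw))

theorem IntDatum.α_g_ne_one (hg : D.g ≠ 1) : D.α D.g ≠ 1 := by
  intro h
  refine D.α_ne_one hp hdim hg (HDual.ext fun x => ?_)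
  refine Ssq_induction hp hdim (D.Ssq_pow_p hp hdim hg) (P := fun x => D.α x = (1 : HDual k H) x) (fun x y hx hy => ?_) ?_
    (fun w x hw hx => ?_) x
  · rw [map_add, hx, hy, map_add]
  · rw [map_zero, map_zero]
  · by_cases hw1 : w = 1
    · rw [hw1, one_smul] at hx
      have h3 := D.mem_span_of_Ssq hp hdim hg hx
      clear hx
      induction h3 using Submodule.span_induction with
      | mem x hx =>
        obtain ⟨i, rfl⟩ := hx
        simp only
        have : ∀ i, D.α (D.g ^ i) = 1 := fun i => by
          induction i with
          | zero => rw [pow_zero, D.α_one]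
          | succ i ih => rw [pow_succ, D.α_mul, ih, h, one_mul]
        rw [this, HDual.one_apply, D.g_groupLike.pow.counit_eq_one]
      | zero => simp
      | add x y _ _ hx hy => rw [map_add, hx, hy, map_add]
      | smul c x _ hx => rw [map_smul, hx, map_smul]
    · rw [HDual.groupLike_of_Ssq D.α_groupLike hx hw1, HDual.groupLike_of_Ssq IsGroupLikeElem.one hx hw1]

theorem isPrimitiveRoot_of_prime {w : k} (hw : w ^ p = 1) (h1 : w ≠ 1) : IsPrimitiveRoot w p := by
  have := Fact.mk hp
  rw [← orderOf_eq_prime hw h1]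
  exact IsPrimitiveRoot.orderOf w

theorem IntDatum.α_g_prim (hg : D.g ≠ 1) : IsPrimitiveRoot (D.α D.g) p := by
  refine isPrimitiveRoot_of_prime hp hdim ?_ (D.α_g_ne_one hp hdim hg)
  have : ∀ i, D.α (D.g ^ i) = D.α D.g ^ i := fun i => by
    induction i with
    | zero => rw [pow_zero, D.α_one, pow_zero]
    | succ i ih => rw [pow_succ, D.α_mul, ih, pow_succ]
  rw [← this, D.g_pow hp hdim hg, D.α_one]

theorem IntDatum.eq_zero_of_cproj (hg : D.g ≠ 1) {y : H} (hy : rho D.α y = y) (h : cproj p D.g (1 : k) * y = 0) : y = 0 := by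
  have hq := D.α_g_prim hp hdim hg
  have key : ∀ i : ℕ, cproj p D.g (((D.α D.g)⁻¹) ^ i) * y = 0 := fun i => by
    induction i with
    | zero => rw [pow_zero, h]
    | succ i ih =>
      have := congrArg (rhoAlg D.α_groupLike) ih
      rw [map_mul, cproj_map, rhoAlg_apply, rhoAlg_apply, hy, D.g_groupLike.rho_eq, map_zero] at this
      rw [← this]
      simp only [cproj, pow_succ, mul_inv, inv_inv, smul_smul]
  rw [← D.sum_jeig hp hdim y]
  refine Finset.sum_eq_zero fun z hz => ?_
  have : NeZero p := ⟨hp.ne_zero⟩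
  obtain ⟨i, -, hi⟩ := hq.inv.eq_pow_of_pow_eq_one ((mem_rou hp.pos).1 hz)
  rw [← hi, key]

theorem IntDatum.exists_R (hg : D.g ≠ 1) {w : k} (hw : w ^ p = 1) : ∃ y : H, y ≠ 0 ∧ rho D.α y = y ∧ Ssq k H y = w • y ∧
    ∀ y', rho D.α y' = y' → Ssq k H y' = w • y' → ∃ c : k, y' = c • y := by
  have : NeZero p := ⟨hp.ne_zero⟩
  have hq := D.α_g_prim hp hdim hg
  have hαp : rho D.α ^ p = 1 := by
    rw [← map_pow, ← D.orderOf_α hp hdim (D.α_ne_one hp hdim hg), pow_orderOf_eq_one, map_one]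
  obtain ⟨x, hx0, hgx, hTx, hx⟩ := D.exists_jeig hp hdim hg (one_pow p) hw
  have hsum := congrArg (fun f => f x) (sum_cproj (k := k) hp.pos (rho D.α))
  simp only [LinearMap.sum_apply, Module.End.one_apply] at hsum
  obtain ⟨z, hz, hz0⟩ := Finset.exists_ne_zero_of_sum_ne_zero (hsum.symm ▸ hx0)
  rw [mem_rou hp.pos] at hz
  obtain ⟨j, -, hj⟩ := hq.eq_pow_of_pow_eq_one (ξ := z⁻¹) (by rw [inv_pow, hz, inv_one])
  set y := cproj p (rho D.α) z x with hy
  have hy1 : rho D.α y = z • y := congrArg (fun f => f x) (mul_cproj (k := k) hp.pos hαp hz)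
  have hy2 : Ssq k H y = w • y := by
    have := congrArg (fun f => f x) (cproj_commute (N := p) (commute_rho_Ssq D.α_groupLike) z).eq
    simp only [Module.End.mul_apply] at this
    rw [hy, ← this, hTx, map_smul]
  have hz' := rootOfUnity_ne_zero hp.pos hz
  have hr : rho D.α (D.g ^ j * y) = D.g ^ j * y := by
    rw [← rhoAlg_apply D.α_groupLike, map_mul, map_pow, rhoAlg_apply, rhoAlg_apply, hy1, D.g_groupLike.rho_eq, smul_pow, hj,
      smul_mul_smul_comm, inv_mul_cancel₀ hz', one_smul]
  have hne : D.g ^ j * y ≠ 0 := fun h => hz0 <| by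
    have h2 := congrArg (fun t => S (D.g ^ j) * t) h
    simp only [← mul_assoc] at h2
    rwa [D.g_groupLike.pow.antipode_mul_cancel, one_mul, mul_zero] at h2
  have hT := Ssq_groupLike_mul (D.g_groupLike.pow (n := j)) hy2
  refine ⟨D.g ^ j * y, hne, hr, hT, fun y' h1 h2 => ?_⟩
  generalize D.g ^ j * y = t at *
  obtain ⟨c, hc⟩ := hx (cproj p D.g 1 * t) (D.g_mul_cproj_mul hp hdim hg (one_pow p) t) (D.Ssq_cproj_mul hp hdim hT)
  obtain ⟨d, hd⟩ := hx (cproj p D.g 1 * y') (D.g_mul_cproj_mul hp hdim hg (one_pow p) y') (D.Ssq_cproj_mul hp hdim h2)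
  have hc0 : c ≠ 0 := fun h => hne (D.eq_zero_of_cproj hp hdim hg hr (by rw [hc, h, zero_smul]))
  refine ⟨d * c⁻¹, sub_eq_zero.1 (D.eq_zero_of_cproj hp hdim hg ?_ ?_)⟩
  · rw [map_sub, map_smul, h1, hr]
  · rw [mul_sub, mul_smul_comm, hc, hd, smul_smul, mul_assoc, inv_mul_cancel₀ hc0, mul_one, sub_self]

end Taft

section Taft
variable {k H : Type*} [Field k] [CharZero k] [IsAlgClosed k] [Ring H] [HopfAlgebra k H] [FiniteDimensional k H]
variable {p : ℕ} (hp : p.Prime) (hdim : Module.finrank k H = p ^ 2) (D : IntDatum k H)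

local notation "S" => antipode k

theorem HDual.apply_eq_zero_of_Ssq {f : HDual k H} {w v : k} (hf : Ssq k _ f = w • f) {x : H} (hx : Ssq k H x = v • x)
    (h : v ≠ w) : f x = 0 := by
  have h1 := HDual.Ssq_apply_apply f x
  rw [hf, hx, map_smul, HDual.smul_apply, smul_eq_mul] at h1
  have h2 : (w - v) * f x = 0 := by rw [sub_mul, h1, sub_self]
  exact (mul_eq_zero.1 h2).resolve_left fun h' => h (sub_eq_zero.1 h').symm

theorem exists_apply_eq_one {x : H} (hx : x ≠ 0) : ∃ f : HDual k H, f x = 1 := by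
  by_contra! h
  refine hx (HDual.eq_of_forall (k := k) fun f => ?_)
  rw [map_zero]
  by_contra h0
  refine h ((f x)⁻¹ • f) ?_
  rw [HDual.smul_apply, inv_mul_cancel₀ h0]

theorem Ssq_rho_of_eigen {f : HDual k H} {w v : k} (hv0 : v ≠ 0) (hf : Ssq k _ f = v • f) {x : H} (hx : Ssq k H x = w • x) :
    Ssq k H (rho f x) = (w * v⁻¹) • rho f x := by
  have h := rho_Ssq f x
  rw [hf, hx, map_smul, map_smul, LinearMap.smul_apply, map_smul] at h
  rw [mul_comm, mul_smul, h, smul_smul, inv_mul_cancel₀ hv0, one_smul]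

include hp hdim

theorem IntDatum.exists_frame (hg : D.g ≠ 1) : ∃ (x : k → H) (φ : k → HDual k H), ∀ w, w ^ p = 1 →
    x w ≠ 0 ∧ rho D.α (x w) = x w ∧ Ssq k H (x w) = w • x w ∧
    (∀ y, rho D.α y = y → Ssq k H y = w • y → ∃ c : k, y = c • x w) ∧ Ssq k _ (φ w) = w • φ w ∧ φ w (x w) = 1 := by
  have hT := D.Ssq_pow_p hp hdim hg
  choose! x hx using fun w (hw : w ^ p = 1) => D.exists_R hp hdim hg hw
  choose! θ hθ using fun w (hw : w ^ p = 1) => exists_apply_eq_one (k := k) (hx w hw).1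
  refine ⟨x, fun w => HDual.of (HDual.of.symm (θ w) ∘ₗ cproj p (Ssq k H) w), fun w hw =>
    ⟨(hx w hw).1, (hx w hw).2.1, (hx w hw).2.2.1, (hx w hw).2.2.2, ?_, ?_⟩⟩
  · ext y
    have h1 := (cproj_commute (N := p) (Commute.refl (Ssq k H)) w).eq
    rw [mul_cproj hp.pos hT hw] at h1
    have h2 := congrArg (fun f => f y) h1
    simp only [Module.End.mul_apply, LinearMap.smul_apply] at h2
    rw [HDual.Ssq_apply_apply, HDual.smul_apply]
    simp only [HDual.of_apply, LinearMap.comp_apply, HDual.of_symm_apply]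
    rw [h2, map_smul, smul_eq_mul]
  · simp only [HDual.of_apply, LinearMap.comp_apply, HDual.of_symm_apply]
    rw [cproj_eigen hp.pos hw hw (hx w hw).2.2.1, if_pos rfl, hθ w hw]

theorem IntDatum.eq_zero_on_R (hg : D.g ≠ 1) {x : k → H}
    (hx : ∀ w, w ^ p = 1 → ∀ y, rho D.α y = y → Ssq k H y = w • y → ∃ c : k, y = c • x w)
    {ψ : HDual k H} (hψ : ∀ w, w ^ p = 1 → ψ (x w) = 0) {y : H} (hy : rho D.α y = y) : ψ y = 0 := by
  have hT := D.Ssq_pow_p hp hdim hg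
  have h1 := congrArg (fun f => f y) (sum_cproj (k := k) hp.pos (Ssq k H))
  simp only [LinearMap.sum_apply, Module.End.one_apply] at h1
  rw [← h1, map_sum]
  refine Finset.sum_eq_zero fun w hw => ?_
  rw [mem_rou hp.pos] at hw
  have h2 := congrArg (fun f => f y) (cproj_commute (N := p) (commute_rho_Ssq D.α_groupLike).symm w).eq
  simp only [Module.End.mul_apply] at h2
  obtain ⟨c, hc⟩ := hx w hw (cproj p (Ssq k H) w y) (by rw [← h2, hy])
    (congrArg (fun f => f y) (mul_cproj (k := k) hp.pos hT hw))
  rw [hc, map_smul, hψ w hw, smul_zero]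

theorem IntDatum.rho_eq_zero_on_R (hg : D.g ≠ 1) {x : k → H}
    (hx : ∀ w, w ^ p = 1 → ∀ y, rho D.α y = y → Ssq k H y = w • y → ∃ c : k, y = c • x w)
    {ψ : HDual k H} (hψ : ∀ w, w ^ p = 1 → ψ (x w) = 0) {y : H} (hy : rho D.α y = y) : rho ψ y = 0 :=
  HDual.eq_of_forall (k := k) fun f => by
    rw [apply_rho, ← apply_lam, map_zero]
    exact D.eq_zero_on_R hp hdim hg hx hψ (by rw [rho_lam_comm, hy])

/-- A nontrivial skew-primitive element, with the functional dual to it. -/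
theorem IntDatum.exists_skewPrimitive (hg : D.g ≠ 1) : ∃ (w : k) (x u : H) (φ : HDual k H),
    w ^ p = 1 ∧ w ≠ 1 ∧ x ≠ 0 ∧ rho D.α x = x ∧ Ssq k H x = w • x ∧ IsGroupLikeElem k u ∧ Ssq k _ φ = w • φ ∧ φ x = 1 ∧
    ∀ f : HDual k H, rho f x = f 1 • x + f x • u := by
  have hp0 := hp.pos
  have hT := D.Ssq_pow_p hp hdim hg
  obtain ⟨x, φ, hxφ⟩ := D.exists_frame hp hdim hg
  have hx0 := fun w hw => (hxφ w hw).1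
  have hxR := fun w hw => (hxφ w hw).2.1
  have hxT := fun w hw => (hxφ w hw).2.2.1
  have hxu := fun w hw => (hxφ w hw).2.2.2.1
  have hφT := fun w hw => (hxφ w hw).2.2.2.2.1
  have hφx := fun w hw => (hxφ w hw).2.2.2.2.2
  have hφ : ∀ v w, v ^ p = 1 → w ^ p = 1 → φ v (x w) = if v = w then 1 else 0 := fun v w hv hw => by
    split_ifs with h
    · rw [h, hφx w hw]
    · exact HDual.apply_eq_zero_of_Ssq (hφT v hv) (hxT w hw) (Ne.symm h)
  set h : k → k → H := fun w v => rho (φ v) (x w) with hh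
  have hexp : ∀ (f : HDual k H) (y : H), rho D.α y = y → rho f y = ∑ v ∈ rou k p, f (x v) • rho (φ v) y := fun f y hy => by
    have := D.rho_eq_zero_on_R hp hdim hg hxu (ψ := f - ∑ v ∈ rou k p, f (x v) • φ v) (fun w hw => ?_) hy
    · rw [map_sub, LinearMap.sub_apply, sub_eq_zero] at this
      rw [this, map_sum, LinearMap.sum_apply]
      refine Finset.sum_congr rfl fun v _ => ?_
      rw [map_smul, LinearMap.smul_apply]
    · rw [HDual.sub_apply, HDual.sum_apply, Finset.sum_eq_single_of_mem w ((mem_rou hp0).2 hw), HDual.smul_apply, hφx w hw,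
        mul_one, sub_self]
      intro v hv hvw
      rw [HDual.smul_apply, hφ v w ((mem_rou hp0).1 hv) hw, if_neg hvw, mul_zero]
  have hhT : ∀ w v, w ^ p = 1 → v ^ p = 1 → Ssq k H (h w v) = (w * v⁻¹) • h w v := fun w v hw hv =>
    Ssq_rho_of_eigen (rootOfUnity_ne_zero hp0 hv) (hφT v hv) (hxT w hw)
  have hrh : ∀ (f : HDual k H) (w j : k), w ^ p = 1 → rho f (h w j) = ∑ v ∈ rou k p, f (h v j) • h w v := fun f w j hw => by
    have h1 : rho f (h w j) = rho (f * φ j) (x w) := by rw [map_mul]; rfl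
    rw [h1, hexp (f * φ j) (x w) (hxR w hw)]
    refine Finset.sum_congr rfl fun v _ => ?_
    rw [← apply_rho]
  have hcomp : ∀ (f : HDual k H) (w j l : k), w ^ p = 1 → l ^ p = 1 →
      cproj p (Ssq k H) (w * l⁻¹) (rho f (h w j)) = f (h l j) • h w l := fun f w j l hw hl => by
    rw [hrh f w j hw, map_sum, Finset.sum_eq_single_of_mem l ((mem_rou hp0).2 hl)]
    · rw [map_smul, cproj_eigen hp0 (by rw [mul_pow, inv_pow, hw, hl]; simp) (by rw [mul_pow, inv_pow, hw, hl]; simp)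
        (hhT w l hw hl), if_pos rfl]
    · intro v hv hvl
      rw [mem_rou hp0] at hv
      rw [map_smul, cproj_eigen hp0 (by rw [mul_pow, inv_pow, hw, hl]; simp) (by rw [mul_pow, inv_pow, hw, hv]; simp)
        (hhT w v hw hv), if_neg, smul_zero]
      intro h
      exact hvl (inv_injective (mul_left_cancel₀ (rootOfUnity_ne_zero hp0 hw) h))
  have htrans : ∀ w l j : k, w ^ p = 1 → l ^ p = 1 → h w l ≠ 0 → h l j ≠ 0 → h w j ≠ 0 := by
    intro w l j hw hl h1 h2 h3
    obtain ⟨f, hf⟩ := exists_apply_eq_one (k := k) h2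
    have := hcomp f w j l hw hl
    rw [h3, map_zero, map_zero, hf, one_smul] at this
    exact h1 this.symm
  have hirr : ∀ w l : k, w ^ p = 1 → l ^ p = 1 → w ≠ l → h w l ≠ 0 → h l w = 0 := by
    intro w l hw hl hne h1
    refine HDual.eq_of_forall (k := k) fun f => ?_
    rw [map_zero]
    have h2 := hcomp f w w l hw hl
    have hw0 := rootOfUnity_ne_zero hp0 hw
    have h3 : Ssq k H (h w w) = h w w := by rw [hhT w w hw hw, mul_inv_cancel₀ hw0, one_smul]
    have h4 := D.Ssq_rho_of_Ssq hp hdim hg h3 f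
    rw [cproj_eigen hp0 (by rw [mul_pow, inv_pow, hw, hl]; simp) (one_pow p) (by rw [h4, one_smul]), if_neg] at h2
    · exact (smul_eq_zero.1 h2.symm).resolve_right h1
    · intro h
      exact hne (by rw [eq_comm, mul_inv_eq_one₀ (rootOfUnity_ne_zero hp0 hl)] at h; exact h)
  -- a minimal nontrivial degree
  obtain ⟨w, hw, hw1, hmin⟩ : ∃ w : k, w ^ p = 1 ∧ w ≠ 1 ∧ ∀ v, v ^ p = 1 → v ≠ 1 → v ≠ w → h w v = 0 := by
    let X := {w : k // w ∈ rou k p ∧ w ≠ 1}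
    have : Finite X := (Set.Finite.subset (rou k p).finite_toSet (fun w (hw : w ∈ rou k p ∧ w ≠ 1) => hw.1)).to_subtype
    let r : X → X → Prop := fun v w => v ≠ w ∧ h w v ≠ 0
    have : IsTrans X r := ⟨fun a b c hab hbc => by
      have ha := (mem_rou hp0).1 a.2.1
      have hb := (mem_rou hp0).1 b.2.1
      have hc := (mem_rou hp0).1 c.2.1
      refine ⟨?_, htrans c b a hc hb hbc.2 hab.2⟩
      rintro rfl
      exact hab.2 (hirr a b ha hb (fun h => hab.1 (Subtype.ext h)) hbc.2)⟩
    have : Std.Irrefl r := ⟨fun a h => h.1 rfl⟩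
    have wf := Finite.wellFounded_of_trans_of_irrefl r
    obtain ⟨w0, hw0, hw01⟩ := exists_root_ne_one (k := k) hp
    obtain ⟨w, -, hw⟩ := wf.has_min Set.univ ⟨⟨w0, (mem_rou hp0).2 hw0, hw01⟩, Set.mem_univ _⟩
    refine ⟨w, (mem_rou hp0).1 w.2.1, w.2.2, fun v hv hv1 hvw => ?_⟩
    by_contra hne
    exact hw ⟨v, (mem_rou hp0).2 hv, hv1⟩ (Set.mem_univ _) ⟨fun h => hvw (congrArg Subtype.val h), hne⟩
  have h11 : (1 : k) ^ p = 1 := one_pow p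
  obtain ⟨c, hc⟩ := hxu 1 h11 1 (by rw [rho_one_right, D.α_one, one_smul]) (by rw [Ssq_one, one_smul])
  have := nontrivial_of_hopf k H
  have hc0 : c ≠ 0 := fun h => one_ne_zero (α := H) (by rw [hc, h, zero_smul])
  have hx1 : x 1 = c⁻¹ • 1 := by rw [hc, smul_smul, inv_mul_cancel₀ hc0, one_smul]
  have hsum : ∀ F : k → H, (∀ v, v ^ p = 1 → v ≠ 1 → v ≠ w → F v = 0) → ∑ v ∈ rou k p, F v = F 1 + F w := fun F hF => by
    rw [← Finset.sum_subset (s₁ := {1, w}), Finset.sum_pair (Ne.symm hw1)]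
    · intro v hv
      rw [Finset.mem_insert, Finset.mem_singleton] at hv
      rcases hv with rfl | rfl
      · exact (mem_rou hp0).2 h11
      · exact (mem_rou hp0).2 hw
    · intro v hv hv'
      rw [Finset.mem_insert, Finset.mem_singleton, not_or] at hv'
      exact hF v ((mem_rou hp0).1 hv) hv'.1 hv'.2
  have hr1 : ∀ f : HDual k H, rho f (x w) = f (x 1) • h w 1 + f (x w) • h w w := fun f => by
    rw [hexp f _ (hxR w hw)]
    exact hsum (fun v => f (x v) • h w v) fun v a b c => by rw [hmin v a b c, smul_zero]
  have hxw1 : c⁻¹ • h w 1 = x w := by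
    have h1 := hr1 1
    rw [map_one, Module.End.one_apply, HDual.groupLike_of_Ssq IsGroupLikeElem.one (hxT w hw) hw1, zero_smul, add_zero, hx1,
      map_smul, HDual.one_apply, Bialgebra.counit_one, smul_eq_mul, mul_one] at h1
    exact h1.symm
  refine ⟨w, x w, h w w, φ w, hw, hw1, hx0 w hw, hxR w hw, hxT w hw, ?_, hφT w hw, hφx w hw, fun f => ?_⟩
  · refine isGroupLikeElem_of_rho (k := k) (fun h0 => ?_) fun f => ?_
    · have := counit_rho (φ w) (x w)
      rw [hφx w hw] at this
      change counit (R := k) (h w w) = 1 at this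
      rw [h0, map_zero] at this
      exact zero_ne_one this
    · rw [hrh f w w hw, hsum (fun v => f (h v w) • h w v) fun v a b c => by rw [hmin v a b c, smul_zero]]
      have : h 1 w = 0 := by
        simp only [hh]
        rw [hx1, map_smul, rho_one_right, HDual.apply_eq_zero_of_Ssq (hφT w hw) (v := 1) (by rw [Ssq_one, one_smul])
          (Ne.symm hw1), zero_smul, smul_zero]
      rw [this, map_zero, zero_smul, zero_add]
  · rw [hr1, ← hxw1, hx1, map_smul, smul_assoc, smul_smul, smul_smul, mul_comm]

end Taft

section Taft
variable {k H : Type*} [Field k] [CharZero k] [IsAlgClosed k] [Ring H] [HopfAlgebra k H] [FiniteDimensional k H]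
variable {p : ℕ} (hp : p.Prime) (hdim : Module.finrank k H = p ^ 2) (D : IntDatum k H)

local notation "S" => antipode k

theorem sw_of_comul_add {M : Type*} [AddCommGroup M] [Module k M] {a u v u' v' : H}
    (h : comul (R := k) a = u ⊗ₜ[k] v + u' ⊗ₜ[k] v') (F : H → H → M)
    (h1 : ∀ y, IsLinearMap k (fun x => F x y) := by intros; fun_prop)
    (h2 : ∀ x, IsLinearMap k (fun y => F x y) := by intros; fun_prop) :
    sw k a F = F u v + F u' v' := by
  rw [sw_eq_of_comul (k := k) Finset.univ (fun b : Bool => if b then u else u') (fun b => if b then v else v') a (by simp [h]) F h1 h2]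
  simp

theorem comul_of_rho {x u : H} (h : ∀ f : HDual k H, rho f x = f 1 • x + f x • u) :
    comul (R := k) x = x ⊗ₜ[k] 1 + u ⊗ₜ[k] x := by
  rw [comul_eq_sum_rho]
  simp only [h, TensorProduct.add_tmul, Finset.sum_add_distrib, TensorProduct.smul_tmul, ← TensorProduct.tmul_sum,
    sum_dualBas_smul]

theorem HDual.map_pow_of_isGroupLikeElem {χ : HDual k H} (hχ : IsGroupLikeElem k χ) (u : H) (i : ℕ) : χ (u ^ i) = χ u ^ i := by
  induction i with
  | zero => rw [pow_zero, pow_zero, HDual.one_of_isGroupLikeElem hχ]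
  | succ i ih => rw [pow_succ, HDual.mul_of_isGroupLikeElem hχ, ih, pow_succ]

include hp hdim

theorem IntDatum.exists_taft (hg : D.g ≠ 1) : ∃ ω : k, IsPrimitiveRoot ω p ∧ IsTaftAlgebra k (H := H) ω p := by
  have hp0 := hp.pos
  have hne : NeZero p := ⟨hp.ne_zero⟩
  have := nontrivial_of_hopf k H
  have hT := D.Ssq_pow_p hp hdim hg
  obtain ⟨w, x, u, φ, hw, hw1, hx0, hxR, hxT, hu, hφT, hφx, hrx⟩ := D.exists_skewPrimitive hp hdim hg
  have hwp := isPrimitiveRoot_of_prime hp hdim hw hw1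
  have hΔ := comul_of_rho hrx
  have hεx : counit (R := k) x = 0 := by
    rw [← HDual.one_apply]; exact HDual.groupLike_of_Ssq IsGroupLikeElem.one hxT hw1
  set a := S u with ha
  have hau : a * u = 1 := hu.antipode_mul_cancel
  have hua : u * a = 1 := hu.mul_antipode_cancel
  have haG : IsGroupLikeElem k a := hu.antipode
  have hSx : S x = -(a * x) := by
    have h1 := sw_mul_antipode (k := k) x (fun t => t)
    rw [sw_of_comul_add hΔ (fun x y => x * S y), hεx, zero_smul, antipode_one, mul_one] at h1
    have h2 := congrArg (fun t => a * t) h1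
    simp only [mul_add, mul_zero, ← mul_assoc, hau, one_mul] at h2
    exact eq_neg_of_add_eq_zero_right h2
  have hax : a * x = w • (x * a) := by
    have h1 : Ssq k H x = a * x * u := by
      rw [Ssq_apply, hSx, map_neg, antipode_mul_antidistrib, hSx, ha, hu.antipode_antipode, neg_mul, neg_neg]
    rw [h1] at hxT
    have h2 := congrArg (fun t => t * a) hxT
    simpa only [mul_assoc, hua, mul_one, smul_mul_assoc] using h2
  have hxu : x * u = w • (u * x) := by
    have h2 := congrArg (fun t => u * t * u) hax
    simp only [mul_smul_comm, smul_mul_assoc, mul_assoc, hau, mul_one] at h2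
    rw [← h2, ← mul_assoc, hua, one_mul]
  have hu1 : u ≠ 1 := by
    intro h
    rw [h, mul_one, one_mul] at hxu
    have h2 : (1 - w) • x = 0 := by rw [sub_smul, one_smul, ← hxu, sub_self]
    rcases smul_eq_zero.1 h2 with h | h
    · exact hw1 (sub_eq_zero.1 h).symm
    · exact hx0 h
  have hup : u ^ p = 1 := by
    rcases orderOf_cases hp hdim hu hu1 with h | h
    · rw [← h]; exact pow_orderOf_eq_one u
    · exfalso
      have hT1 : ∀ y : H, Ssq k H y = y := fun y => by
        have hy : y ∈ Submodule.span k (Set.range fun i : ℕ => u ^ i) := h ▸ Submodule.mem_top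
        induction hy using Submodule.span_induction with
        | mem x hx => obtain ⟨i, rfl⟩ := hx; exact Ssq_groupLike hu.pow
        | zero => simp
        | add x y _ _ hx hy => rw [map_add, hx, hy]
        | smul c x _ hx => rw [map_smul, hx]
      have h2 : (1 - w) • x = 0 := by rw [sub_smul, one_smul, ← hxT, hT1, sub_self]
      rcases smul_eq_zero.1 h2 with h | h
      · exact hw1 (sub_eq_zero.1 h).symm
      · exact hx0 h
  have hcomm : Commute a u := by rw [Commute, SemiconjBy, hau, hua]
  have hap : a ^ p = 1 := by
    have := hcomm.mul_pow p
    rwa [hau, one_pow, hup, mul_one, eq_comm] at this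
  have hap1 : a ^ (p - 1) = u := by
    have h1 : a ^ (p - 1) * a = 1 := by rw [← pow_succ, Nat.sub_add_cancel hp0, hap]
    calc a ^ (p - 1) = a ^ (p - 1) * (a * u) := by rw [hau, mul_one]
      _ = u := by rw [← mul_assoc, h1, one_mul]
  have hRmul : ∀ y z : H, rho D.α y = y → rho D.α z = z → rho D.α (y * z) = y * z := fun y z hy hz => by
    rw [rho_mul_of_groupLike D.α_groupLike, hy, hz]
  have hRpow : ∀ m, rho D.α (x ^ m) = x ^ m := fun m => by
    induction m with
    | zero => rw [pow_zero, rho_one_right, D.α_one, one_smul]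
    | succ m ih => rw [pow_succ]; exact hRmul _ _ ih hxR
  have hTpow : ∀ m, Ssq k H (x ^ m) = w ^ m • x ^ m := fun m => by
    induction m with
    | zero => rw [pow_zero, pow_zero, Ssq_one, one_smul]
    | succ m ih => rw [pow_succ, Ssq_mul, ih, hxT, smul_mul_smul_comm, pow_succ]
  obtain ⟨xf, φf, hfr⟩ := D.exists_frame hp hdim hg
  have hxun := fun w hw => (hfr w hw).2.2.2.1
  have hR1 : ∀ y, rho D.α y = y → Ssq k H y = y → y = counit (R := k) y • 1 := fun y hy hy' => by
    obtain ⟨c, hc⟩ := hxun 1 (one_pow p) 1 (by rw [rho_one_right, D.α_one, one_smul]) (by rw [Ssq_one, one_smul])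
    obtain ⟨d, hd⟩ := hxun 1 (one_pow p) y hy (by rw [hy', one_smul])
    have hc0 : c ≠ 0 := fun h => one_ne_zero (α := H) (by rw [hc, h, zero_smul])
    have h1 : y = (d * c⁻¹) • 1 := by rw [hc, hd, smul_smul, mul_assoc, inv_mul_cancel₀ hc0, mul_one]
    have h2 : counit (R := k) y = d * c⁻¹ := by rw [h1, map_smul, Bialgebra.counit_one, smul_eq_mul, mul_one]
    rw [h2, ← h1]
  have hxp : x ^ p = 0 := by
    rw [hR1 (x ^ p) (hRpow p) (by rw [hTpow, hw, one_smul]), Bialgebra.counit_pow, hεx, zero_pow hp.ne_zero, zero_smul]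
  have hD : ∀ y, rho D.α y = y → rho φ (x * y) = x * rho φ y + u * y := fun y hy => by
    have h1 : rho φ (x * y) = x * rho φ y + u * rho (precompMulLeft x φ) y := by
      rw [rho_apply, sw_mul x y (fun a b => φ b • a), sw_of_comul_add hΔ (fun a₁ a₂ => sw k y (fun b₁ b₂ => φ (a₂ * b₂) • (a₁ * b₁)))]
      congr 1
      · rw [rho_apply, IsLinearMap.map_sw (L := fun t => x * t) (by fun_prop)]
        refine sw_congr fun a b => ?_
        rw [one_mul, mul_smul_comm]
      · rw [rho_apply, IsLinearMap.map_sw (L := fun t => u * t) (by fun_prop)]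
        refine sw_congr fun a b => ?_
        rw [mul_smul_comm]; rfl
    have h2 : rho (precompMulLeft x φ - 1) y = 0 := by
      refine D.rho_eq_zero_on_R hp hdim hg hxun (fun v hv => ?_) hy
      rw [HDual.sub_apply]
      by_cases hv1 : v = 1
      · rw [hv1, hR1 (xf 1) (hfr 1 (one_pow p)).2.1 (by rw [(hfr 1 (one_pow p)).2.2.1, one_smul])]
        rw [map_smul, map_smul, ← smul_sub]
        simp [hφx]
      · rw [HDual.groupLike_of_Ssq IsGroupLikeElem.one (hfr v hv).2.2.1 hv1, sub_zero]
        refine HDual.apply_eq_zero_of_Ssq hφT (x := x * xf v) (v := w * v) ?_ ?_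
        · rw [Ssq_mul, hxT, (hfr v hv).2.2.1, smul_mul_smul_comm]
        · intro h
          exact hv1 (mul_left_cancel₀ (rootOfUnity_ne_zero hp0 hw) (by rw [h, mul_one]))
    rw [map_sub, LinearMap.sub_apply, sub_eq_zero, map_one, Module.End.one_apply] at h2
    rw [h1, h2]
  have hDpow : ∀ m, rho φ (x ^ (m + 1)) = (∑ i ∈ Finset.range (m + 1), w ^ i) • (u * x ^ m) := fun m => by
    induction m with
    | zero =>
      rw [zero_add, pow_one, hrx, hφx, HDual.apply_eq_zero_of_Ssq hφT (v := 1) (by rw [Ssq_one, one_smul]) (Ne.symm hw1)]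
      simp
    | succ m ih =>
      rw [pow_succ', hD _ (hRpow _), ih, mul_smul_comm, ← mul_assoc, hxu, smul_mul_assoc, mul_assoc, ← pow_succ', smul_smul,
        Finset.sum_range_succ' _ (m + 1), add_smul, pow_zero, one_smul, Finset.sum_mul]
      simp only [pow_succ]
  have hxm : ∀ m, m < p → x ^ m ≠ 0 := fun m => by
    induction m with
    | zero => intro _; rw [pow_zero]; exact one_ne_zero
    | succ m ih =>
      intro hm h
      have h1 := hDpow m
      rw [h, map_zero] at h1
      rcases smul_eq_zero.1 h1.symm with h2 | h2
      · have h3 := mul_geom_sum w (m + 1)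
        rw [h2, mul_zero, eq_comm, sub_eq_zero] at h3
        exact hwp.pow_ne_one_of_pos_of_lt (by omega) hm h3
      · refine ih (by omega) ?_
        have h3 := congrArg (fun t => a * t) h2
        simpa only [← mul_assoc, hau, one_mul, mul_zero] using h3
  have hαu : IsPrimitiveRoot (D.α u) p := by
    refine isPrimitiveRoot_of_prime hp hdim (by rw [← HDual.map_pow_of_isGroupLikeElem D.α_groupLike, hup, D.α_one]) fun h => ?_
    have := hR1 u (by rw [hu.rho_eq, h, one_smul]) (Ssq_groupLike hu)
    rw [hu.counit_eq_one, one_smul] at this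
    exact hu1 this
  have hyp : ∀ m, ∃ c : k, (x * a) ^ m = c • (x ^ m * a ^ m) := fun m => by
    induction m with
    | zero => exact ⟨1, by simp⟩
    | succ m ih =>
      obtain ⟨c, hc⟩ := ih
      have h1 : ∀ m, a ^ m * x = w ^ m • (x * a ^ m) := fun m => by
        induction m with
        | zero => simp
        | succ m ih => rw [pow_succ a, mul_assoc, hax, mul_smul_comm, ← mul_assoc, ih, smul_mul_assoc, smul_smul, mul_assoc, pow_succ' w]
      refine ⟨c * w ^ m, ?_⟩
      rw [pow_succ, hc, smul_mul_assoc, mul_assoc (x ^ m), ← mul_assoc (a ^ m), h1, smul_mul_assoc, mul_smul_comm, smul_smul,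
        pow_succ x, pow_succ a]
      simp only [mul_assoc]
  refine ⟨w, hwp, a, x * a, hap, ?_, ?_, haG.comul_eq_tmul_self, ?_, haG.counit_eq_one, ?_, ?_, ?_, ?_, hdim⟩
  · rw [← mul_assoc, hax, smul_mul_assoc]
  · obtain ⟨c, hc⟩ := hyp p
    rw [hc, hxp, zero_mul, smul_zero]
  · rw [Bialgebra.comul_mul, hΔ, haG.comul_eq_tmul_self, add_mul, Algebra.TensorProduct.tmul_mul_tmul,
      Algebra.TensorProduct.tmul_mul_tmul, hua, one_mul]
  · rw [Bialgebra.counit_mul, hεx, zero_mul]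
  · rw [hap1, ha, hu.antipode_antipode]
  · rw [antipode_mul_antidistrib, hSx, hap1, mul_assoc, hau, mul_one, ha, hu.antipode_antipode, ← ha, mul_neg, ← mul_assoc, hua, one_mul]
  · set A := Algebra.adjoin k {a, x * a} with hA
    have haA : a ∈ A := Algebra.subset_adjoin (by simp)
    have huA : u ∈ A := hap1 ▸ A.pow_mem haA _
    have hxA : x ∈ A := by
      have : x * a * u ∈ A := A.mul_mem (Algebra.subset_adjoin (by simp)) huA
      rwa [mul_assoc, hau, mul_one] at this
    have hRA : ∀ y, rho D.α y = y → y ∈ A := fun y hy => by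
      have h1 := congrArg (fun f => f y) (sum_cproj (k := k) hp.pos (Ssq k H))
      simp only [LinearMap.sum_apply, Module.End.one_apply] at h1
      rw [← h1]
      refine A.sum_mem fun v hv => ?_
      rw [mem_rou hp.pos] at hv
      have h2 := congrArg (fun f => f y) (cproj_commute (N := p) (commute_rho_Ssq D.α_groupLike).symm v).eq
      simp only [Module.End.mul_apply] at h2
      obtain ⟨c, hc⟩ := hxun v hv (cproj p (Ssq k H) v y) (by rw [← h2, hy])
        (congrArg (fun f => f y) (mul_cproj (k := k) hp.pos hT hv))
      obtain ⟨m, hm, hmv⟩ := hwp.eq_pow_of_pow_eq_one hv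
      obtain ⟨d, hd⟩ := hxun v hv (x ^ m) (hRpow m) (by rw [hTpow, hmv])
      have hd0 : d ≠ 0 := fun h => hxm m hm (by rw [hd, h, zero_smul])
      rw [hc, show xf v = d⁻¹ • x ^ m by rw [hd, smul_smul, inv_mul_cancel₀ hd0, one_smul]]
      exact A.smul_mem (A.smul_mem (A.pow_mem hxA m) _) _
    have hαp : rho D.α ^ p = 1 := by
      rw [← map_pow, ← D.orderOf_α hp hdim (D.α_ne_one hp hdim hg), pow_orderOf_eq_one, map_one]
    rw [eq_top_iff]
    intro y _
    have h1 := congrArg (fun f => f y) (sum_cproj (k := k) hp.pos (rho D.α))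
    simp only [LinearMap.sum_apply, Module.End.one_apply] at h1
    rw [← h1]
    refine A.sum_mem fun z hz => ?_
    rw [mem_rou hp.pos] at hz
    have hz0 := rootOfUnity_ne_zero hp0 hz
    have h2 : rho D.α (cproj p (rho D.α) z y) = z • cproj p (rho D.α) z y :=
      congrArg (fun f => f y) (mul_cproj (k := k) hp.pos hαp hz)
    generalize cproj p (rho D.α) z y = t at *
    obtain ⟨j, -, hj⟩ := hαu.eq_pow_of_pow_eq_one (ξ := z⁻¹) (by rw [inv_pow, hz, inv_one])
    have h3 := hRA (t * u ^ j) (by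
      rw [rho_mul_of_groupLike D.α_groupLike, h2, hu.pow.rho_eq, HDual.map_pow_of_isGroupLikeElem D.α_groupLike, hj,
        smul_mul_smul_comm, mul_inv_cancel₀ hz0, one_smul])
    have h4 := A.mul_mem h3 (A.pow_mem haA j)
    rwa [mul_assoc, ← hcomm.symm.mul_pow, hua, one_pow, mul_one] at h4

end Taft

section Involutive
variable {k H : Type*} [Field k] [CharZero k] [IsAlgClosed k] [Ring H] [HopfAlgebra k H] [FiniteDimensional k H]
variable {p : ℕ} (hp : p.Prime) (hdim : Module.finrank k H = p ^ 2) (D : IntDatum k H)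

local notation "S" => antipode k

theorem IntDatum.Ssq_mul_Ssq (hg : D.g = 1) (hα : D.α = 1) : Ssq k H * Ssq k H = 1 := by
  have := Ssq_pow D (p := 1) (by rw [hg, pow_one]) (by rw [hα, pow_one])
  rwa [mul_one, pow_two] at this

theorem IntDatum.antipode_L (hα : D.α = 1) : S D.L = D.L := by
  have := D.L_eq
  rwa [hα, lam_one] at this

theorem counit_Ssq (h : H) : counit (R := k) (Ssq k H h) = counit (R := k) h := by
  rw [Ssq_apply, counit_antipode, counit_antipode]

/-- The projection to the fixed space of an involution. -/
theorem half_idem {V : Type*} [AddCommGroup V] [Module k V] {T : Module.End k V} (hT : T * T = 1) :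
    ((2 : k)⁻¹ • (1 + T)) * ((2 : k)⁻¹ • (1 + T)) = (2 : k)⁻¹ • (1 + T) := by
  rw [smul_mul_smul_comm, mul_add, add_mul, add_mul, hT, one_mul, one_mul, mul_one,
    show (1 + T + (T + 1) : Module.End k V) = (2 : k) • (1 + T) by rw [two_smul]; abel, smul_smul]
  congr 1
  norm_num

theorem half_apply_range {V : Type*} [AddCommGroup V] [Module k V] {T : Module.End k V} (hT : T * T = 1) (v : V) :
    v ∈ LinearMap.range ((2 : k)⁻¹ • (1 + T)) ↔ T v = v := by
  constructor
  · rintro ⟨w, rfl⟩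
    have := LinearMap.congr_fun hT w
    simp only [Module.End.mul_apply, Module.End.one_apply] at this
    simp [this, add_comm]
  · intro h
    refine ⟨v, ?_⟩
    simp only [LinearMap.smul_apply, LinearMap.add_apply, Module.End.one_apply, h, ← two_smul k v, smul_smul]
    norm_num

theorem trace_half {V : Type*} [AddCommGroup V] [Module k V] [FiniteDimensional k V] {T : Module.End k V} (hT : T * T = 1) :
    LinearMap.trace k V T = 2 * (Module.finrank k (LinearMap.range ((2 : k)⁻¹ • (1 + T))) : k) - Module.finrank k V := by
  rw [← trace_idem (half_idem hT), map_smul, map_add, LinearMap.trace_one, smul_eq_mul]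
  ring

theorem IntDatum.trace_Ssq (hg : D.g = 1) : LinearMap.trace k H (Ssq k H) = counit (R := k) D.L * D.l 1 := by
  have := D.trace_mulLeft_antipode_sq 1
  rw [hg, mul_one] at this
  rw [← this]
  congr 1
  ext x
  simp [Ssq_apply]

theorem IntDatum.counit_L_ne_zero_of_finrank_eq_four (h4 : Module.finrank k H = 4) (hg : D.g = 1) (hα : D.α = 1) :
    counit (R := k) D.L ≠ 0 := by
  intro h0
  have hT := D.Ssq_mul_Ssq hg hα
  set T := Ssq k H with hTdef
  have hTT : ∀ x, T (T x) = x := fun x => LinearMap.congr_fun hT x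
  have htr := D.trace_Ssq hg
  have hL : T D.L = D.L := by rw [hTdef, Ssq_apply, D.antipode_L hα, D.antipode_L hα]
  rw [h0, zero_mul, trace_half hT, h4] at htr
  have hV : Module.finrank k (LinearMap.range ((2 : k)⁻¹ • (1 + T))) = 2 := by
    have : (2 * Module.finrank k (LinearMap.range ((2 : k)⁻¹ • (1 + T))) : k) = (4 : ℕ) := sub_eq_zero.1 htr
    have : 2 * Module.finrank k (LinearMap.range ((2 : k)⁻¹ • (1 + T))) = 4 := by exact_mod_cast this
    omega
  have hind : LinearIndependent k ![(1 : H), D.L] := by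
    rw [LinearIndependent.pair_iff]
    intro s t h
    have hs : s = 0 := by
      have := congrArg (counit (R := k)) h
      simpa [h0] using this
    subst hs
    rw [zero_smul, zero_add] at h
    exact ⟨rfl, (smul_eq_zero.1 h).resolve_right D.L_ne⟩
  have hspan : Submodule.span k {(1 : H), D.L} = LinearMap.range ((2 : k)⁻¹ • (1 + T)) := by
    refine Submodule.eq_of_le_of_finrank_eq ?_ ?_
    · rw [Submodule.span_le]
      rintro x (rfl | rfl)
      · exact (half_apply_range hT _).2 Ssq_one
      · exact (half_apply_range hT _).2 hL
    · rw [hV]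
      have := finrank_span_eq_card hind
      have hr : Set.range ![(1 : H), D.L] = {1, D.L} := by ext x; simp [or_comm]
      rwa [hr, Fintype.card_fin] at this
  have hfix : ∀ x, T x = x → ∃ d : k, x = counit (R := k) x • 1 + d • D.L := by
    intro x hx
    have : x ∈ Submodule.span k {(1 : H), D.L} := hspan ▸ (half_apply_range hT x).2 hx
    obtain ⟨c, d, rfl⟩ := Submodule.mem_span_pair.1 this
    refine ⟨d, ?_⟩
    simp [h0]
  have hε : ∀ x, T x = -x → counit (R := k) x = 0 := by
    intro x hx
    have := counit_Ssq (k := k) x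
    rw [← hTdef, hx, map_neg] at this
    exact self_eq_neg.1 this.symm
  -- an odd functional is a derivation
  have hder : ∀ f : HDual k H, (∀ x, f (T x) = - f x) → ∀ a b, f (a * b) = f a * counit (R := k) b + counit (R := k) a * f b := by
    intro f hf a b
    have hf0 : ∀ x, T x = x → f x = 0 := fun x hx => by
      have := hf x
      rw [hx] at this
      exact self_eq_neg.1 this
    have hdec : ∀ x, ∃ c d : k, ∃ v : H, T v = -v ∧ x = c • 1 + d • D.L + v := by
      intro x
      obtain ⟨d, hd⟩ := hfix ((2 : k)⁻¹ • (x + T x)) (by simp [hTT, add_comm])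
      refine ⟨counit (R := k) ((2 : k)⁻¹ • (x + T x)), d, (2 : k)⁻¹ • (x - T x), by simp [hTT, ← smul_neg], ?_⟩
      rw [← hd, ← smul_add, show x + T x + (x - T x) = (2 : k) • x by rw [two_smul]; abel, smul_smul]
      norm_num
    obtain ⟨c, d, v, hv, rfl⟩ := hdec a
    obtain ⟨c', d', v', hv', rfl⟩ := hdec b
    have h1 : f 1 = 0 := hf0 _ Ssq_one
    have h2 : f D.L = 0 := hf0 _ hL
    have hvv : f (v * v') = 0 := hf0 _ (by rw [hTdef, Ssq_mul, ← hTdef, hv, hv', neg_mul_neg])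
    have hvL : v * D.L = 0 := by rw [D.mul_L, hε v hv, zero_smul]
    have hLv : D.L * v' = 0 := by rw [D.L_mul, hα, HDual.one_apply, hε v' hv', zero_smul]
    have hLL : D.L * D.L = 0 := by rw [D.mul_L, h0, zero_smul]
    simp only [mul_add, add_mul, smul_mul_assoc, mul_smul_comm, one_mul, mul_one, map_add, map_smul, hvL, hLv, hLL,
      h1, h2, hvv, hε v hv, hε v' hv', h0, Bialgebra.counit_one, smul_eq_mul, map_zero]
    ring
  have hT1 : ∀ x, T x = x := by
    intro x
    refine HDual.eq_of_forall (k := k) fun φ => ?_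
    have hf : ∀ f : HDual k H, (∀ x, f (T x) = - f x) → ∀ h, f h = 0 := by
      intro f hf h
      have hS : ∀ h, f (S h) = - f h := by
        intro h
        have h1 := sw_mul_antipode (k := k) h (fun x => f x)
        have h2 : f 1 = 0 := by have := hf 1; rw [hTdef, Ssq_one] at this; exact self_eq_neg.1 this
        simp only [hder f hf, counit_antipode, h2, smul_zero] at h1
        rw [sw_add (F := fun x y => f x * counit (R := k) y) (G := fun x y => counit (R := k) x * f (S y))] at h1
        have h3 := sw_smul_counit (k := k) h (fun x => f x)
        have h4 := sw_counit_smul (k := k) h (fun x => f (S x))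
        simp only [smul_eq_mul] at h3 h4
        rw [h4] at h1
        simp only [mul_comm _ (counit _)] at h1 h3
        rw [h3] at h1
        exact eq_neg_of_add_eq_zero_right h1
      have := hf h
      rw [hTdef, Ssq_apply, hS, hS, neg_neg] at this
      exact self_eq_neg.1 this
    have := hf (φ - Ssq k (HDual k H) φ) (fun x => by
      rw [HDual.sub_apply, HDual.sub_apply, HDual.Ssq_apply_apply, HDual.Ssq_apply_apply, ← hTdef, hTT]; ring) x
    rw [HDual.sub_apply, HDual.Ssq_apply_apply, sub_eq_zero] at this
    exact this.symm
  have : LinearMap.range ((2 : k)⁻¹ • (1 + T)) = ⊤ := by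
    rw [eq_top_iff]; exact fun x _ => (half_apply_range hT x).2 (hT1 x)
  rw [this, finrank_top, h4] at hV
  omega

include hp hdim

/-- The dual of a unimodular and counimodular Hopf algebra of dimension `p²` has the same property. -/
theorem IntDatum.dual_trivial (hg : D.g = 1) (DK : IntDatum k (HDual k H)) :
    DK.g = 1 ∧ DK.α = 1 ∧ DK.L = (DK.l D.l)⁻¹ • D.l := by
  have hl : ∀ f : HDual k H, f * D.l = counit (R := k) f • D.l := fun f => by
    rw [D.mul_l, hg, HDual.counit_apply]
  have h1 := DK.L_unique D.l hl
  have h0 : DK.l D.l ≠ 0 := fun h => D.l_ne (by rw [h1, h, zero_smul])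
  have hαK : DK.α = 1 := by
    ext f
    have h2 := DK.L_mul f
    have h3 := D.l_mul f
    rw [h1, smul_mul_assoc, h2, smul_comm] at h3
    have h4 := sub_eq_zero.2 h3
    rw [← sub_smul] at h4
    rw [HDual.one_apply, HDual.counit_apply]
    refine sub_eq_zero.1 ((smul_eq_zero.1 h4).resolve_right ?_)
    rw [← h1]; exact D.l_ne
  refine ⟨?_, hαK, ?_⟩
  · by_contra h
    exact DK.α_ne_one hp (HDual.finrank_eq.trans hdim) h hαK
  · have h2 := congrArg (fun t => (DK.l D.l)⁻¹ • t) h1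
    simp only [smul_smul, inv_mul_cancel₀ h0, one_smul] at h2
    exact h2.symm

theorem IntDatum.trace_Ssq_ne_zero (hg : D.g = 1) (hα : D.α = 1) : LinearMap.trace k H (Ssq k H) ≠ 0 := by
  intro h0
  have hT := D.Ssq_mul_Ssq hg hα
  have hp2 : p = 2 := by
    rw [trace_half hT, hdim, sub_eq_zero] at h0
    have : 2 * Module.finrank k (LinearMap.range ((2 : k)⁻¹ • (1 + Ssq k H))) = p ^ 2 := by exact_mod_cast h0
    exact ((Nat.prime_dvd_prime_iff_eq Nat.prime_two hp).1 (Nat.prime_two.dvd_of_dvd_pow ⟨_, this.symm⟩)).symm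
  subst hp2
  rw [D.trace_Ssq hg] at h0
  rcases mul_eq_zero.1 h0 with h | h
  · exact D.counit_L_ne_zero_of_finrank_eq_four (by rw [hdim]; norm_num) hg hα h
  · obtain ⟨DK⟩ := IntDatum.nonempty (k := k) (H := HDual k H)
    obtain ⟨h1, h2, h3⟩ := D.dual_trivial hp hdim hg DK
    refine DK.counit_L_ne_zero_of_finrank_eq_four (by rw [HDual.finrank_eq, hdim]; norm_num) h1 h2 ?_
    rw [h3, HDual.counit_apply, HDual.smul_apply, h, mul_zero]

theorem IntDatum.Ssq_eq_one (hg : D.g = 1) (hα : D.α = 1) : Ssq k H = 1 := by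
  have hT := D.Ssq_mul_Ssq hg hα
  have htr := D.trace_Ssq hg
  have hne := D.trace_Ssq_ne_zero hp hdim hg hα
  have hn : (Module.finrank k H : k) ≠ 0 := by
    rw [hdim]; exact_mod_cast (pow_pos hp.pos 2).ne'
  set n := Module.finrank k H with hndef
  set T := Ssq k H with hTdef
  set χ := regChar k H with hχ
  set P : Module.End k H := (n : k)⁻¹ • rho χ with hP
  have hPP : P * P = P := by
    rw [hP, smul_mul_smul_comm, ← map_mul, hχ, regChar_mul_regChar, map_smul, smul_smul, ← hndef,
      mul_assoc, inv_mul_cancel₀ hn, mul_one]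
  have hχT : Ssq k _ χ = χ := by
    ext h
    rw [HDual.Ssq_apply_apply, hχ, regChar_apply, regChar_apply]
    have : LinearMap.mulLeft k (Ssq k H h) = T * (LinearMap.mulLeft k h * T) := by
      ext x
      simp only [Module.End.mul_apply, LinearMap.mulLeft_apply, hTdef]
      rw [Ssq_mul]
      congr 1
      exact (LinearMap.congr_fun hT x).symm
    rw [this, LinearMap.trace_mul_comm, mul_assoc, hT, mul_one]
  have hPT : P * T = T * P := by
    ext h
    rw [Module.End.mul_apply, Module.End.mul_apply, hP, LinearMap.smul_apply, hTdef, rho_Ssq, hχT, LinearMap.smul_apply, map_smul]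
  have htrPT : LinearMap.trace k H (P * T) = (n : k)⁻¹ * LinearMap.trace k H T := by
    have h1 := D.trace_rho_antipode_sq χ
    rw [hg, one_mul, D.antipode_L hα] at h1
    have h2 : χ D.L = counit (R := k) D.L := by
      rw [hχ, regChar_apply]
      have : LinearMap.mulLeft k D.L = (counit (R := k) (A := H)).smulRight D.L := by
        ext x
        rw [LinearMap.mulLeft_apply, D.L_mul, hα, HDual.one_apply, LinearMap.smulRight_apply]
      rw [this, LinearMap.trace_smulRight]
    rw [h2] at h1
    rw [hP, smul_mul_assoc, map_smul, smul_eq_mul, htr, mul_comm (counit _), ← h1]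
    rfl
  set Q : Module.End k H := (2 : k)⁻¹ • (1 + T) with hQ
  have hQQ : Q * Q = Q := half_idem hT
  have hPQ : P * Q = Q * P := by
    rw [hQ, mul_smul_comm, smul_mul_assoc (2 : k)⁻¹ _ P, mul_add P, add_mul, hPT, one_mul, mul_one]
  have hPQ2 : (P * Q) * (P * Q) = P * Q := by
    rw [mul_assoc, ← mul_assoc Q, ← hPQ, mul_assoc, hQQ, ← mul_assoc, hPP]
  have e1 := trace_idem hPQ2
  have e2 := trace_idem hPP
  have e3 := trace_half hT
  have e4 : LinearMap.trace k H (P * T) = 2 * LinearMap.trace k H (P * Q) - LinearMap.trace k H P := by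
    rw [hQ, mul_smul_comm, mul_add, mul_one, map_smul, map_add, smul_eq_mul]; ring
  rw [← hQ, ← hndef] at e3
  set a := Module.finrank k (LinearMap.range Q)
  set b := Module.finrank k (LinearMap.range (P * Q))
  set c := Module.finrank k (LinearMap.range P)
  rw [e1, e2, htrPT] at e4
  have e5 : (n * (2 * b - c) : ℤ) = 2 * a - n := by
    have : (n : k) * (2 * b - c) = 2 * a - n := by rw [← e4, ← e3, ← mul_assoc, mul_inv_cancel₀ hn, one_mul]
    exact_mod_cast this
  have e6 : (2 * a - n : ℤ) ≠ 0 := by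
    intro h
    apply hne
    rw [e3]
    exact_mod_cast congrArg (Int.cast : ℤ → k) h
  have ha : a ≤ n := Submodule.finrank_le _
  have ha0 : 0 < a := by
    have := nontrivial_of_hopf k H
    have h1 : (⟨1, (half_apply_range hT _).2 Ssq_one⟩ : LinearMap.range Q) ≠ 0 := by
      intro h; exact one_ne_zero (congrArg Subtype.val h)
    have : Nontrivial (LinearMap.range Q) := ⟨_, _, h1⟩
    exact Module.finrank_pos
  have han : a = n := by
    have hm : (2 * b - c : ℤ) = 1 := by
      have hn0 : (0 : ℤ) < n := by omega
      have h1 : (2 * b - c : ℤ) ≤ 1 := by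
        by_contra h
        push Not at h
        nlinarith
      have h2 : (-1 : ℤ) < (2 * b - c : ℤ) := by
        by_contra h
        push Not at h
        nlinarith
      have h3 : (2 * b - c : ℤ) ≠ 0 := fun h => e6 (by rw [← e5, h, mul_zero])
      omega
    rw [hm, mul_one] at e5
    omega
  have htop : LinearMap.range Q = ⊤ := Submodule.eq_top_of_finrank_eq han
  ext x
  exact (half_apply_range hT x).1 (htop ▸ Submodule.mem_top)

end Involutive

section Wedderburn
variable {k A : Type*} [Field k] [CharZero k] [Ring A] [Algebra k A] [FiniteDimensional k A]

theorem isSemisimpleRing_of_nondegenerate (τ : A → k) (hnil : ∀ a, IsNilpotent a → τ a = 0)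
    (hnd : ∀ a, (∀ b, τ (b * a) = 0) → a = 0) : IsSemisimpleRing A := by
  have : IsArtinianRing A := IsArtinianRing.of_finite k A
  rw [IsArtinianRing.isSemisimpleRing_iff_jacobson, eq_bot_iff]
  intro a ha
  refine hnd a fun b => hnil _ ?_
  obtain ⟨N, hN⟩ := IsSemiprimaryRing.isNilpotent (R := A)
  refine ⟨N, ?_⟩
  have h1 : b * a ∈ Ring.jacobson A := Ideal.mul_mem_left _ b ha
  have h2 := Ideal.pow_mem_pow h1 N
  rw [hN] at h2
  exact h2

theorem exists_primitive_family [IsAlgClosed k] [IsSemisimpleRing A] : ∃ (ι : Type) (_ : Fintype ι) (e : ι → A),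
    (∀ i, e i ≠ 0) ∧ (∀ i, e i * e i = e i) ∧ (∀ i j, i ≠ j → e i * e j = 0) ∧ ∑ i, e i = 1 ∧
    ∀ i c, ∃ μ : k, e i * c * e i = μ • e i := by
  obtain ⟨n, d, hd, ⟨φ⟩⟩ := IsSemisimpleRing.exists_algEquiv_pi_matrix_of_isAlgClosed k A
  let E : (Σ i, Fin (d i)) → (∀ i, Matrix (Fin (d i)) (Fin (d i)) k) := fun s => Pi.single s.1 (Matrix.single s.2 s.2 1)
  have hmul : ∀ i (a b : Matrix (Fin (d i)) (Fin (d i)) k), (Pi.single i a * Pi.single i b : ∀ i, Matrix (Fin (d i)) (Fin (d i)) k) = Pi.single i (a * b) :=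
    fun i a b => (Pi.single_mul (α := fun i => Matrix (Fin (d i)) (Fin (d i)) k) i a b).symm
  refine ⟨Σ i, Fin (d i), inferInstance, fun s => φ.symm (E s), ?_, ?_, ?_, ?_, ?_⟩
  · rintro ⟨i, a⟩ h
    rw [map_eq_zero_iff _ φ.symm.injective] at h
    have := congrFun (congrFun (congrFun h i) a) a
    simp [E] at this
  · rintro ⟨i, a⟩
    rw [← map_mul]
    simp only [E, hmul, Matrix.single_mul_single_same, mul_one]
  · rintro ⟨i, a⟩ ⟨j, b⟩ h
    rw [← map_mul]
    simp only [E]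
    by_cases hij : i = j
    · subst hij
      rw [hmul, Matrix.single_mul_single_of_ne _ _ _ _ (fun hab => h (by rw [hab])), Pi.single_zero, map_zero]
    · rw [← map_zero φ.symm]
      congr 1
      funext l
      by_cases hl : l = i
      · subst hl; simp [Pi.single_eq_of_ne hij]
      · simp [Pi.single_eq_of_ne hl]
  · rw [← map_sum, ← map_one φ.symm]
    congr 1
    rw [Fintype.sum_sigma]
    funext l
    rw [Finset.sum_apply, Finset.sum_eq_single l]
    · simp only [E, Finset.sum_apply, Pi.single_eq_same, Pi.one_apply]
      ext a b
      simp [Matrix.sum_apply, Matrix.single_apply, Matrix.one_apply, -Finset.sum_boole, ite_and]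
    · intro i _ hi
      simp [E, Finset.sum_apply, Pi.single_eq_of_ne hi.symm]
    · simp
  · rintro ⟨i, a⟩ c
    refine ⟨φ c i a a, φ.injective ?_⟩
    simp only [map_mul, map_smul, AlgEquiv.apply_symm_apply, E]
    funext l
    by_cases hl : l = i
    · subst hl
      simp
    · simp [Pi.single_eq_of_ne hl]

theorem Matrix.trace_of_idem {m : Type*} [Fintype m] {M : Matrix m m k} (h : M * M = M) : ∃ r : ℕ, M.trace = r := by
  have h1 : (Matrix.toLin' M) * (Matrix.toLin' M) = Matrix.toLin' M := by
    rw [Module.End.mul_eq_comp, ← Matrix.toLin'_mul, h]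
  have := trace_idem h1
  rw [Matrix.trace_toLin'_eq] at this
  exact ⟨_, this⟩

theorem isIntegral_of_mulVec {m : Type*} [Fintype m] (N : Matrix m m ℤ) {v : m → k} (hv : v ≠ 0) {γ : k}
    (h : (N.map (Int.castRingHom k)).mulVec v = γ • v) : IsIntegral ℤ γ := by
  refine ⟨N.charpoly, N.charpoly_monic, ?_⟩
  have h1 : ((N.map (Int.castRingHom k)).charpoly).IsRoot γ := by
    have : Module.End.HasEigenvalue (Matrix.toLin' (N.map (Int.castRingHom k))) γ :=
      Module.End.hasEigenvalue_of_hasEigenvector (x := v) ⟨Module.End.mem_eigenspace_iff.2 (by rw [Matrix.toLin'_apply, h]), hv⟩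
    have := (Module.End.hasEigenvalue_iff_isRoot_charpoly _ _).1 this
    rwa [Matrix.charpoly_toLin'] at this
  rw [Matrix.charpoly_map, Polynomial.IsRoot.def, Polynomial.eval_map] at h1
  exact h1

theorem dvd_of_isIntegral_div {r n : ℕ} (hr : r ≠ 0) (h : IsIntegral ℤ ((n : k) / r)) : r ∣ n := by
  let _ : Algebra ℚ k := DivisionRing.toRatAlgebra
  have h1 : ((n : k) / r) = algebraMap ℚ k ((n : ℚ) / r) := by simp
  rw [h1, isIntegral_algebraMap_iff (algebraMap ℚ k).injective, IsIntegrallyClosed.isIntegral_iff] at h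
  obtain ⟨m, hm⟩ := h
  have hr' : (r : ℚ) ≠ 0 := by exact_mod_cast hr
  rw [eq_div_iff hr'] at hm
  have : m * r = n := by simp at hm; exact_mod_cast hm
  exact Int.natCast_dvd_natCast.1 ⟨m, by rw [mul_comm, this]⟩

variable {n : ℕ} {d : Fin n → ℕ} [∀ i, NeZero (d i)] (φ : A ≃ₐ[k] ∀ i, Matrix (Fin (d i)) (Fin (d i)) k)

/-- The matrix units of a split semisimple algebra. -/
noncomputable def munit (i : Fin n) (a b : Fin (d i)) : A := φ.symm (Pi.single i (Matrix.single a b 1))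

/-- The irreducible characters. -/
noncomputable def irrChar (i : Fin n) : A →ₗ[k] k :=
  Matrix.traceLinearMap (Fin (d i)) k k ∘ₗ LinearMap.proj i ∘ₗ φ.toLinearMap

theorem irrChar_apply (i : Fin n) (x : A) : irrChar φ i x = (φ x i).trace := rfl

theorem irrChar_comm (i : Fin n) (x y : A) : irrChar φ i (x * y) = irrChar φ i (y * x) := by
  rw [irrChar_apply, irrChar_apply, map_mul, map_mul, Pi.mul_apply, Pi.mul_apply, Matrix.trace_mul_comm]

theorem munit_mul (i : Fin n) (a b c : Fin (d i)) : munit φ i a b * munit φ i b c = munit φ i a c := by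
  rw [munit, munit, munit, ← map_mul, ← Pi.single_mul, Matrix.single_mul_single_same, mul_one]

theorem munit_mul_of_ne (i : Fin n) (a b b' c : Fin (d i)) (h : b ≠ b') : munit φ i a b * munit φ i b' c = 0 := by
  rw [munit, munit, ← map_mul, ← Pi.single_mul, Matrix.single_mul_single_of_ne _ _ _ _ h, Pi.single_zero, map_zero]

theorem eq_sum_munit (x : A) : x = ∑ i, ∑ a, ∑ b, φ x i a b • munit φ i a b := by
  apply φ.injective
  simp only [map_sum, map_smul, munit, AlgEquiv.apply_symm_apply]
  funext l
  rw [Finset.sum_apply, Finset.sum_eq_single l]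
  · simp only [Finset.sum_apply, Pi.smul_apply, Pi.single_eq_same]
    conv_lhs => rw [Matrix.matrix_eq_sum_single (φ x l)]
    simp [Matrix.smul_single]
  · intro i _ hi
    simp [Finset.sum_apply, Pi.single_eq_of_ne hi.symm]
  · simp

/-- A trace function is a combination of irreducible characters. -/
theorem eq_sum_irrChar (f : A →ₗ[k] k) (hf : ∀ x y, f (x * y) = f (y * x)) (x : A) :
    f x = ∑ i, f (munit φ i 0 0) * irrChar φ i x := by
  have h1 : ∀ i a b, f (munit φ i a b) = if a = b then f (munit φ i 0 0) else 0 := by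
    intro i a b
    split_ifs with h
    · subst h
      rw [← munit_mul φ i a 0 a, hf, munit_mul]
    · rw [← munit_mul φ i a b b, hf, munit_mul_of_ne φ i _ _ _ _ (Ne.symm h), map_zero]
  conv_lhs => rw [eq_sum_munit φ x]
  simp only [map_sum, map_smul]
  refine Finset.sum_congr rfl fun i _ => ?_
  rw [irrChar_apply, Matrix.trace, Finset.mul_sum]
  refine Finset.sum_congr rfl fun a _ => ?_
  rw [Finset.sum_eq_single a (fun b _ hb => by rw [h1, if_neg hb.symm, smul_zero]) (by simp), h1, if_pos rfl,
    smul_eq_mul, mul_comm, Matrix.diag_apply]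

theorem munit_idem (i : Fin n) (a : Fin (d i)) : munit φ i a a * munit φ i a a = munit φ i a a := munit_mul φ i a a a

/-- The regular character takes the value `d i` at a minimal idempotent of the `i`-th block. -/
theorem trace_mulLeft_munit (i : Fin n) : LinearMap.trace k A (LinearMap.mulLeft k (munit φ i 0 0)) = d i := by
  rw [trace_idem (by rw [Module.End.mul_eq_comp, ← LinearMap.mulLeft_mul, munit_idem])]
  congr 1
  let ψ : (Fin (d i) → k) →ₗ[k] A := ∑ b, (LinearMap.proj b).smulRight (munit φ i 0 b)
  have hψ : ∀ v, ψ v = ∑ b, v b • munit φ i 0 b := fun v => by simp [ψ]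
  have hinj : Function.Injective ψ := by
    rw [injective_iff_map_eq_zero]
    intro v hv
    funext b
    have h1 := congrArg (fun t => φ t i 0 b) hv
    simp only [hψ, map_sum, map_smul, munit, AlgEquiv.apply_symm_apply, Finset.sum_apply, Pi.smul_apply, Pi.single_eq_same,
      Matrix.sum_apply, Matrix.smul_apply, map_zero] at h1
    simpa [Matrix.single_apply] using h1
  have hr : LinearMap.range (LinearMap.mulLeft k (munit φ i 0 0)) = LinearMap.range ψ := by
    refine le_antisymm ?_ ?_
    · rintro _ ⟨x, rfl⟩
      refine ⟨fun b => φ x i 0 b, ?_⟩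
      rw [hψ, LinearMap.mulLeft_apply]
      apply φ.injective
      simp only [map_sum, map_smul, map_mul, munit, AlgEquiv.apply_symm_apply]
      funext l
      by_cases hl : l = i
      · subst hl
        ext a b
        simp [Finset.sum_apply, Matrix.sum_apply, Matrix.single_apply, Matrix.mul_apply, ite_and]
      · simp [Finset.sum_apply, Pi.single_eq_of_ne hl]
    · rintro _ ⟨v, rfl⟩
      refine ⟨ψ v, ?_⟩
      rw [LinearMap.mulLeft_apply, hψ, Finset.mul_sum]
      simp only [mul_smul_comm, munit_mul]
  rw [hr, LinearMap.finrank_range_of_inj hinj]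
  simp

end Wedderburn

/-- Integrals of a semisimple Hopf algebra with involutive antipode. -/
structure SSDatum (k H : Type*) [Field k] [Ring H] [HopfAlgebra k H] [FiniteDimensional k H] where
  L : H
  Ssq_eq : Ssq k H = 1
  mul_L : ∀ h : H, h * L = counit (R := k) h • L
  L_mul : ∀ h : H, L * h = counit (R := k) h • L
  counit_L : counit (R := k) L = 1
  trace_rho : ∀ f : HDual k H, LinearMap.trace k H (rho f) = (Module.finrank k H : k) * f L
  nondeg : ∀ h : H, (∀ x, regChar k H (x * h) = 0) → h = 0
  mul_reg : ∀ f : HDual k H, f * regChar k H = f 1 • regChar k H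
  reg_mul : ∀ f : HDual k H, regChar k H * f = f 1 • regChar k H
  sw_L : ∀ a : H, sw k L (fun u v => regChar k H (a * u) • antipode k v) = a

section SS
variable {k H : Type*} [Field k] [CharZero k] [IsAlgClosed k] [Ring H] [HopfAlgebra k H] [FiniteDimensional k H]
variable {p : ℕ} (hp : p.Prime) (hdim : Module.finrank k H = p ^ 2)

local notation "S" => antipode k

theorem regChar_comm (a b : H) : regChar k H (a * b) = regChar k H (b * a) := by
  rw [regChar_apply, regChar_apply, LinearMap.mulLeft_mul, LinearMap.mulLeft_mul]
  exact LinearMap.trace_mul_comm k _ _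

theorem regChar_one : regChar k H 1 = Module.finrank k H := by
  rw [regChar_apply, LinearMap.mulLeft_one]; exact LinearMap.trace_one k H

include hp hdim

theorem SSDatum.of (D : IntDatum k H) (hg : D.g = 1) (hα : D.α = 1) (hS : Ssq k H = 1) : Nonempty (SSDatum k H) := by
  set c := counit (R := k) D.L with hc
  have hn : (Module.finrank k H : k) ≠ 0 := by
    rw [hdim]; exact_mod_cast (pow_pos hp.pos 2).ne'
  have hreg : regChar k H = c • D.l := by
    ext h
    have := D.trace_mulLeft_antipode_sq h
    rw [hg, mul_one, show (S : H →ₗ[k] H) ∘ₗ S = LinearMap.id from hS, LinearMap.comp_id] at this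
    rw [regChar_apply, this, HDual.smul_apply]
  have hcl : c * D.l 1 = Module.finrank k H := by
    rw [← regChar_one (k := k) (H := H), hreg, HDual.smul_apply]
  have hc0 : c ≠ 0 := fun h => hn (by rw [← hcl, h, zero_mul])
  refine ⟨⟨c⁻¹ • D.L, hS, fun h => ?_, fun h => ?_, ?_, fun f => ?_, fun h hh => ?_, fun f => ?_, fun f => ?_, fun a => ?_⟩⟩
  · rw [mul_smul_comm, D.mul_L, smul_comm]
  · rw [smul_mul_assoc, D.L_mul, hα, HDual.one_apply, smul_comm]
  · rw [map_smul, ← hc, smul_eq_mul, inv_mul_cancel₀ hc0]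
  · have := D.trace_rho_antipode_sq f
    rw [hg, one_mul, D.antipode_L hα, show (S : H →ₗ[k] H) ∘ₗ S = LinearMap.id from hS, LinearMap.comp_id] at this
    rw [this, map_smul, ← hcl, smul_eq_mul]
    field_simp
  · refine D.nondeg' h fun x => ?_
    have := hh x
    rw [hreg, HDual.smul_apply] at this
    exact (mul_eq_zero.1 this).resolve_left hc0
  · rw [hreg, mul_smul_comm, D.mul_l, hg, smul_comm]
  · rw [hreg, smul_mul_assoc, D.l_mul, smul_comm]
  · rw [sw_smul_left c⁻¹ D.L (fun u v => regChar k H (a * u) • S v), hreg]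
    simp only [HDual.smul_apply, mul_smul]
    rw [← smul_sw, D.sw_L, smul_smul, inv_mul_cancel₀ hc0, one_smul]

theorem IntDatum.ssDatum (D : IntDatum k H) (hg : D.g = 1) (hα : D.α = 1) :
    Nonempty (SSDatum k H) ∧ Nonempty (SSDatum k (HDual k H)) := by
  have hS := D.Ssq_eq_one hp hdim hg hα
  refine ⟨SSDatum.of hp hdim D hg hα hS, ?_⟩
  obtain ⟨DK⟩ := IntDatum.nonempty (k := k) (H := HDual k H)
  obtain ⟨h1, h2, -⟩ := D.dual_trivial hp hdim hg DK
  refine SSDatum.of hp (HDual.finrank_eq.trans hdim) DK h1 h2 ?_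
  ext f h
  rw [HDual.Ssq_apply_apply, hS]
  rfl

end SS

section CharAlg
variable (k H : Type*) [Field k] [CharZero k] [IsAlgClosed k] [Ring H] [HopfAlgebra k H] [FiniteDimensional k H]

local notation "S" => antipode k

/-- The algebra of trace functions on a Hopf algebra. -/
def charAlg : Subalgebra k (HDual k H) where
  carrier := {f | ∀ a b, f (a * b) = f (b * a)}
  mul_mem' := by
    intro f f' hf hf' a b
    rw [HDual.mul_apply, HDual.mul_apply, sw_mul a b (fun x y => f x * f' y), sw_mul b a (fun x y => f x * f' y), sw_comm]
    refine sw_congr fun x y => sw_congr fun x' y' => ?_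
    change ∀ a b, f (a * b) = f (b * a) at hf
    change ∀ a b, f' (a * b) = f' (b * a) at hf'
    rw [hf, hf']
  add_mem' := by
    intro f f' hf hf' a b
    rw [HDual.add_apply, HDual.add_apply, hf, hf']
  algebraMap_mem' := by
    intro c a b
    rw [Algebra.algebraMap_eq_smul_one, HDual.smul_apply, HDual.smul_apply, HDual.one_apply, HDual.one_apply,
      Bialgebra.counit_mul, Bialgebra.counit_mul, mul_comm (counit a)]

variable {k H}

theorem antipode_mem_charAlg {f : HDual k H} (hf : f ∈ charAlg k H) : S f ∈ charAlg k H := fun a b => by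
  rw [HDual.antipode_apply, HDual.antipode_apply, antipode_mul_antidistrib, antipode_mul_antidistrib, hf]

theorem regChar_mem_charAlg : regChar k H ∈ charAlg k H := regChar_comm

theorem mem_charAlg_of_groupLike {f : HDual k H} (hf : IsGroupLikeElem k f) : f ∈ charAlg k H := fun a b => by
  rw [HDual.mul_of_isGroupLikeElem hf, HDual.mul_of_isGroupLikeElem hf, mul_comm]

set_option maxHeartbeats 1000000 in
/-- The product of two characters takes natural values at idempotents. -/
theorem trace_mul_trace_of_idem {m m' : Type*} [Fintype m] [Fintype m'] (M : H →ₗ[k] Matrix m m k) (M' : H →ₗ[k] Matrix m' m' k)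
    (hM : ∀ x y, M (x * y) = M x * M y) (hM' : ∀ x y, M' (x * y) = M' x * M' y) {x : H} (hx : x * x = x) :
    ∃ r : ℕ, sw k x (fun u v => (M u).trace * (M' v).trace) = r := by
  obtain ⟨B, hB⟩ : ∃ B : Matrix m m k →ₗ[k] Matrix m' m' k →ₗ[k] Matrix (m × m') (m × m') k,
      ∀ a b, B a b = Matrix.kroneckerMap (fun x y => x * y) a b := ⟨Matrix.kroneckerMapBilinear (LinearMap.mul k k), fun _ _ => rfl⟩
  have h2 : sw k x (fun u v => B (M u) (M' v)) * sw k x (fun u v => B (M u) (M' v)) = sw k x (fun u v => B (M u) (M' v)) := by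
    conv_rhs => rw [← hx]
    rw [sw_mul x x (fun u v => B (M u) (M' v)), IsLinearMap.map_sw (L := fun t => t * sw k x (fun u v => B (M u) (M' v))) (by fun_prop)]
    refine sw_congr fun u v => ?_
    rw [IsLinearMap.map_sw (L := fun t => B (M u) (M' v) * t) (by fun_prop)]
    refine sw_congr fun u' v' => ?_
    rw [hM, hM', hB, hB, hB, Matrix.mul_kronecker_mul]
  obtain ⟨r, hr⟩ := Matrix.trace_of_idem h2
  refine ⟨r, ?_⟩
  rw [← hr, IsLinearMap.map_sw (L := fun t => Matrix.trace t) ⟨fun a b => Matrix.trace_add a b, fun c a => Matrix.trace_smul c a⟩]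
  refine sw_congr fun u v => ?_
  rw [hB, Matrix.trace_kronecker]

end CharAlg

section ClassEq
variable {k H : Type*} [Field k] [CharZero k] [IsAlgClosed k] [Ring H] [HopfAlgebra k H] [FiniteDimensional k H]

local notation "S" => antipode k

theorem finrank_ne_zero_of_hopf : (Module.finrank k H : k) ≠ 0 := by
  have := nontrivial_of_hopf k H
  exact_mod_cast (Module.finrank_pos (R := k) (M := H)).ne'

theorem rho_injective : Function.Injective (rho : HDual k H → Module.End k H) := fun f f' h => by
  ext x
  rw [← counit_rho, h, counit_rho]

theorem regChar_of_isNilpotent {a : H} (ha : IsNilpotent a) : regChar k H a = 0 := by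
  rw [regChar_apply]
  refine (LinearMap.isNilpotent_trace_of_isNilpotent ?_).eq_zero
  obtain ⟨m, hm⟩ := ha
  exact ⟨m, by rw [LinearMap.pow_mulLeft, hm, LinearMap.mulLeft_zero_eq_zero]⟩

namespace SSDatum
variable (d : SSDatum k H)
include d

theorem antipode_antipode (h : H) : S (S h) = h := by
  rw [← Ssq_apply, d.Ssq_eq]; rfl

theorem dual_antipode_antipode (f : HDual k H) : S (S f) = f := by
  ext h; rw [HDual.antipode_apply, HDual.antipode_apply, d.antipode_antipode]

theorem antipode_L : S d.L = d.L := by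
  have h1 : d.L * S d.L = d.L := by rw [d.L_mul, counit_antipode, d.counit_L, one_smul]
  calc S d.L = S (d.L * S d.L) := by rw [h1]
    _ = S (S d.L) * S d.L := antipode_mul_antidistrib _ _
    _ = d.L := by rw [d.antipode_antipode, h1]

theorem antipode_apply_L (f : HDual k H) : (S f) d.L = f d.L := by rw [HDual.antipode_apply, d.antipode_L]

theorem mul_apply_L_comm (f f' : HDual k H) : (f * f') d.L = (f' * f) d.L := by
  refine mul_left_cancel₀ (finrank_ne_zero_of_hopf (k := k) (H := H)) ?_
  rw [← d.trace_rho, ← d.trace_rho, map_mul rho, map_mul rho, LinearMap.trace_mul_comm]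

theorem isSemisimpleRing : IsSemisimpleRing H :=
  isSemisimpleRing_of_nondegenerate (k := k) (regChar k H) (fun _ => regChar_of_isNilpotent) d.nondeg

theorem apply_L_eq {e : HDual k H} (he : e * e = e) :
    (Module.finrank k H : k) * e d.L = Module.finrank k (LinearMap.range (rho e)) := by
  rw [← d.trace_rho, trace_idem (by rw [← map_mul, he])]

theorem finrank_range_ne_zero {e : HDual k H} (he0 : e ≠ 0) : Module.finrank k (LinearMap.range (rho e)) ≠ 0 := by
  intro h
  rw [Submodule.finrank_eq_zero, LinearMap.range_eq_bot] at h
  exact he0 (rho_injective (h.trans (map_zero rho).symm))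

variable {n : ℕ} {r : Fin n → ℕ} [∀ i, NeZero (r i)] (φ : H ≃ₐ[k] ∀ i, Matrix (Fin (r i)) (Fin (r i)) k)

local notation "χ" => fun i => (HDual.of (irrChar φ i) : HDual k H)

omit d in
theorem irrChar_mem (i : Fin n) : HDual.of (irrChar φ i) ∈ charAlg k H := fun a b => irrChar_comm φ i a b

omit d in
theorem eq_sum_of_mem {f : HDual k H} (hf : f ∈ charAlg k H) : f = ∑ i, f (munit φ i 0 0) • HDual.of (irrChar φ i) := by
  ext x
  rw [HDual.sum_apply]
  exact eq_sum_irrChar φ (HDual.of.symm f) hf x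

theorem irrChar_orthogonal (i j : Fin n) :
    ((HDual.of (irrChar φ i) : HDual k H) * S (HDual.of (irrChar φ j))) d.L = if i = j then 1 else 0 := by
  have hreg : ∀ x, regChar k H x = ∑ l, (r l : k) * irrChar φ l x := fun x => by
    refine (eq_sum_irrChar φ (HDual.of.symm (regChar k H)) regChar_mem_charAlg x).trans ?_
    refine Finset.sum_congr rfl fun l _ => ?_
    rw [HDual.of_symm_apply, regChar_apply, trace_mulLeft_munit]
  let z : H := φ.symm (Pi.single i 1)
  have hz : ∀ u, regChar k H (z * u) = (r i : k) * irrChar φ i u := fun u => by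
    rw [hreg, Finset.sum_eq_single i]
    · rw [irrChar_apply, irrChar_apply, map_mul, Pi.mul_apply, AlgEquiv.apply_symm_apply, Pi.single_eq_same, one_mul]
    · intro l _ hl
      rw [irrChar_apply, map_mul, Pi.mul_apply, AlgEquiv.apply_symm_apply, Pi.single_eq_of_ne hl, zero_mul, Matrix.trace_zero, mul_zero]
    · simp
  have hr : (r i : k) ≠ 0 := Nat.cast_ne_zero.2 (NeZero.ne _)
  refine mul_left_cancel₀ hr ?_
  have h1 := congrArg (irrChar φ j) (d.sw_L z)
  rw [map_sw] at h1
  rw [HDual.mul_apply, ← smul_eq_mul, smul_sw]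
  calc _ = sw k d.L (fun u v => irrChar φ j (regChar k H (z * u) • S v)) := sw_congr fun u v => by
        rw [hz, map_smul, HDual.antipode_apply, HDual.of_apply, HDual.of_apply, smul_eq_mul, smul_eq_mul, mul_assoc]
    _ = _ := h1
    _ = _ := by
      rw [irrChar_apply, AlgEquiv.apply_symm_apply]
      by_cases hij : i = j
      · subst hij; simp
      · rw [Pi.single_eq_of_ne (Ne.symm hij)]; simp [hij]

theorem apply_munit {a : HDual k H} (ha : a ∈ charAlg k H) (l : Fin n) :
    a (munit φ l 0 0) = (a * S (HDual.of (irrChar φ l))) d.L := by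
  conv_rhs => rw [eq_sum_of_mem φ ha, Finset.sum_mul, HDual.sum_apply]
  simp only [smul_mul_assoc, HDual.smul_apply, d.irrChar_orthogonal φ]
  simp

theorem eq_sum_irr {a : HDual k H} (ha : a ∈ charAlg k H) :
    a = ∑ l, (a * S (HDual.of (irrChar φ l))) d.L • HDual.of (irrChar φ l) := by
  conv_lhs => rw [eq_sum_of_mem φ ha]
  simp only [d.apply_munit φ ha]

theorem eq_sum_antipode_irr {a : HDual k H} (ha : a ∈ charAlg k H) :
    a = ∑ l, (a * HDual.of (irrChar φ l)) d.L • S (HDual.of (irrChar φ l)) := by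
  have h1 := congrArg S (d.eq_sum_irr φ (antipode_mem_charAlg ha))
  rw [d.dual_antipode_antipode, map_sum] at h1
  conv_lhs => rw [h1]
  refine Finset.sum_congr rfl fun l _ => ?_
  rw [map_smul, ← antipode_mul_antidistrib, d.antipode_apply_L, d.mul_apply_L_comm]

theorem sum_casimir {e : HDual k H} (he : e ∈ charAlg k H) (he0 : e ≠ 0) (hee : e * e = e)
    (hprim : ∀ c ∈ charAlg k H, ∃ μ : k, e * c * e = μ • e) (x y : H) :
    ∑ i, ((HDual.of (irrChar φ i) : HDual k H) * e) x * (S (HDual.of (irrChar φ i) : HDual k H) * e) y =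
      (e d.L)⁻¹ * (e x * e y) := by
  have hL : e d.L ≠ 0 := fun h => by
    have := d.apply_L_eq hee
    rw [h, mul_zero] at this
    exact d.finrank_range_ne_zero he0 (by exact_mod_cast this.symm)
  have h1 : ∀ c ∈ charAlg k H, e * c * e = ((c * e) d.L * (e d.L)⁻¹) • e := fun c hc => by
    obtain ⟨μ, hμ⟩ := hprim c hc
    have := congrArg (fun f : HDual k H => f d.L) hμ
    simp only [HDual.smul_apply] at this
    rw [mul_assoc, d.mul_apply_L_comm, mul_assoc, hee] at this
    rw [hμ, this, mul_assoc, mul_inv_cancel₀ hL, mul_one]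
  have hC := irrChar_mem (k := k) φ
  have h2 : ∀ i, (S (HDual.of (irrChar φ i) : HDual k H) * e) y =
      ∑ j, (e * HDual.of (irrChar φ j) * S (HDual.of (irrChar φ i))) d.L * (S (HDual.of (irrChar φ j) : HDual k H)) y := fun i => by
    conv_lhs => rw [d.eq_sum_antipode_irr φ (mul_mem (antipode_mem_charAlg (hC i)) he)]
    rw [HDual.sum_apply]
    refine Finset.sum_congr rfl fun j _ => ?_
    rw [HDual.smul_apply, mul_assoc, d.mul_apply_L_comm]
  simp only [h2, Finset.mul_sum]
  rw [Finset.sum_comm]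
  have h3 : ∀ j, (e * HDual.of (irrChar φ j) * e) x = ∑ i, ((HDual.of (irrChar φ i) : HDual k H) * e) x *
      (e * HDual.of (irrChar φ j) * S (HDual.of (irrChar φ i))) d.L := fun j => by
    conv_lhs => rw [d.eq_sum_irr φ (mul_mem he (hC j)), Finset.sum_mul, HDual.sum_apply]
    exact Finset.sum_congr rfl fun i _ => by rw [smul_mul_assoc, HDual.smul_apply, mul_comm]
  simp only [← mul_assoc, ← Finset.sum_mul, ← h3]
  have h4 := congrArg (fun f : HDual k H => f y) (d.eq_sum_antipode_irr φ he)
  simp only [HDual.sum_apply] at h4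
  rw [h4, Finset.mul_sum]
  refine Finset.sum_congr rfl fun j _ => ?_
  rw [h1 _ (hC j), HDual.smul_apply, HDual.smul_apply, d.mul_apply_L_comm]
  ring

omit d in
theorem irrChar_mul_irrChar_munit (i j l : Fin n) :
    ∃ s : ℕ, ((HDual.of (irrChar φ i) : HDual k H) * HDual.of (irrChar φ j)) (munit φ l 0 0) = s := by
  obtain ⟨s, hs⟩ := trace_mul_trace_of_idem (k := k) (LinearMap.proj i ∘ₗ φ.toLinearMap) (LinearMap.proj j ∘ₗ φ.toLinearMap)
    (fun x y => by simp) (fun x y => by simp) (munit_idem φ l 0)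
  exact ⟨s, by rw [← hs, HDual.mul_apply]; rfl⟩

omit d in
theorem antipode_irrChar_mul_irrChar_munit (i j l : Fin n) :
    ∃ s : ℕ, (S (HDual.of (irrChar φ i) : HDual k H) * HDual.of (irrChar φ j)) (munit φ l 0 0) = s := by
  obtain ⟨s, hs⟩ := trace_mul_trace_of_idem (k := k)
    ((Matrix.transposeLinearEquiv (Fin (r i)) (Fin (r i)) k k).toLinearMap ∘ₗ LinearMap.proj i ∘ₗ φ.toLinearMap ∘ₗ S)
    (LinearMap.proj j ∘ₗ φ.toLinearMap)
    (fun x y => by simp [antipode_mul_antidistrib, Matrix.transpose_mul]) (fun x y => by simp) (munit_idem φ l 0)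
  refine ⟨s, ?_⟩
  rw [← hs, HDual.mul_apply]
  refine sw_congr fun x y => ?_
  rw [HDual.antipode_apply]
  simp [irrChar_apply]

/-- The class equation: the rank of a primitive idempotent of the character algebra divides the dimension. -/
theorem finrank_range_dvd {e : HDual k H} (he : e ∈ charAlg k H) (he0 : e ≠ 0) (hee : e * e = e)
    (hprim : ∀ c ∈ charAlg k H, ∃ μ : k, e * c * e = μ • e) :
    Module.finrank k (LinearMap.range (rho e)) ∣ Module.finrank k H := by
  have := d.isSemisimpleRing
  obtain ⟨n, r, hr, ⟨φ⟩⟩ := IsSemisimpleRing.exists_algEquiv_pi_matrix_of_isAlgClosed k H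
  have hL := d.apply_L_eq hee
  have hn := finrank_ne_zero_of_hopf (k := k) (H := H)
  have hγ : (e d.L)⁻¹ = (Module.finrank k H : k) / (Module.finrank k (LinearMap.range (rho e)) : k) := by
    have h0 : e d.L ≠ 0 := fun h => by
      rw [h, mul_zero] at hL
      exact d.finrank_range_ne_zero he0 (by exact_mod_cast hL.symm)
    rw [← hL]; field_simp
  refine dvd_of_isIntegral_div (k := k) (d.finrank_range_ne_zero he0) ?_
  rw [← hγ]
  choose A hA using irrChar_mul_irrChar_munit (k := k) φ
  choose B hB using antipode_irrChar_mul_irrChar_munit (k := k) φ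
  refine isIntegral_of_mulVec (m := Fin n × Fin n) (fun s t => ∑ i, (A i t.1 s.1 : ℤ) * (B i t.2 s.2 : ℤ))
    (v := fun s => e (munit φ s.1 0 0) * e (munit φ s.2 0 0)) ?_ ?_
  · intro h
    refine he0 ?_
    rw [eq_sum_of_mem φ he]
    refine Finset.sum_eq_zero fun i _ => ?_
    rw [mul_self_eq_zero.1 (congrFun h (i, i)), zero_smul]
  · funext s
    have hs := d.sum_casimir φ he he0 hee hprim (munit φ s.1 0 0) (munit φ s.2 0 0)
    rw [Pi.smul_apply, smul_eq_mul, ← hs, Matrix.mulVec, dotProduct]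
    have h1 : ∀ (a : HDual k H) (x : H), (a * e) x = ∑ j, (a * HDual.of (irrChar φ j)) x * e (munit φ j 0 0) := fun a x => by
      conv_lhs => rw [eq_sum_of_mem φ he, Finset.mul_sum, HDual.sum_apply]
      exact Finset.sum_congr rfl fun j _ => by rw [mul_smul_comm, HDual.smul_apply, mul_comm]
    simp only [h1, Finset.sum_mul_sum, hA, hB]
    rw [Fintype.sum_prod_type]
    have h2 : ∀ t : Fin n × Fin n, (Matrix.map (fun s t : Fin n × Fin n => ∑ i, (A i t.1 s.1 : ℤ) * (B i t.2 s.2 : ℤ))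
        (Int.castRingHom k)) s t = ∑ i, (A i t.1 s.1 : k) * (B i t.2 s.2 : k) := fun t => by
      change Int.castRingHom k (∑ i, (A i t.1 s.1 : ℤ) * (B i t.2 s.2 : ℤ)) = _
      simp
    simp only [h2, Finset.sum_mul]
    rw [Finset.sum_congr rfl fun x _ => Finset.sum_comm, Finset.sum_comm]
    exact Finset.sum_congr rfl fun i _ => Finset.sum_congr rfl fun x _ => Finset.sum_congr rfl fun y _ => by ring

end SSDatum
end ClassEq

section KZ
variable {k H : Type*} [Field k] [CharZero k] [IsAlgClosed k] [Ring H] [HopfAlgebra k H] [FiniteDimensional k H]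

local notation "S" => antipode k

theorem HDual.mul_apply_one (f f' : HDual k H) : (f * f') 1 = f 1 * f' 1 := by
  rw [HDual.mul_apply, sw_one (fun x y => f x * f' y)]

namespace SSDatum
variable (d : SSDatum k H)
include d

theorem isSemisimpleRing_charAlg : IsSemisimpleRing (charAlg k H) := by
  refine isSemisimpleRing_of_nondegenerate (k := k) (fun f : charAlg k H => (f : HDual k H) d.L) (fun a ha => ?_) fun a ha => ?_
  · have h1 : IsNilpotent (rho (a : HDual k H)) := (ha.map (charAlg k H).val).map rho
    have h2 := (LinearMap.isNilpotent_trace_of_isNilpotent h1).eq_zero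
    rw [d.trace_rho] at h2
    exact (mul_eq_zero.1 h2).resolve_left finrank_ne_zero_of_hopf
  · have := d.isSemisimpleRing
    obtain ⟨n, r, hr, ⟨φ⟩⟩ := IsSemisimpleRing.exists_algEquiv_pi_matrix_of_isAlgClosed k H
    apply Subtype.ext
    rw [d.eq_sum_irr φ a.2]
    refine Finset.sum_eq_zero fun l _ => ?_
    rw [d.mul_apply_L_comm, show (S (HDual.of (irrChar φ l)) * (a : HDual k H)) d.L = 0 from
      ha ⟨_, antipode_mem_charAlg (irrChar_mem φ l)⟩, zero_smul]

/-- A trace function idempotent of rank one comes from a central group-like element. -/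
theorem exists_groupLike_of_rank_one {e : HDual k H} (he : e ∈ charAlg k H) (hee : e * e = e)
    (hr : Module.finrank k (LinearMap.range (rho e)) = 1) :
    ∃ u : H, IsGroupLikeElem k u ∧ (∀ h, u * h = h * u) ∧ (∀ f, f * e = f u • e) ∧ e u = 1 := by
  obtain ⟨⟨v, hv⟩, hv0, hv1⟩ := finrank_eq_one_iff'.1 hr
  have hc : ∀ h, ∃ c : k, c • v = rho e h := fun h => by
    obtain ⟨c, hc⟩ := hv1 ⟨rho e h, LinearMap.mem_range_self _ h⟩
    exact ⟨c, congrArg Subtype.val hc⟩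
  choose c hc using hc
  have hec : ∀ h, e h = c h * counit (R := k) v := fun h => by
    rw [← counit_rho, ← hc, map_smul, smul_eq_mul]
  have he0 : ∃ h, e h ≠ 0 := by
    by_contra! hcon
    have : e = 0 := by ext h; rw [hcon]; rfl
    obtain ⟨w, hw⟩ := hv
    apply hv0
    apply Subtype.ext
    change v = 0
    rw [← hw, this, map_zero]; rfl
  obtain ⟨h0, hh0⟩ := he0
  have hεv : counit (R := k) v ≠ 0 := fun h => hh0 (by rw [hec, h, mul_zero])
  obtain ⟨u, hu⟩ : ∃ u : H, u = (counit (R := k) v)⁻¹ • v := ⟨_, rfl⟩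
  have hrho : ∀ h, rho e h = e h • u := fun h => by
    rw [hu, smul_smul, hec, mul_assoc, mul_inv_cancel₀ hεv, mul_one, hc]
  have hmul : ∀ f : HDual k H, f * e = f u • e := fun f => by
    ext h
    rw [← apply_rho, hrho, map_smul, HDual.smul_apply, smul_eq_mul, mul_comm]
  have hεu : counit (R := k) u = 1 := by rw [hu, map_smul, smul_eq_mul, inv_mul_cancel₀ hεv]
  have hu0 : u ≠ 0 := fun h => by simp [h] at hεu
  have hug : IsGroupLikeElem k u := by
    refine isGroupLikeElem_of_rho hu0 fun f => HDual.eq_of_forall (k := k) fun f' => ?_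
    have h1 := hmul (f' * f)
    rw [mul_assoc, hmul f, mul_smul_comm, hmul f', smul_smul] at h1
    have h2 := congrArg (fun t : HDual k H => t h0) h1
    simp only [HDual.smul_apply] at h2
    rw [apply_rho, map_smul, smul_eq_mul, mul_right_cancel₀ hh0 h2]
  have heu : e u = 1 := by
    have h2 := congrArg (fun t : HDual k H => t h0) (hmul e)
    simp only [HDual.smul_apply, hee] at h2
    exact mul_right_cancel₀ hh0 (h2.symm.trans (one_mul _).symm)
  have hSu : S u * u = 1 := hug.antipode_mul_cancel
  have huS : u * S u = 1 := hug.mul_antipode_cancel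
  refine ⟨u, hug, ?_, hmul, heu⟩
  have h1 : ∀ (f : HDual k H), f * precompMulLeft u e = f 1 • precompMulLeft u e := fun f => by
    ext h
    have h2 := congrArg (fun t : HDual k H => t (u * h)) (hmul (precompMulLeft (S u) f))
    simp only [HDual.smul_apply, HDual.mul_apply, precompMulLeft_apply, hSu] at h2
    rw [sw_mul u h (fun x y => f (S u * x) * e y),
      sw_of_comul u u u hug.comul_eq_tmul_self (fun a b => sw k h (fun x y => f (S u * (a * x)) * e (b * y)))] at h2
    simp only [← mul_assoc, hSu, one_mul] at h2
    rw [HDual.mul_apply, HDual.smul_apply]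
    exact h2
  have h3 : ∀ y, (Module.finrank k H : k) * e y = regChar k H (S u * y) := fun y => by
    have h4 := h1 (regChar k H)
    rw [d.reg_mul, regChar_one] at h4
    have h5 := congrArg (fun t : HDual k H => t (S u * y)) h4
    simp only [HDual.smul_apply, precompMulLeft_apply, ← mul_assoc, huS, one_mul, mul_one, heu] at h5
    exact h5.symm
  have h4 : ∀ a, S u * a = a * S u := fun a => by
    rw [← sub_eq_zero]
    refine d.nondeg _ fun b => ?_
    rw [mul_sub, map_sub, sub_eq_zero, ← mul_assoc, ← mul_assoc, mul_assoc b, regChar_comm b, regChar_comm (b * a), mul_assoc,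
      ← h3, ← h3, he]
  intro h
  calc u * h = u * (h * S u) * u := by rw [mul_assoc, mul_assoc h, hSu, mul_one]
    _ = h * u := by rw [← h4, ← mul_assoc, huS, one_mul]

/-- A central idempotent of the character algebra whose rank is divisible by `p` detects a central group-like element. -/
theorem exists_central_groupLike {p : ℕ} (hp : p.Prime) (hdim : Module.finrank k H = p ^ 2) {f : HDual k H}
    (hfC : f ∈ charAlg k H) (hfc : ∀ x ∈ charAlg k H, f * x = x * f) (hff : f * f = f) (hf1 : f 1 = 1)
    (hdvd : p ∣ Module.finrank k (LinearMap.range (rho f))) :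
    ∃ u : H, IsGroupLikeElem k u ∧ u ≠ 1 ∧ (∀ h, u * h = h * u) ∧ f u = 1 := by
  have := d.isSemisimpleRing_charAlg
  obtain ⟨ι, _, e', h0', hid', horth', hsum', hprim'⟩ := exists_primitive_family (k := k) (A := charAlg k H)
  obtain ⟨e, he⟩ : ∃ e : ι → HDual k H, ∀ i, e i = e' i := ⟨_, fun i => rfl⟩
  have hC : ∀ i, e i ∈ charAlg k H := fun i => he i ▸ (e' i).2
  have h0 : ∀ i, e i ≠ 0 := fun i h => h0' i (Subtype.ext (by rw [← he, h]; rfl))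
  have hid : ∀ i, e i * e i = e i := fun i => by rw [he]; exact congrArg Subtype.val (hid' i)
  have horth : ∀ i j, i ≠ j → e i * e j = 0 := fun i j h => by rw [he, he]; exact congrArg Subtype.val (horth' i j h)
  have hsum : ∑ i, e i = 1 := by
    have := congrArg (charAlg k H).val hsum'
    rw [map_sum, map_one] at this
    rw [← this]; exact Finset.sum_congr rfl fun i _ => he i
  have hprim : ∀ i, ∀ c ∈ charAlg k H, ∃ μ : k, e i * c * e i = μ • e i := fun i c hc => by
    obtain ⟨μ, hμ⟩ := hprim' i ⟨c, hc⟩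
    exact ⟨μ, by rw [he]; exact congrArg Subtype.val hμ⟩
  have hcase : ∀ i, e i * f = e i ∨ e i * f = 0 := fun i => by
    obtain ⟨μ, hμ⟩ := hprim i f hfC
    rw [mul_assoc, hfc _ (hC i), ← mul_assoc, hid] at hμ
    have h1 : μ * μ = μ := by
      have : e i * f * f = e i * f := by rw [mul_assoc, hff]
      rw [hμ, smul_mul_assoc, hμ, smul_smul] at this
      exact smul_left_injective k (h0 i) this
    rcases (mul_eq_zero.1 (show μ * (μ - 1) = 0 by rw [mul_sub, h1, mul_one, sub_self])).imp_right sub_eq_zero.1 with h | h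
    · right; rw [hμ, h, zero_smul]
    · left; rw [hμ, h, one_smul]
  set R : HDual k H → ℕ := fun e => Module.finrank k (LinearMap.range (rho e)) with hR
  set I := Finset.univ.filter fun i => e i * f = e i with hI
  have hrank : R f = ∑ i ∈ I, R (e i) := by
    have : (R f : k) = ((∑ i ∈ I, R (e i) : ℕ) : k) := by
      rw [Nat.cast_sum, hR, ← d.apply_L_eq hff]
      have h1 : f = ∑ i ∈ I, e i := by
        conv_lhs => rw [← one_mul f, ← hsum, Finset.sum_mul]
        rw [hI, Finset.sum_filter]
        refine Finset.sum_congr rfl fun i _ => ?_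
        split_ifs with h
        · exact h
        · exact (hcase i).resolve_left h
      conv_lhs => rw [h1, HDual.sum_apply, Finset.mul_sum]
      exact Finset.sum_congr rfl fun i _ => d.apply_L_eq (hid i)
    exact_mod_cast this
  obtain ⟨j, hj⟩ : ∃ j, e j 1 ≠ 0 := by
    by_contra! hcon
    have h1 := congrArg (fun t : HDual k H => t 1) hsum
    simp only [HDual.sum_apply, hcon, HDual.one_apply, Bialgebra.counit_one] at h1
    simp at h1
  have hj1 : e j 1 = 1 := by
    have h1 := congrArg (fun t : HDual k H => t 1) (hid j)
    simp only [HDual.mul_apply_one] at h1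
    exact mul_right_cancel₀ hj (h1.trans (one_mul _).symm)
  have hjI : j ∈ I := by
    rw [hI, Finset.mem_filter]
    refine ⟨Finset.mem_univ _, (hcase j).resolve_right fun h => ?_⟩
    have h1 := congrArg (fun t : HDual k H => t 1) h
    simp only [HDual.mul_apply_one, hf1, hj1, HDual.zero_apply] at h1
    simp at h1
  have hzero : ∀ i, i ≠ j → e i 1 = 0 := fun i hi => by
    have h1 := congrArg (fun t : HDual k H => t 1) (horth i j hi)
    simpa only [HDual.mul_apply_one, hj1, HDual.zero_apply, mul_one] using h1
  have hRj : R (e j) = 1 := by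
    obtain ⟨μ, hμ⟩ := hprim j _ regChar_mem_charAlg
    rw [d.mul_reg, hj1, one_smul, d.reg_mul, hj1, one_smul] at hμ
    have hμ1 := congrArg (fun t : HDual k H => t 1) hμ
    simp only [regChar_one, HDual.smul_apply, hj1, mul_one] at hμ1
    have h1 : rho (e j) = (HDual.of.symm (e j)).smulRight 1 := by
      refine LinearMap.ext fun h => HDual.eq_of_forall (k := k) fun f' => ?_
      rw [apply_rho, LinearMap.smulRight_apply, map_smul, smul_eq_mul, HDual.of_symm_apply]
      have h2 := congrArg (fun t : HDual k H => t h) (d.mul_reg f')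
      simp only [hμ, mul_smul_comm, HDual.smul_apply, ← hμ1] at h2
      rw [mul_left_comm] at h2
      rw [mul_left_cancel₀ finrank_ne_zero_of_hopf h2, mul_comm]
    have h2 : (R (e j) : k) = 1 := by
      rw [hR, ← d.apply_L_eq (hid j), ← d.trace_rho, h1, LinearMap.trace_smulRight]
      exact hj1
    exact_mod_cast h2
  obtain ⟨i, hiI, hij, hRi⟩ : ∃ i ∈ I, i ≠ j ∧ R (e i) = 1 := by
    by_contra! hcon
    have h1 : ∀ i ∈ I.erase j, p ∣ R (e i) := fun i hi => by
      have h2 : R (e i) ∣ p ^ 2 := hdim ▸ d.finrank_range_dvd (hC i) (h0 i) (hid i) (hprim i)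
      obtain ⟨m, -, hm⟩ := (Nat.dvd_prime_pow hp).1 h2
      have h3 := hcon i (Finset.mem_of_mem_erase hi) (Finset.ne_of_mem_erase hi)
      rw [hm] at h3 ⊢
      exact dvd_pow_self p fun h => h3 (by rw [h, pow_zero])
    have h2 := Finset.dvd_sum h1
    have h3 : p ∣ R f := hdvd
    rw [hrank, ← Finset.add_sum_erase _ _ hjI, hRj] at h3
    exact hp.one_lt.ne' (Nat.dvd_one.1 ((Nat.dvd_add_left h2).1 h3))
  obtain ⟨u, hug, huc, hmul, heu⟩ := d.exists_groupLike_of_rank_one (hC i) (hid i) hRi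
  refine ⟨u, hug, fun h => ?_, huc, ?_⟩
  · rw [h, hzero i hij] at heu; exact zero_ne_one heu
  · have h1 := hmul f
    rw [hfc _ (hC i), (Finset.mem_filter.1 hiI).2] at h1
    have h2 := congrArg (fun t : HDual k H => t u) h1
    simp only [HDual.smul_apply, heu, mul_one] at h2
    exact h2.symm

end SSDatum
end KZ

section Graded
variable {k A : Type*} [Field k] [CharZero k] [IsAlgClosed k] [Ring A] [Algebra k A] {p : ℕ}

/-- A strongly graded algebra over a cyclic group whose degree-zero part is one-dimensional is commutative. -/
theorem mul_comm_of_graded (hp : 0 < p) (T : A →ₐ[k] A) (hT : (T.toLinearMap : Module.End k A) ^ p = 1) {z : k}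
    (hz : IsPrimitiveRoot z p) {e : A} (hee : e * e = e) (hec : ∀ a, e * a = a * e)
    (he1 : ∀ h, T h = h → ∃ c : k, e * h = c • e) {x y : A} (hx : T x = z • x) (hy : T y = z⁻¹ • y)
    (hxy : e * (x * y) = e) (a b : A) : e * (a * b) = e * (b * a) := by
  have hz0 : z ≠ 0 := rootOfUnity_ne_zero hp hz.pow_eq_one
  have hyx : e * (y * x) = e := by
    obtain ⟨c, hc⟩ := he1 (y * x) (by rw [map_mul, hx, hy, smul_mul_smul_comm, inv_mul_cancel₀ hz0, one_smul])
    have h1 : c • e = e := by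
      calc c • e = x * (e * (y * x)) * y := by rw [hc, mul_smul_comm, smul_mul_assoc, ← hec, mul_assoc, hxy]
        _ = (e * (x * y)) * (x * y) := by rw [← mul_assoc, ← hec]; simp only [mul_assoc]
        _ = e := by rw [hxy, hxy]
    rw [hc, h1]
  have hyxi : ∀ i : ℕ, e * (y ^ i * x ^ i) = e := fun i => by
    induction i with
    | zero => simp
    | succ i ih =>
      calc e * (y ^ (i + 1) * x ^ (i + 1)) = y ^ i * (e * (y * x)) * x ^ i := by
            rw [pow_succ, pow_succ', ← mul_assoc (y ^ i) e, ← hec]; simp only [mul_assoc]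
        _ = e := by rw [hyx, ← hec, mul_assoc, ih]
  have hTx : ∀ i : ℕ, T (y ^ i) = (z⁻¹) ^ i • y ^ i := fun i => by rw [map_pow, hy, smul_pow]
  have hpoly : ∀ a, ∃ q : Polynomial k, e * a = e * Polynomial.aeval x q := fun a => by
    have h1 : ∀ ζ : k, ζ ^ p = 1 → ∃ q : Polynomial k, e * cproj p (T.toLinearMap : Module.End k A) ζ a = e * Polynomial.aeval x q := by
      intro ζ hζ
      obtain ⟨m, hm⟩ : ∃ m, m = cproj p (T.toLinearMap : Module.End k A) ζ a := ⟨_, rfl⟩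
      have hTm : T m = ζ • m := by
        rw [hm]
        exact congrArg (fun f : Module.End k A => f a) (mul_cproj hp hT hζ)
      have : NeZero p := ⟨hp.ne'⟩
      obtain ⟨i, -, hi⟩ := hz.eq_pow_of_pow_eq_one hζ
      obtain ⟨c, hc⟩ := he1 (m * y ^ i) (by
        rw [map_mul, hTm, hTx, smul_mul_smul_comm, ← hi, ← mul_pow, mul_inv_cancel₀ hz0, one_pow, one_smul])
      refine ⟨Polynomial.C c * Polynomial.X ^ i, ?_⟩
      rw [← hm, map_mul, Polynomial.aeval_C, map_pow, Polynomial.aeval_X, ← Algebra.smul_def, mul_smul_comm, ← smul_mul_assoc, ← hc]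
      calc e * m = m * (e * (y ^ i * x ^ i)) := by rw [hyxi, hec]
        _ = _ := by rw [← mul_assoc m, ← hec]; simp only [mul_assoc]
    choose! q hq using h1
    refine ⟨∑ ζ ∈ rou k p, q ζ, ?_⟩
    have h2 := congrArg (fun f : Module.End k A => f a) (sum_cproj (k := k) hp (T.toLinearMap : Module.End k A))
    simp only [LinearMap.sum_apply, Module.End.one_apply] at h2
    conv_lhs => rw [← h2]
    rw [Finset.mul_sum, map_sum, Finset.mul_sum]
    exact Finset.sum_congr rfl fun ζ hζ => hq ζ ((mem_rou hp).1 hζ)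
  have hmul : ∀ a b, e * (a * b) = (e * a) * (e * b) := fun a b => by
    rw [← mul_assoc (e * a), mul_assoc e a e, ← hec a, ← mul_assoc e e, hee, mul_assoc]
  obtain ⟨q, hq⟩ := hpoly a
  obtain ⟨q', hq'⟩ := hpoly b
  rw [hmul, hmul, hq, hq', ← hmul, ← hmul, ← map_mul, ← map_mul, mul_comm q]

end Graded

section Comm
variable {k H : Type*} [Field k] [CharZero k] [IsAlgClosed k] [Ring H] [HopfAlgebra k H] [FiniteDimensional k H]
variable {p : ℕ} (hp : p.Prime) (hdim : Module.finrank k H = p ^ 2)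

local notation "S" => antipode k

theorem mul_comm_of_span_pow {g : H} (h : Submodule.span k (Set.range fun i : ℕ => g ^ i) = ⊤) (a b : H) : a * b = b * a := by
  have h1 : ∀ a, a ∈ Algebra.adjoin k {g} := fun a => by
    have ha : a ∈ Submodule.span k (Set.range fun i : ℕ => g ^ i) := h ▸ Submodule.mem_top
    refine Submodule.span_le (p := Subalgebra.toSubmodule (Algebra.adjoin k {g})) |>.2 ?_ ha
    rintro _ ⟨i, rfl⟩
    exact pow_mem (Algebra.self_mem_adjoin_singleton k g) i
  have h2 : ∀ a, ∃ q : Polynomial k, Polynomial.aeval g q = a := fun a => by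
    have := h1 a
    rwa [Algebra.adjoin_singleton_eq_range_aeval] at this
  obtain ⟨q, rfl⟩ := h2 a
  obtain ⟨r, rfl⟩ := h2 b
  rw [← map_mul, mul_comm, map_mul]

theorem IsGroupLikeElem.mul_apply {u : H} (hu : IsGroupLikeElem k u) (f f' : HDual k H) : (f * f') u = f u * f' u := by
  rw [HDual.mul_apply, sw_of_comul u u u hu.comul_eq_tmul_self (fun x y => f x * f' y)]

namespace SSDatum
variable (d : SSDatum k H)

theorem groupLike_apply_L {β : HDual k H} (hβ : IsGroupLikeElem k β) (h1 : β ≠ 1) : β d.L = 0 := by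
  by_contra h0
  refine h1 (HDual.ext fun h => ?_)
  have := congrArg β (d.mul_L h)
  rw [HDual.mul_of_isGroupLikeElem hβ, map_smul, smul_eq_mul] at this
  rw [HDual.one_apply, mul_right_cancel₀ h0 this]

theorem cproj_apply_L {β : HDual k H} (hβ : IsGroupLikeElem k β) (hp : 0 < p) (ho : orderOf β = p) (z : k) :
    (cproj p β z) d.L = (p : k)⁻¹ := by
  rw [cproj, HDual.smul_apply, HDual.sum_apply, Finset.sum_eq_single 0]
  · rw [pow_zero, HDual.one_apply, d.counit_L, mul_one]
  · intro i hi h0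
    rw [smul_pow, HDual.smul_apply, d.groupLike_apply_L hβ.pow, mul_zero]
    intro h
    exact absurd (Nat.le_of_dvd (Nat.pos_of_ne_zero h0) (orderOf_dvd_of_pow_eq_one h)) (by rw [ho]; exact not_le.2 (Finset.mem_range.1 hi))
  · intro h; exact absurd (Finset.mem_range.2 hp) h

omit [CharZero k] [IsAlgClosed k] in
theorem rho_eq_lam {f : HDual k H} (hf : ∀ f', f * f' = f' * f) (h : H) : rho f h = lam f h :=
  HDual.eq_of_forall (k := k) fun f' => by rw [apply_rho, apply_lam, hf]

theorem rho_antipode_of_eigen {β : HDual k H} (hβ : IsGroupLikeElem k β) (hc : ∀ f', β * f' = f' * β) {z : k} (hz : z ≠ 0) {v : H}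
    (hv : rho β v = z • v) : rho β (S v) = z⁻¹ • S v := by
  have h1 : rho β (S v) = S (lam (S β) v) := by
    rw [rho_apply, sw_antipode v (fun x y => β y • x), lam_apply, map_sw]
    exact sw_congr fun x y => by rw [map_smul, HDual.antipode_apply]
  have h2 : lam (S β) (lam β v) = v := by
    rw [← lam_mul, hβ.mul_antipode_cancel, lam_one]
  rw [← rho_eq_lam hc, hv, map_smul] at h2
  rw [h1]
  conv_rhs => rw [← h2, map_smul, smul_smul, inv_mul_cancel₀ hz, one_smul]

theorem sw_lam (f : HDual k H) (h : H) {M : Type*} [AddCommGroup M] [Module k M] (F : H → H → M)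
    (h1 : ∀ y, IsLinearMap k (fun x => F x y)) (h2 : ∀ x, IsLinearMap k (fun y => F x y)) :
    sw k (lam f h) F = sw k h (fun x y => F (lam f x) y) := by
  rw [lam_apply, IsLinearMap.map_sw (L := fun t => sw k t F) (IsLinearMap.sw_left IsLinearMap.id_fun F h1 h2)]
  calc _ = sw k h (fun u x => sw k x (fun v w => f u • F v w)) := sw_congr fun u x => by
          rw [sw_smul_left (f u) x F h1 h2, smul_sw]
    _ = sw k h (fun x w => sw k x (fun u v => f u • F v w)) :=
          (sw_assoc h (fun u v w => f u • F v w) (fun _ _ => by fun_prop) (fun _ w => (h1 w).const_smul_fun _)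
            (fun _ v => (h2 v).const_smul_fun _)).symm
    _ = _ := sw_congr fun x w => by
          rw [lam_apply, (h1 w).map_sw]
          exact sw_congr fun u v => ((h1 w).map_smul _ _).symm

theorem sw_rho (f : HDual k H) (h : H) {M : Type*} [AddCommGroup M] [Module k M] (F : H → H → M)
    (h1 : ∀ y, IsLinearMap k (fun x => F x y)) (h2 : ∀ x, IsLinearMap k (fun y => F x y)) :
    sw k (rho f h) F = sw k h (fun x y => F x (rho f y)) := by
  rw [rho_apply, IsLinearMap.map_sw (L := fun t => sw k t F) (IsLinearMap.sw_left IsLinearMap.id_fun F h1 h2)]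
  calc _ = sw k h (fun x w => sw k x (fun u v => f w • F u v)) := sw_congr fun x w => by
          rw [sw_smul_left (f w) x F h1 h2, smul_sw]
    _ = sw k h (fun u x => sw k x (fun v w => f w • F u v)) :=
          sw_assoc h (fun u v w => f w • F u v) (fun v _ => (h1 v).const_smul_fun _) (fun u _ => (h2 u).const_smul_fun _)
            (fun _ _ => by fun_prop)
    _ = _ := sw_congr fun u x => by
          rw [rho_apply, (h2 u).map_sw]
          exact sw_congr fun v w => ((h2 u).map_smul _ _).symm

include d hp hdim

theorem mul_comm_of_central {β : HDual k H} (hβ : IsGroupLikeElem k β) (ho : orderOf β = p) (hβc : ∀ f, β * f = f * β)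
    {u : H} (hu : IsGroupLikeElem k u) (huo : orderOf u = p) (huc : ∀ h, u * h = h * u) (hβu : β u = 1) (a b : H) :
    a * b = b * a := by
  have hβp : β ^ p = 1 := ho ▸ pow_orderOf_eq_one β
  have hup : u ^ p = 1 := huo ▸ pow_orderOf_eq_one u
  have hTp : (rho β : Module.End k H) ^ p = 1 := by rw [← map_pow, hβp, map_one]
  have hcc : ∀ (z : k) (f : HDual k H), cproj p β z * f = f * cproj p β z := fun z f => cproj_commute (hβc f) z
  have hH1 : ∀ h, rho β h = h → h ∈ Submodule.span k (Set.range fun i : Fin p => u ^ (i : ℕ)) := by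
    have hpk : (p : k) ≠ 0 := Nat.cast_ne_zero.2 hp.ne_zero
    have hli : LinearIndependent k (fun i : Fin p => u ^ (i : ℕ)) :=
      (linearIndep_groupLikeVal (R := k) (A := H)).comp
        (fun i : Fin p => (⟨u ^ (i : ℕ), hu.pow⟩ : GroupLike k H)) (fun i j hij =>
          Fin.ext (pow_injOn_Iio_orderOf (Set.mem_Iio.2 (huo.symm ▸ i.2)) (Set.mem_Iio.2 (huo.symm ▸ j.2)) (congrArg GroupLike.val hij)))
    have hrk : Module.finrank k (LinearMap.range (rho (cproj p β (1 : k)))) = p := by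
      have h1 := d.apply_L_eq (cproj_idem hp.pos hβp (one_pow p : (1 : k) ^ p = 1))
      rw [d.cproj_apply_L hβ hp.pos ho, hdim, Nat.cast_pow, pow_two, mul_assoc, mul_inv_cancel₀ hpk, mul_one] at h1
      exact_mod_cast h1.symm
    have hfix : ∀ h, rho β h = h → h ∈ LinearMap.range (rho (cproj p β (1 : k))) := fun h hh => by
      refine ⟨h, ?_⟩
      rw [cproj_map, cproj_eigen hp.pos (one_pow p) (one_pow p) (by rw [hh, one_smul]), if_pos rfl]
    have heq : Submodule.span k (Set.range fun i : Fin p => u ^ (i : ℕ)) = LinearMap.range (rho (cproj p β (1 : k))) := by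
      refine Submodule.eq_of_le_of_finrank_eq (Submodule.span_le.2 ?_) ?_
      · rintro _ ⟨i, rfl⟩
        refine hfix _ ?_
        have hpow : ∀ i : ℕ, β (u ^ i) = 1 := fun i => by
          induction i with
          | zero => rw [pow_zero, HDual.one_of_isGroupLikeElem hβ]
          | succ i ih => rw [pow_succ, HDual.mul_of_isGroupLikeElem hβ, ih, hβu, one_mul]
        rw [(hu.pow (n := (i : ℕ))).rho_eq, hpow, one_smul]
      · rw [hrk, finrank_span_eq_card hli, Fintype.card_fin]
    exact fun h hh => heq ▸ hfix h hh
  obtain ⟨z, hz⟩ := exists_prim k hp.pos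
  have hz0 : z ≠ 0 := rootOfUnity_ne_zero hp.pos hz.pow_eq_one
  have key : ∀ w ∈ rou k p, cproj p u w * (a * b) = cproj p u w * (b * a) := by
    intro w hw
    rw [mem_rou hp.pos] at hw
    obtain ⟨e, he⟩ : ∃ e, e = cproj p u w := ⟨_, rfl⟩
    rw [← he]
    have hee : e * e = e := he ▸ cproj_idem hp.pos hup hw
    have hec : ∀ a, e * a = a * e := fun a => he ▸ cproj_commute (huc a) w
    have hue : ∀ i : ℕ, e * u ^ i = w ^ i • e := fun i => by
      induction i with
      | zero => simp
      | succ i ih =>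
        rw [pow_succ, ← mul_assoc, ih, smul_mul_assoc, hec, he, mul_cproj hp.pos hup hw, smul_smul, ← pow_succ]
    have he1 : ∀ h, rho β h = h → ∃ c : k, e * h = c • e := fun h hh => by
      have hm := hH1 h hh
      clear hh
      induction hm using Submodule.span_induction with
      | mem x hx => obtain ⟨i, rfl⟩ := hx; exact ⟨_, hue i⟩
      | zero => exact ⟨0, by simp⟩
      | add x y _ _ hx hy =>
        obtain ⟨c, hc⟩ := hx
        obtain ⟨c', hc'⟩ := hy
        exact ⟨c + c', by rw [mul_add, hc, hc', add_smul]⟩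
      | smul r x _ hx =>
        obtain ⟨c, hc⟩ := hx
        exact ⟨r * c, by rw [mul_smul_comm, hc, smul_smul]⟩
    by_cases he0 : e = 0
    · rw [he0, zero_mul, zero_mul]
    have hTmul : ∀ a b, rho β (a * b) = rho β a * rho β b := rho_mul_of_groupLike hβ
    obtain ⟨x, y, hx, hy, hxy⟩ : ∃ x y, rho β x = z • x ∧ rho β y = z⁻¹ • y ∧ e * (x * y) = e := by
      by_contra! hcon
      have hcon' : ∀ x y, rho β x = z • x → rho β y = z⁻¹ • y → e * (x * y) = 0 := fun x y hx hy => by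
        obtain ⟨c, hc⟩ := he1 (x * y) (by rw [hTmul, hx, hy, smul_mul_smul_comm, mul_inv_cancel₀ hz0, one_smul])
        by_contra h0
        have hc0 : c ≠ 0 := fun h => h0 (by rw [hc, h, zero_smul])
        refine hcon (c⁻¹ • x) y (by rw [map_smul, hx, smul_comm]) hy ?_
        rw [smul_mul_assoc, mul_smul_comm, hc, smul_smul, inv_mul_cancel₀ hc0, one_smul]
      obtain ⟨c, hc⟩ : ∃ c, c = cproj p β z := ⟨_, rfl⟩
      have hcid : c * c = c := hc ▸ cproj_idem hp.pos hβp hz.pow_eq_one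
      have hcr : ∀ h, rho c h = lam c h := rho_eq_lam (hc ▸ hcc z)
      have hTc : ∀ h, rho β (rho c h) = z • rho c h := fun h => by
        have := congrArg (fun f : Module.End k H => f h) (congrArg rho (mul_cproj hp.pos hβp hz.pow_eq_one))
        rw [← hc] at this
        simpa using this
      have h1 := sw_mul_antipode (k := k) (rho c d.L) (fun x => e * x)
      rw [counit_rho, hc, d.cproj_apply_L hβ hp.pos ho, ← hc, mul_one] at h1
      have h2 : rho c d.L = lam c (rho c d.L) := by
        rw [← hcr, ← Module.End.mul_apply, ← map_mul, hcid]
      rw [h2, sw_lam c _ (fun x y => e * (x * S y)) (by fun_prop) (by fun_prop),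
        sw_rho c _ (fun x y => e * (lam c x * S y)) (by fun_prop) (by fun_prop)] at h1
      have h3 : sw k d.L (fun x y => e * (lam c x * S (rho c y))) = sw k d.L (fun _ _ => (0 : k) • e) :=
        sw_congr fun x y => by
          rw [zero_smul, ← hcr]
          exact hcon' _ _ (hTc x) (rho_antipode_of_eigen hβ hβc hz0 (hTc y))
      rw [h3, ← smul_sw, zero_smul] at h1
      exact (smul_ne_zero (inv_ne_zero (Nat.cast_ne_zero.2 hp.ne_zero)) he0) h1.symm
    exact mul_comm_of_graded hp.pos (rhoAlg hβ) hTp hz hee hec he1 hx hy hxy a b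
  calc a * b = ∑ w ∈ rou k p, cproj p u w * (a * b) := by rw [← Finset.sum_mul, sum_cproj hp.pos, one_mul]
    _ = ∑ w ∈ rou k p, cproj p u w * (b * a) := Finset.sum_congr rfl key
    _ = b * a := by rw [← Finset.sum_mul, sum_cproj hp.pos, one_mul]

theorem mul_comm_or_dual_mul_comm (dK : SSDatum k (HDual k H)) :
    (∀ a b : H, a * b = b * a) ∨ ∀ a b : HDual k H, a * b = b * a := by
  have hdK : Module.finrank k (HDual k H) = p ^ 2 := HDual.finrank_eq.trans hdim
  obtain ⟨β, hβ, hβ1, hβc, -⟩ := dK.exists_central_groupLike hp hdK (f := 1) (one_mem _)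
    (fun x _ => by rw [one_mul, mul_one]) (one_mul 1) (by rw [HDual.one_apply, Bialgebra.counit_one])
    (by rw [map_one, Module.End.one_eq_id, LinearMap.range_id, finrank_top, hdK]; exact dvd_pow_self p two_ne_zero)
  rcases orderOf_cases hp hdK hβ hβ1 with ho | ho
  swap
  · exact Or.inr (mul_comm_of_span_pow ho)
  left
  have hβp : β ^ p = 1 := ho ▸ pow_orderOf_eq_one β
  have hpk : (p : k) ≠ 0 := Nat.cast_ne_zero.2 hp.ne_zero
  have hβf := mul_cproj hp.pos hβp (one_pow p : (1 : k) ^ p = 1)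
  have hid := cproj_idem hp.pos hβp (one_pow p : (1 : k) ^ p = 1)
  have hm : cproj p β (1 : k) ∈ charAlg k H := by
    rw [cproj]
    exact Subalgebra.smul_mem _ (sum_mem fun i _ => pow_mem (Subalgebra.smul_mem _ (mem_charAlg_of_groupLike hβ) _) i) _
  have hone : (cproj p β (1 : k)) 1 = 1 := by
    have h1 : ∀ i : ℕ, (β ^ i) 1 = 1 := fun i => HDual.one_of_isGroupLikeElem hβ.pow
    rw [cproj, HDual.smul_apply, HDual.sum_apply]
    simp [h1, hpk]
  have hrk : Module.finrank k (LinearMap.range (rho (cproj p β (1 : k)))) = p := by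
    have h1 := d.apply_L_eq hid
    rw [d.cproj_apply_L hβ hp.pos ho, hdim, Nat.cast_pow, pow_two, mul_assoc, mul_inv_cancel₀ hpk, mul_one] at h1
    exact_mod_cast h1.symm
  obtain ⟨u, hu, hu1, huc, hfu⟩ := d.exists_central_groupLike hp hdim hm
    (fun x _ => cproj_commute (hβc x) 1) hid hone hrk.symm.dvd
  rcases orderOf_cases hp hdim hu hu1 with huo | huo
  · refine d.mul_comm_of_central hp hdim hβ ho hβc hu huo huc ?_
    have h1 := congrArg (fun f : HDual k H => f u) hβf
    simpa only [hu.mul_apply, one_smul, hfu, mul_one] using h1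
  · exact mul_comm_of_span_pow huo

end SSDatum
end Comm

section Classification
variable {k H : Type*} [Field k] [CharZero k] [IsAlgClosed k] [Ring H] [HopfAlgebra k H] [FiniteDimensional k H]
variable {p : ℕ} (hp : p.Prime) (hdim : Module.finrank k H = p ^ 2)

theorem SSDatum.span_dual_groupLike (d : SSDatum k H) (hc : ∀ a b : H, a * b = b * a) :
    Submodule.span k {f : HDual k H | IsGroupLikeElem k f} = ⊤ := by
  have := d.isSemisimpleRing
  obtain ⟨ι, _, e, he0, hee, -, hsum, hμ⟩ := exists_primitive_family (k := k) (A := H)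
  choose μ hμ using hμ
  have hμ' : ∀ i c, e i * c = μ i c • e i := fun i c => by
    rw [← hμ, mul_assoc, hc c, ← mul_assoc, hee]
  have hinj : ∀ i (a b : k), a • e i = b • e i → a = b := fun i a b h => smul_left_injective k (he0 i) h
  let χ : ι → HDual k H := fun i => HDual.of
    { toFun := μ i
      map_add' a b := hinj i _ _ (by rw [← hμ', mul_add, hμ', hμ', add_smul])
      map_smul' c a := hinj i _ _ (by rw [← hμ', mul_smul_comm, hμ', smul_smul]; rfl) }
  have hχ : ∀ i c, χ i c = μ i c := fun i c => rfl
  have hg : ∀ i, IsGroupLikeElem k (χ i) := fun i => HDual.isGroupLikeElem_of_mul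
    (hinj i _ _ (by rw [hχ, ← hμ', mul_one, one_smul]))
    (fun x y => hinj i _ _ (by
      rw [hχ, hχ, hχ, ← hμ', ← mul_assoc, hμ', smul_mul_assoc, hμ', smul_smul]))
  refine Submodule.eq_top_iff'.2 fun f => ?_
  have hf : f = ∑ i, f (e i) • χ i := HDual.ext fun c => by
    conv_lhs => rw [← one_mul c, ← hsum, Finset.sum_mul]
    rw [map_sum, HDual.sum_apply]
    exact Finset.sum_congr rfl fun i _ => by
      rw [hμ', map_smul, HDual.smul_apply, hχ, smul_eq_mul, mul_comm]
  rw [hf]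
  exact Submodule.sum_mem _ fun i _ => Submodule.smul_mem _ _ (Submodule.subset_span (hg i))

theorem span_groupLike_of_bidual (h : Submodule.span k {f : HDual k (HDual k H) | IsGroupLikeElem k f} = ⊤) :
    Submodule.span k {a : H | IsGroupLikeElem k a} = ⊤ := by
  have h1 : {f : HDual k (HDual k H) | IsGroupLikeElem k f} ⊆ Set.image (bid k H) {a : H | IsGroupLikeElem k a} := fun f hf => by
    obtain ⟨a, rfl⟩ := bid_surjective (k := k) (H := H) f
    have hf' : IsGroupLikeElem k (bid k H a) := hf
    refine ⟨a, isGroupLikeElem_of_rho (fun h0 => hf'.ne_zero (by rw [h0, map_zero])) fun f => ?_, rfl⟩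
    refine HDual.eq_of_forall (k := k) fun f' => ?_
    rw [apply_rho, map_smul, smul_eq_mul, mul_comm]
    exact HDual.mul_of_isGroupLikeElem hf' f' f
  have h2 := Submodule.span_mono (R := k) h1
  rw [h, Submodule.span_image, top_le_iff] at h2
  refine Submodule.eq_top_iff'.2 fun a => ?_
  have h3 : bid k H a ∈ Submodule.map (bid k H) (Submodule.span k {a : H | IsGroupLikeElem k a}) := h2 ▸ Submodule.mem_top
  obtain ⟨b, hb, hba⟩ := h3
  exact bid_injective hba ▸ hb

omit [CharZero k] [IsAlgClosed k] in
theorem finite_groupLike : Finite (GroupLike k H) := (linearIndep_groupLikeVal (R := k) (A := H)).finite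

omit [CharZero k] [IsAlgClosed k] in
theorem range_groupLike_val : Set.range (GroupLike.val (R := k) (A := H)) = {a : H | IsGroupLikeElem k a} :=
  Set.ext fun a => ⟨fun ⟨u, hu⟩ => hu ▸ u.2, fun ha => ⟨⟨a, ha⟩, rfl⟩⟩

omit [CharZero k] [IsAlgClosed k] in
theorem card_groupLike_le : Nat.card (GroupLike k H) ≤ Module.finrank k H := by
  have := finite_groupLike (k := k) (H := H)
  have := Fintype.ofFinite (GroupLike k H)
  rw [Nat.card_eq_fintype_card]
  exact (linearIndep_groupLikeVal (R := k) (A := H)).fintype_card_le_finrank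

omit [CharZero k] [IsAlgClosed k] in
theorem card_groupLike (h : Submodule.span k {a : H | IsGroupLikeElem k a} = ⊤) :
    Nat.card (GroupLike k H) = Module.finrank k H := by
  have := finite_groupLike (k := k) (H := H)
  have := Fintype.ofFinite (GroupLike k H)
  rw [Nat.card_eq_fintype_card, ← finrank_span_eq_card (linearIndep_groupLikeVal (R := k) (A := H)), range_groupLike_val, h,
    finrank_top]

omit [CharZero k] [IsAlgClosed k] [FiniteDimensional k H] in
/-- An algebra spanned by pairwise commuting elements is commutative. -/
theorem mul_comm_of_span {s : Set H} (h : Submodule.span k s = ⊤) (hs : ∀ a ∈ s, ∀ b ∈ s, a * b = b * a) (a b : H) :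
    a * b = b * a := by
  have ha : a ∈ Submodule.span k s := h ▸ Submodule.mem_top
  have hb : b ∈ Submodule.span k s := h ▸ Submodule.mem_top
  induction ha, hb using Submodule.span_induction₂ with
  | mem_mem x y hx hy => exact hs x hx y hy
  | zero_left y hy => simp
  | zero_right x hx => simp
  | add_left x y z _ _ _ hx hy => rw [add_mul, mul_add, hx, hy]
  | add_right x y z _ _ _ hx hy => rw [add_mul, mul_add, hx, hy]
  | smul_left r x y _ _ h => rw [smul_mul_assoc, mul_smul_comm, h]
  | smul_right r x y _ _ h => rw [smul_mul_assoc, mul_smul_comm, h]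

omit [CharZero k] [IsAlgClosed k] in
include hp hdim in
theorem mul_comm_of_span_groupLike (h : Submodule.span k {a : H | IsGroupLikeElem k a} = ⊤) (a b : H) : a * b = b * a := by
  have : Fact p.Prime := ⟨hp⟩
  have hc := (IsPGroup.isMulCommutative_of_card_eq_prime_sq ((card_groupLike h).trans hdim)).is_comm.comm
  exact mul_comm_of_span h (fun a ha b hb => congrArg GroupLike.val (hc ⟨a, ha⟩ ⟨b, hb⟩)) a b

include hp hdim in
theorem span_groupLike_of_ssDatum (d : SSDatum k H) (dK : SSDatum k (HDual k H)) :
    Submodule.span k {a : H | IsGroupLikeElem k a} = ⊤ := by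
  refine span_groupLike_of_bidual (dK.span_dual_groupLike ?_)
  rcases d.mul_comm_or_dual_mul_comm hp hdim dK with hc | hc
  · exact mul_comm_of_span_groupLike hp (HDual.finrank_eq.trans hdim) (d.span_dual_groupLike hc)
  · exact hc

theorem nonempty_addEquiv_of_zmodModule {V : Type*} [AddCommGroup V] [Module (ZMod p) V] (hp : p.Prime)
    (hV : Nat.card V = p ^ 2) : Nonempty ((ZMod p × ZMod p) ≃+ V) := by
  have : Fact p.Prime := ⟨hp⟩
  have : Finite V := Nat.finite_of_card_ne_zero (hV ▸ pow_ne_zero 2 hp.ne_zero)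
  have : Module.Finite (ZMod p) V := Module.Finite.of_finite
  have hr : Module.finrank (ZMod p) V = 2 :=
    Nat.pow_right_injective hp.two_le ((FiniteField.pow_finrank_eq_natCard p V).trans hV)
  exact ⟨(LinearEquiv.ofFinrankEq (R := ZMod p) (ZMod p × ZMod p) V (by
    rw [hr, Module.finrank_prod, Module.finrank_self])).toAddEquiv⟩

theorem nonempty_mulEquiv_of_exponent {G : Type*} [CommGroup G] (hp : p.Prime) (hG : Nat.card G = p ^ 2)
    (hexp : Monoid.exponent G = p) : Nonempty (Multiplicative (ZMod p × ZMod p) ≃* G) := by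
  let _ : Module (ZMod p) (Additive G) := AddCommGroup.zmodModule fun x => by
    have := Monoid.pow_exponent_eq_one (x.toMul)
    rw [hexp] at this
    exact congrArg Additive.ofMul this
  obtain ⟨e⟩ := nonempty_addEquiv_of_zmodModule (V := Additive G) hp hG
  exact ⟨(AddEquiv.toMultiplicative e).trans (MulEquiv.refl G)⟩

/-- A noncyclic group of order `p ^ 2` is elementary abelian. -/
theorem nonempty_mulEquiv_of_not_isCyclic {G : Type*} [Group G] (hp : p.Prime) (hG : Nat.card G = p ^ 2) (hc : ¬ IsCyclic G) :
    Nonempty (Multiplicative (ZMod p × ZMod p) ≃* G) := by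
  have : Fact p.Prime := ⟨hp⟩
  exact @nonempty_mulEquiv_of_exponent p G (IsPGroup.commGroupOfCardEqPrimeSq hG) hp hG
    ((not_isCyclic_iff_exponent_eq_prime hp hG).1 hc)

omit [CharZero k] [IsAlgClosed k] in
theorem isGroupAlgebraOf_of_mulEquiv {G : Type*} [Group G] (h : Submodule.span k {a : H | IsGroupLikeElem k a} = ⊤)
    (e : G ≃* GroupLike k H) : IsGroupAlgebraOf k G H := by
  refine ⟨(GroupLike.valMonoidHom (R := k) (A := H)).comp e.toMonoidHom, fun x y hxy => ?_, fun s => ?_, ?_⟩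
  · exact e.injective (GroupLike.val_injective hxy)
  · exact ⟨(e s).2.ne_zero, (e s).2.comul_eq_tmul_self⟩
  · rw [← h, ← range_groupLike_val]
    congr 1
    exact e.surjective.range_comp (GroupLike.val (R := k) (A := H))

omit [CharZero k] [IsAlgClosed k] [FiniteDimensional k H] in
theorem IsGroupLike.isGroupLikeElem {a : H} (h : IsGroupLike k a) : IsGroupLikeElem k a where
  comul_eq_tmul_self := h.2
  counit_eq_one := by
    have h1 := sw_counit_smul (k := k) a (fun x => x)
    rw [sw_of_comul a a a h.2 (fun x y => counit (R := k) x • y)] at h1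
    exact smul_left_injective k h.1 (by simpa using h1)

omit [CharZero k] [IsAlgClosed k] in
theorem IsGroupAlgebraOf.exists_injective {G : Type*} [Group G] (h : IsGroupAlgebraOf k G H) :
    ∃ φ : G →* GroupLike k H, Function.Injective φ := by
  obtain ⟨φ, hi, hg, -⟩ := h
  refine ⟨{ toFun := fun s => ⟨φ s, (hg s).isGroupLikeElem⟩, map_one' := ?_, map_mul' := ?_ }, ?_⟩
  · exact GroupLike.val_injective (map_one φ)
  · exact fun x y => GroupLike.val_injective (map_mul φ x y)
  · exact fun x y hxy => hi (congrArg GroupLike.val hxy)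

omit [CharZero k] [IsAlgClosed k] [FiniteDimensional k H] in
theorem IsGroupAlgebraOf.mul_comm {G : Type*} [CommGroup G] (h : IsGroupAlgebraOf k G H) (a b : H) : a * b = b * a := by
  obtain ⟨φ, -, -, hs⟩ := h
  refine mul_comm_of_span hs ?_ a b
  rintro _ ⟨x, rfl⟩ _ ⟨y, rfl⟩
  rw [← map_mul, _root_.mul_comm, map_mul]

omit [CharZero k] [IsAlgClosed k] in
include hp hdim in
theorem IsGroupAlgebraOf.not_prod (h : IsGroupAlgebraOf k (Multiplicative (ZMod (p ^ 2))) H) :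
    ¬ IsGroupAlgebraOf k (Multiplicative (ZMod p × ZMod p)) H := by
  intro h'
  have : NeZero p := ⟨hp.ne_zero⟩
  have := finite_groupLike (k := k) (H := H)
  obtain ⟨φ, hφ⟩ := h.exists_injective
  obtain ⟨ψ, hψ⟩ := h'.exists_injective
  have hψs : Function.Surjective ψ := by
    refine ((Nat.bijective_iff_injective_and_card ψ).2 ⟨hψ, le_antisymm (Nat.card_le_card_of_injective ψ hψ) ?_⟩).2
    refine card_groupLike_le.trans (le_of_eq ?_)
    rw [hdim, Nat.card_congr Multiplicative.toAdd, Nat.card_prod, Nat.card_zmod, pow_two]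
  have hpow : φ (Multiplicative.ofAdd 1) ^ p = 1 := by
    obtain ⟨x, hx⟩ := hψs (φ (Multiplicative.ofAdd 1))
    rw [← hx, ← map_pow, ← map_one ψ]
    congr 1
    rw [← ofAdd_toAdd x, ← ofAdd_nsmul, ← ofAdd_zero]
    congr 1
    ext <;> simp
  rw [← map_pow, ← map_one φ] at hpow
  have h1 := hφ hpow
  rw [← ofAdd_nsmul, ← ofAdd_zero] at h1
  have h2 : (p : ZMod (p ^ 2)) = 0 := by simpa using Multiplicative.ofAdd.injective h1
  rw [ZMod.natCast_eq_zero_iff] at h2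
  exact absurd (Nat.le_of_dvd hp.pos h2) (not_le.2 (lt_self_pow₀ hp.one_lt one_lt_two))

omit [CharZero k] [IsAlgClosed k] in
include hp in
theorem not_isTaftAlgebra_of_mul_comm (hc : ∀ a b : H, a * b = b * a) :
    ¬ ∃ ω : k, IsPrimitiveRoot ω p ∧ IsTaftAlgebra k (H := H) ω p := by
  rintro ⟨ω, hω, a, x, hap, hax, -, -, -, -, -, -, -, htop, hdim⟩
  have hxa : x * a = 0 := by
    rw [hc a x] at hax
    have h1 : (1 - ω) • (x * a) = 0 := by rw [sub_smul, one_smul, ← hax, sub_self]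
    exact (smul_eq_zero.1 h1).resolve_left (sub_ne_zero.2 (hω.ne_one hp.one_lt).symm)
  have hx : x = 0 := by
    have h1 : x * a ^ p = 0 := by
      rw [← Nat.sub_add_cancel hp.pos, pow_succ', ← mul_assoc, hxa, zero_mul]
    rwa [hap, mul_one] at h1
  have hle : (⊤ : Submodule k H) ≤ Submodule.span k (Set.range fun i : Fin p => a ^ (i : ℕ)) := by
    intro y _
    have hy : y ∈ Algebra.adjoin k {a, x} := htop ▸ Algebra.mem_top
    rw [hx, Set.pair_comm, Algebra.adjoin_insert_zero, Algebra.adjoin_singleton_eq_range_aeval] at hy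
    obtain ⟨q, rfl⟩ := hy
    change Polynomial.aeval a q ∈ _
    rw [Polynomial.aeval_eq_sum_range]
    refine Submodule.sum_mem _ fun i _ => Submodule.smul_mem _ _ (Submodule.subset_span ⟨⟨i % p, Nat.mod_lt _ hp.pos⟩, ?_⟩)
    exact (pow_eq_pow_mod i hap).symm
  have h1 := Submodule.finrank_mono hle
  rw [finrank_top, hdim] at h1
  have h2 : p ^ 2 ≤ p := h1.trans ((finrank_range_le_card (R := k) _).trans_eq (Fintype.card_fin p))
  exact absurd h2 (not_le.2 (lt_self_pow₀ hp.one_lt one_lt_two))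

end Classification

end HopfTheory

/-- Theorem 6.5. Every Hopf algebra of dimension `p²` over an algebraically
closed field of characteristic `0` is isomorphic to exactly one of: the group algebra
`k[ℤ/p²]`, the group algebra `k[ℤ/p × ℤ/p]`, or a Taft algebra `T(ω)` with `ω` a primitive
`p`-th root of unity. -/
theorem stmt4 (k : Type*) [Field k] [IsAlgClosed k] [CharZero k]
    (p : ℕ) (hp : p.Prime)
    (H : Type*) [Ring H] [HopfAlgebra k H] [FiniteDimensional k H]
    (hdim : Module.finrank k H = p ^ 2) :
    (IsGroupAlgebraOf k (Multiplicative (ZMod (p ^ 2))) H ∧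
        ¬ IsGroupAlgebraOf k (Multiplicative (ZMod p × ZMod p)) H ∧
        ¬ ∃ ω : k, IsPrimitiveRoot ω p ∧ IsTaftAlgebra k (H := H) ω p) ∨
      (IsGroupAlgebraOf k (Multiplicative (ZMod p × ZMod p)) H ∧
        ¬ IsGroupAlgebraOf k (Multiplicative (ZMod (p ^ 2))) H ∧
        ¬ ∃ ω : k, IsPrimitiveRoot ω p ∧ IsTaftAlgebra k (H := H) ω p) ∨
      ((∃ ω : k, IsPrimitiveRoot ω p ∧ IsTaftAlgebra k (H := H) ω p) ∧
        ¬ IsGroupAlgebraOf k (Multiplicative (ZMod (p ^ 2))) H ∧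
        ¬ IsGroupAlgebraOf k (Multiplicative (ZMod p × ZMod p)) H) := by
  obtain ⟨D⟩ := IntDatum.nonempty (k := k) (H := H)
  by_cases hg : D.g = 1
  · have hα : D.α = 1 := by
      by_contra hα
      exact D.g_ne_one hp hdim hα hg
    obtain ⟨⟨d⟩, ⟨dK⟩⟩ := IntDatum.ssDatum hp hdim D hg hα
    have hspan := span_groupLike_of_ssDatum hp hdim d dK
    have hcard := (card_groupLike hspan).trans hdim
    have hT := not_isTaftAlgebra_of_mul_comm (k := k) hp (mul_comm_of_span_groupLike hp hdim hspan)
    by_cases hc : IsCyclic (GroupLike k H)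
    · have h1 := isGroupAlgebraOf_of_mulEquiv hspan
        (mulEquivOfCyclicCardEq (G := Multiplicative (ZMod (p ^ 2))) (by
          rw [hcard, Nat.card_congr Multiplicative.toAdd, Nat.card_zmod]))
      exact Or.inl ⟨h1, h1.not_prod hp hdim, hT⟩
    · obtain ⟨e⟩ := nonempty_mulEquiv_of_not_isCyclic hp hcard hc
      have h1 := isGroupAlgebraOf_of_mulEquiv hspan e
      exact Or.inr (Or.inl ⟨h1, fun h => h.not_prod hp hdim h1, hT⟩)
  · have hT := D.exists_taft hp hdim hg
    exact Or.inr (Or.inr ⟨hT, fun h => not_isTaftAlgebra_of_mul_comm hp h.mul_comm hT,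
      fun h => not_isTaftAlgebra_of_mul_comm hp h.mul_comm hT⟩)
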